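/- For every ε ∈ (0, 1/100) there exists a constant K = K(ε) > 0 such that the following holds. Let X ≥ 1, X^ε ≤ H ≤ X^{4/7 − ε}, and z ≥ H^{4/3 + ε}. Then (1/X) ∫_X^{2X} | ∑_{(n,d): x < n d² ≤ x+H, d² > z} μ(d) − H ∑_{d: z < d² ≤ 2X} μ(d)/d² |² dx ≤ K · H^{1/2 − ε/8}. -/

import Mathlib

open MeasureTheory

/-- `∑_{(n,d) : x < n·d² ≤ x+H, d² > z} μ(d)`, where `n, d` range over positive integers.
(Any `d` with `d² > x + H` contributes nothing since the inner range of `n` is empty.) -/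
noncomputable def pairShortGT (x H z : ℝ) : ℝ :=
  ∑ d ∈ (Finset.Icc 1 ⌊Real.sqrt (x + H)⌋₊).filter (fun d : ℕ => z < (d : ℝ) ^ 2),
    ∑ _n ∈ Finset.Ioc ⌊x / (d : ℝ) ^ 2⌋₊ ⌊(x + H) / (d : ℝ) ^ 2⌋₊,
      (ArithmeticFunction.moebius d : ℝ)

/-- `∑_{d : z < d² ≤ w} μ(d)/d²`. -/
noncomputable def mertensRange (z w : ℝ) : ℝ :=
  ∑ d ∈ (Finset.Icc 1 ⌊Real.sqrt w⌋₊).filter (fun d : ℕ => z < (d : ℝ) ^ 2),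
    (ArithmeticFunction.moebius d : ℝ) / (d : ℝ) ^ 2

namespace LargeDivisors

/-- The additive character `x ↦ exp (2πix)`. -/
noncomputable def ex (x : ℝ) : ℂ := Complex.exp (((2 * Real.pi * x : ℝ) : ℂ) * Complex.I)

lemma norm_ex (x : ℝ) : ‖ex x‖ = 1 := Complex.norm_exp_ofReal_mul_I _

lemma ex_add (x y : ℝ) : ex (x + y) = ex x * ex y := by
  rw [ex, ex, ex, ← Complex.exp_add]; push_cast; ring_nf

lemma ex_int (n : ℤ) : ex n = 1 := by
  rw [ex, Complex.exp_eq_one_iff]; exact ⟨n, by push_cast; ring⟩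

lemma ex_zero : ex 0 = 1 := by simpa using ex_int 0

lemma conj_ex (x : ℝ) : (starRingEnd ℂ) (ex x) = ex (-x) := by
  rw [ex, ex, ← Complex.exp_conj, map_mul, Complex.conj_ofReal, Complex.conj_I]
  push_cast; ring_nf

/-- The function `(1 + i cot πg)/2 = 1/(1 - e(g))`. -/
lemma one_sub_ex_mul (g : ℝ) (h : Real.sin (Real.pi * g) ≠ 0) :
    (1 - ex g) * ((1 + Complex.I * (Real.cos (Real.pi * g) / Real.sin (Real.pi * g) : ℝ)) / 2) = 1 := by
  have h1 : ex g = (Real.cos (2 * (Real.pi * g)) : ℂ) + (Real.sin (2 * (Real.pi * g)) : ℂ) * Complex.I := by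
    rw [ex, Complex.exp_mul_I]; push_cast; ring_nf
  rw [h1, Real.cos_two_mul, Real.sin_two_mul]
  have hcs : ((Real.sin (Real.pi * g) : ℂ)) ^ 2 + (Real.cos (Real.pi * g) : ℂ) ^ 2 = 1 := by
    exact_mod_cast Real.sin_sq_add_cos_sq _
  have hs : (Real.sin (Real.pi * g) : ℂ) ≠ 0 := by exact_mod_cast h
  simp only [Complex.ofReal_sub, Complex.ofReal_mul, Complex.ofReal_pow, Complex.ofReal_div, Complex.ofReal_one, Complex.ofReal_ofNat]
  generalize (Real.cos (Real.pi * g) : ℂ) = c at *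
  generalize (Real.sin (Real.pi * g) : ℂ) = s at *
  field_simp
  linear_combination (-2 * c ^ 2 * s) * Complex.I_sq + (-2 * c * Complex.I) * hcs

lemma sin_pi_mul_ge {g δ : ℝ} (hδ : 0 < δ) (h1 : δ ≤ g) (h2 : g ≤ 1 - δ) :
    2 * δ ≤ Real.sin (Real.pi * g) := by
  have hpi := Real.pi_pos
  rcases le_total g (1 / 2) with h | h
  · have := Real.mul_le_sin (x := Real.pi * g) (by nlinarith) (by nlinarith)
    have e : 2 / Real.pi * (Real.pi * g) = 2 * g := by field_simp
    linarith
  · have := Real.mul_le_sin (x := Real.pi * (1 - g)) (by nlinarith) (by nlinarith)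
    have e : 2 / Real.pi * (Real.pi * (1 - g)) = 2 * (1 - g) := by field_simp
    have e2 : Real.sin (Real.pi * (1 - g)) = Real.sin (Real.pi * g) := by
      rw [← Real.sin_pi_sub]; ring_nf
    linarith

lemma cot_antitone {x y δ : ℝ} (hδ : 0 < δ) (hx : δ ≤ x) (hxy : x ≤ y) (hy : y ≤ 1 - δ) :
    Real.cos (Real.pi * y) / Real.sin (Real.pi * y) ≤
      Real.cos (Real.pi * x) / Real.sin (Real.pi * x) := by
  have sx := sin_pi_mul_ge hδ hx (hxy.trans hy)
  have sy := sin_pi_mul_ge hδ (hx.trans hxy) hy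
  rw [div_le_div_iff₀ (by linarith) (by linarith)]
  have hpi := Real.pi_pos
  have : 0 ≤ Real.sin (Real.pi * y - Real.pi * x) :=
    Real.sin_nonneg_of_nonneg_of_le_pi (by nlinarith) (by nlinarith)
  rw [Real.sin_sub] at this
  linarith

lemma abs_cot_le {x δ : ℝ} (hδ : 0 < δ) (hx : δ ≤ x) (hy : x ≤ 1 - δ) :
    |Real.cos (Real.pi * x) / Real.sin (Real.pi * x)| ≤ 1 / (2 * δ) := by
  have sx := sin_pi_mul_ge hδ hx hy
  rw [abs_div, abs_of_pos (show 0 < Real.sin (Real.pi * x) by linarith)]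
  exact div_le_div₀ zero_le_one (Real.abs_cos_le_one _) (by linarith) sx

/-- The Kusmin–Landau inequality. -/
lemma kusmin_landau (f : ℕ → ℝ) (ν : ℤ) {δ : ℝ} (hδ : 0 < δ) (a b : ℕ) (hab : a ≤ b)
    (h1 : ∀ n ∈ Finset.Icc a b, ν + δ ≤ f (n + 1) - f n ∧ f (n + 1) - f n ≤ ν + 1 - δ)
    (h2 : ∀ n ∈ Finset.Ico a b, f (n + 2) - f (n + 1) ≤ f (n + 1) - f n) :
    ‖∑ n ∈ Finset.Icc a b, ex (f n)‖ ≤ 2 / δ := by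
  set g : ℕ → ℝ := fun n => f (n + 1) - f n - ν with hg
  set ct : ℕ → ℝ := fun n => Real.cos (Real.pi * g n) / Real.sin (Real.pi * g n) with hct
  set c : ℕ → ℂ := fun n => (1 + Complex.I * (ct n : ℂ)) / 2 with hc
  have hb1 : ∀ n ∈ Finset.Icc a b, δ ≤ g n ∧ g n ≤ 1 - δ := fun n hn => by
    have := h1 n hn; constructor <;> simp only [hg] <;> linarith
  have hz : ∀ n ∈ Finset.Icc a b, ex (f n) = (ex (f n) - ex (f (n + 1))) * c n := fun n hn => by
    have hs := sin_pi_mul_ge hδ (hb1 n hn).1 (hb1 n hn).2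
    have e := one_sub_ex_mul (g n) (by linarith)
    have : ex (f (n + 1)) = ex (f n) * ex (g n) := by
      have : f (n + 1) = f n + g n + ν := by simp only [hg]; ring
      rw [this, ex_add, ex_add, ex_int, mul_one]
    rw [this]
    linear_combination (-ex (f n)) * e
  have key : ∀ m, a ≤ m → m ≤ b → ‖∑ n ∈ Finset.Icc a m, ex (f n) + ex (f (m + 1)) * c m
      - ex (f a) * c a‖ ≤ (ct m - ct a) / 2 := by
    intro m ham
    induction m, ham using Nat.le_induction with
    | base =>
      intro hb
      have := hz a (by simp [hab])
      simp only [Finset.Icc_self, Finset.sum_singleton, sub_self, zero_div]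
      rw [show ex (f a) + ex (f (a + 1)) * c a - ex (f a) * c a = 0 by
        linear_combination this]
      simp
    | succ m ham ih =>
      intro hb
      have ih := ih (by omega)
      have hzz := hz (m + 1) (by simp; omega)
      rw [Finset.sum_Icc_succ_top (by omega)]
      have hm : ct m ≤ ct (m + 1) := by
        have i1 := hb1 m (by simp; omega)
        have i2 := hb1 (m + 1) (by simp; omega)
        have := h2 m (by simp; omega)
        exact cot_antitone hδ i2.1 (by simp only [hg]; linarith) i1.2
      have e : ∑ n ∈ Finset.Icc a m, ex (f n) + ex (f (m + 1)) + ex (f (m + 1 + 1)) * c (m + 1)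
          - ex (f a) * c a = (∑ n ∈ Finset.Icc a m, ex (f n) + ex (f (m + 1)) * c m
          - ex (f a) * c a) + ex (f (m + 1)) * (c (m + 1) - c m) := by
        linear_combination hzz
      rw [e]
      refine (norm_add_le _ _).trans ?_
      have e2 : ‖ex (f (m + 1)) * (c (m + 1) - c m)‖ = (ct (m + 1) - ct m) / 2 := by
        rw [norm_mul, norm_ex, one_mul]
        have : c (m + 1) - c m = Complex.I * (((ct (m + 1) - ct m) / 2 : ℝ) : ℂ) := by
          simp only [hc]; push_cast; ring
        rw [this, norm_mul, Complex.norm_I, one_mul, Complex.norm_real, Real.norm_of_nonneg]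
        linarith
      rw [e2]; linarith
  have hk := key b hab le_rfl
  have ia := hb1 a (by simp [hab])
  have ib := hb1 b (by simp [hab])
  have ca := abs_le.1 (abs_cot_le hδ ia.1 ia.2)
  have cb := abs_le.1 (abs_cot_le hδ ib.1 ib.2)
  have hδ1 : δ ≤ 1 / 2 := by linarith [ia.1, ia.2]
  have hδ2 : 1 ≤ 1 / (2 * δ) := by rw [le_div_iff₀ (by linarith)]; linarith
  have nc : ∀ n, |ct n| ≤ 1 / (2 * δ) → ‖c n‖ ≤ 1 / (2 * δ) := fun n hn => by
    simp only [hc]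
    rw [norm_div, Complex.norm_ofNat]
    have : ‖1 + Complex.I * (ct n : ℂ)‖ ≤ 1 + |ct n| := by
      refine (norm_add_le _ _).trans ?_
      simp
    linarith
  have na := nc a (abs_le.2 ca)
  have nb := nc b (abs_le.2 cb)
  have t1 : ‖∑ n ∈ Finset.Icc a b, ex (f n)‖ ≤ ‖∑ n ∈ Finset.Icc a b, ex (f n) + ex (f (b + 1)) * c b
      - ex (f a) * c a‖ + ‖ex (f (b + 1)) * c b‖ + ‖ex (f a) * c a‖ := by
    have e : ∑ n ∈ Finset.Icc a b, ex (f n) = (∑ n ∈ Finset.Icc a b, ex (f n)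
      + ex (f (b + 1)) * c b - ex (f a) * c a) - ex (f (b + 1)) * c b + ex (f a) * c a := by ring
    calc _ = ‖(∑ n ∈ Finset.Icc a b, ex (f n) + ex (f (b + 1)) * c b - ex (f a) * c a)
          - ex (f (b + 1)) * c b + ex (f a) * c a‖ := congrArg norm e
      _ ≤ _ := (norm_add_le _ _).trans (add_le_add (norm_sub_le _ _) le_rfl)
  rw [norm_mul, norm_mul, norm_ex, norm_ex, one_mul, one_mul] at t1
  have : (2:ℝ) / δ = 4 * (1 / (2 * δ)) := by field_simp; norm_num
  rw [this]
  linarith [ca.1, cb.2]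

lemma filter_Icc_eq_Icc (a b : ℕ) (p : ℕ → Prop) [DecidablePred p]
    (hp : ∀ x y z, a ≤ x → x ≤ y → y ≤ z → z ≤ b → p x → p z → p y) :
    (Finset.Icc a b).filter p = ∅ ∨ ∃ a' b', a ≤ a' ∧ a' ≤ b' ∧ b' ≤ b ∧
      (Finset.Icc a b).filter p = Finset.Icc a' b' := by
  rcases ((Finset.Icc a b).filter p).eq_empty_or_nonempty with h | h
  · exact Or.inl h
  · right
    have m1 := Finset.min'_mem _ h
    have m2 := Finset.max'_mem _ h
    set u := ((Finset.Icc a b).filter p).min' h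
    set v := ((Finset.Icc a b).filter p).max' h
    simp only [Finset.mem_filter, Finset.mem_Icc] at m1 m2
    refine ⟨u, v, m1.1.1, Finset.min'_le_max' _ h, m2.1.2, ?_⟩
    ext n
    constructor
    · intro hn
      exact Finset.mem_Icc.2 ⟨Finset.min'_le _ _ hn, Finset.le_max' _ _ hn⟩
    · intro hn
      rw [Finset.mem_Icc] at hn
      simp only [Finset.mem_filter, Finset.mem_Icc]
      exact ⟨⟨m1.1.1.trans hn.1, hn.2.trans m2.1.2⟩,
        hp u n v m1.1.1 hn.1 hn.2 m2.1.2 m1.2 m2.2⟩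

/-- The trivial bound for an exponential sum over a set on which the differences of the phase
vary by at most `δ`. -/
lemma norm_sum_le_of_close (f g : ℕ → ℝ) {l δ : ℝ} (hl : 0 < l) (a b : ℕ) (hab : a ≤ b)
    (hg : ∀ x y, a ≤ x → x ≤ y → y ≤ b → l * (y - x) ≤ g x - g y) (h : g a - g b ≤ δ) :
    ‖∑ n ∈ Finset.Icc a b, ex (f n)‖ ≤ δ / l + 1 := by
  have h1 := hg a b le_rfl hab le_rfl
  have h2 : (b : ℝ) - a ≤ δ / l := by rw [le_div_iff₀ hl]; linarith
  refine (norm_sum_le _ _).trans ?_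
  simp only [norm_ex, Finset.sum_const, Nat.card_Icc, nsmul_eq_mul, mul_one]
  rw [Nat.cast_sub (by omega)]
  push_cast; linarith

/-- Van der Corput's second derivative test, in terms of finite differences. -/
lemma second_derivative_test (f : ℕ → ℝ) {l : ℝ} (hl : 0 < l) (hl1 : l ≤ 1) (a b : ℕ)
    (hab : a ≤ b) (h : ∀ n ∈ Finset.Ico a b,
      l ≤ (f (n + 1) - f n) - (f (n + 2) - f (n + 1))) :
    ‖∑ n ∈ Finset.Icc a b, ex (f n)‖ ≤
      ((f (a + 1) - f a) - (f (b + 1) - f b) + 2) * (6 / Real.sqrt l) := by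
  set g : ℕ → ℝ := fun n => f (n + 1) - f n with hgdef
  have hg : ∀ x y, a ≤ x → x ≤ y → y ≤ b → l * (y - x) ≤ g x - g y := by
    intro x y hax hxy
    induction y, hxy using Nat.le_induction with
    | base => intro _; simp
    | succ y hy ih =>
      intro hb
      have i1 := ih (by omega)
      have i2 := h y (by simp; omega)
      simp only [hgdef] at *
      push_cast
      linarith
  have hanti : ∀ x y, a ≤ x → x ≤ y → y ≤ b → g y ≤ g x := fun x y h1 h2 h3 => by
    have := hg x y h1 h2 h3
    have : (x : ℝ) ≤ y := by exact_mod_cast h2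
    nlinarith
  have hfib : ∀ ν : ℤ, ‖∑ n ∈ (Finset.Icc a b).filter (fun n => ⌊g n⌋ = ν), ex (f n)‖ ≤
      6 / Real.sqrt l := by
    intro ν
    set δ := Real.sqrt l with hδ
    have hδ0 : 0 < δ := Real.sqrt_pos.2 hl
    have hδ1 : δ ≤ 1 := Real.sqrt_le_one.2 hl1
    have hδδ : δ / l = 1 / δ := by
      rw [div_eq_div_iff hl.ne' hδ0.ne', one_mul, Real.mul_self_sqrt hl.le]
    have hδi : 1 ≤ 1 / δ := by rw [le_div_iff₀ hδ0]; linarith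
    have close : ∀ (p : ℕ → Prop) [DecidablePred p],
        (∀ x y z, a ≤ x → x ≤ y → y ≤ z → z ≤ b → p x → p z → p y) →
        (∀ x y, p x → p y → g x - g y ≤ δ) →
        ‖∑ n ∈ (Finset.Icc a b).filter p, ex (f n)‖ ≤ 2 / δ := by
      intro p _ hp hp2
      rcases filter_Icc_eq_Icc a b p hp with h | ⟨a', b', h1, h2, h3, h4⟩
      · rw [h]; simp; positivity
      · rw [h4]
        have q : ∀ n ∈ Finset.Icc a' b', p n := fun n hn => by
          rw [← h4] at hn; exact (Finset.mem_filter.1 hn).2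
        refine (norm_sum_le_of_close f g (δ := δ) hl a' b' h2 (fun x y hx hxy hy =>
          hg x y (h1.trans hx) hxy (hy.trans h3))
          (hp2 _ _ (q a' (by simp [h2])) (q b' (by simp [h2])))).trans ?_
        rw [hδδ]
        have : 2 / δ = 1 / δ + 1 / δ := by ring
        linarith
    have s1 := close (fun n => ⌊g n⌋ = ν ∧ g n < ν + δ) (by
      intro x y z hx hxy hyz hz px pz
      have e1 := hanti x y hx hxy (hyz.trans hz)
      have e2 := hanti y z (hx.trans hxy) hyz hz
      refine ⟨le_antisymm ?_ ?_, by linarith [px.2]⟩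
      · rw [← px.1]; exact Int.floor_mono e1
      · rw [← pz.1]; exact Int.floor_mono e2) (by
      intro x y px py
      have := Int.floor_le (g y)
      rw [py.1] at this
      linarith [px.2])
    have s2 := close (fun n => ⌊g n⌋ = ν ∧ ν + δ ≤ g n ∧ ν + 1 - δ < g n) (by
      intro x y z hx hxy hyz hz px pz
      have e1 := hanti x y hx hxy (hyz.trans hz)
      have e2 := hanti y z (hx.trans hxy) hyz hz
      refine ⟨le_antisymm ?_ ?_, by linarith [pz.2.1], by linarith [pz.2.2]⟩
      · rw [← px.1]; exact Int.floor_mono e1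
      · rw [← pz.1]; exact Int.floor_mono e2) (by
      intro x y px py
      have := Int.lt_floor_add_one (g x)
      rw [px.1] at this
      linarith [py.2.2])
    have s3 : ‖∑ n ∈ (Finset.Icc a b).filter
        (fun n => ⌊g n⌋ = ν ∧ ν + δ ≤ g n ∧ g n ≤ ν + 1 - δ), ex (f n)‖ ≤ 2 / δ := by
      rcases filter_Icc_eq_Icc a b (fun n => ⌊g n⌋ = ν ∧ ν + δ ≤ g n ∧ g n ≤ ν + 1 - δ) (by
        intro x y z hx hxy hyz hz px pz
        have e1 := hanti x y hx hxy (hyz.trans hz)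
        have e2 := hanti y z (hx.trans hxy) hyz hz
        refine ⟨le_antisymm ?_ ?_, by linarith [pz.2.1], by linarith [px.2.2]⟩
        · rw [← px.1]; exact Int.floor_mono e1
        · rw [← pz.1]; exact Int.floor_mono e2) with h | ⟨a', b', h1, h2, h3, h4⟩
      · rw [h]; simp; positivity
      · rw [h4]
        refine kusmin_landau f ν hδ0 a' b' h2 (fun n hn => ?_) (fun n hn => ?_)
        · rw [← h4] at hn; exact (Finset.mem_filter.1 hn).2.2
        · rw [Finset.mem_Ico] at hn
          exact hanti n (n + 1) (h1.trans hn.1) (by omega) (by omega)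
    have split : ∑ n ∈ (Finset.Icc a b).filter (fun n => ⌊g n⌋ = ν), ex (f n) =
        ∑ n ∈ (Finset.Icc a b).filter (fun n => ⌊g n⌋ = ν ∧ ν + δ ≤ g n ∧ g n ≤ ν + 1 - δ), ex (f n)
        + ∑ n ∈ (Finset.Icc a b).filter (fun n => ⌊g n⌋ = ν ∧ g n < ν + δ), ex (f n)
        + ∑ n ∈ (Finset.Icc a b).filter (fun n => ⌊g n⌋ = ν ∧ ν + δ ≤ g n ∧ ν + 1 - δ < g n),
          ex (f n) := by
      simp only [Finset.sum_filter, ← Finset.sum_add_distrib]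
      refine Finset.sum_congr rfl fun n _ => ?_
      by_cases c1 : ⌊g n⌋ = ν <;> by_cases c2 : g n < ν + δ <;> by_cases c3 : ν + 1 - δ < g n <;>
        simp [c1, c2, c3, not_le.2, not_lt.1]
    rw [split]
    refine (norm_add₃_le).trans ?_
    have : 6 / δ = 2 / δ + 2 / δ + 2 / δ := by ring
    linarith
  have e : ∑ n ∈ Finset.Icc a b, ex (f n) = ∑ ν ∈ Finset.Icc ⌊g b⌋ ⌊g a⌋,
      ∑ n ∈ (Finset.Icc a b).filter (fun n => ⌊g n⌋ = ν), ex (f n) := by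
    rw [Finset.sum_fiberwise_of_maps_to]
    intro n hn
    rw [Finset.mem_Icc] at *
    exact ⟨Int.floor_mono (hanti n b hn.1 hn.2 le_rfl), Int.floor_mono (hanti a n le_rfl hn.1 hn.2)⟩
  rw [e]
  refine (norm_sum_le _ _).trans ((Finset.sum_le_sum fun ν _ => hfib ν).trans ?_)
  rw [Finset.sum_const, nsmul_eq_mul, Int.card_Icc]
  refine mul_le_mul_of_nonneg_right ?_ (by positivity)
  have hfl : ⌊g b⌋ ≤ ⌊g a⌋ := Int.floor_mono (hanti a b le_rfl hab le_rfl)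
  have : (((⌊g a⌋ + 1 - ⌊g b⌋).toNat : ℤ) : ℝ) = ⌊g a⌋ + 1 - ⌊g b⌋ := by
    rw [Int.toNat_of_nonneg (by omega)]; push_cast; ring
  rw [Int.cast_natCast] at this
  rw [this]
  have := Int.floor_le (g a)
  have := Int.lt_floor_add_one (g b)
  simp only [hgdef] at *
  linarith

set_option maxHeartbeats 1000000 in
/-- Van der Corput's (Weyl's) differencing inequality. -/
lemma weyl_vdc (f : ℕ → ℝ) (a b Q : ℕ) (hab : a ≤ b) {B : ℝ} (hB : 0 ≤ B)
    (h : ∀ q, 1 ≤ q → q < Q → ‖∑ n ∈ Finset.Ioc a (b - q), ex (f (n + q) - f n)‖ ≤ B) :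
    (Q : ℝ) ^ 2 * ‖∑ n ∈ Finset.Ioc a b, ex (f n)‖ ^ 2 ≤
      ((b - a : ℝ) + Q) * (Q * (b - a) + Q ^ 2 * B) := by
  set z : ℕ → ℕ → ℂ := fun q m => if a + q < m ∧ m ≤ b + q then ex (f (m - q)) else 0 with hz
  set I := Finset.Ioc a (b + Q)
  have hsum : ∀ q ∈ Finset.range Q, ∑ m ∈ I, z q m = ∑ n ∈ Finset.Ioc a b, ex (f n) := by
    intro q hq
    rw [Finset.mem_range] at hq
    simp only [hz]
    rw [← Finset.sum_filter]
    symm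
    refine Finset.sum_bij (fun n _ => n + q) ?_ ?_ ?_ ?_
    · intro n hn; simp only [I, Finset.mem_filter, Finset.mem_Ioc] at *; omega
    · intro n _ m _ h; omega
    · intro m hm
      simp only [I, Finset.mem_filter, Finset.mem_Ioc] at hm
      exact ⟨m - q, by simp only [Finset.mem_Ioc]; omega, by omega⟩
    · intro n hn; simp
  have hcorr : ∀ q₁ q₂, q₁ < q₂ → q₂ < Q → ‖∑ m ∈ I, z q₁ m * (starRingEnd ℂ) (z q₂ m)‖ ≤ B := by
    intro q₁ q₂ h12 h2
    refine le_trans (le_of_eq (congrArg norm ?_)) (h (q₂ - q₁) (by omega) (by omega))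
    have : ∀ m, z q₁ m * (starRingEnd ℂ) (z q₂ m) =
        if a + q₂ < m ∧ m ≤ b + q₁ then ex (f (m - q₁) - f (m - q₂)) else 0 := by
      intro m
      simp only [hz]
      split_ifs <;> first | omega | simp only [map_zero, mul_zero, zero_mul] | skip
      rw [conj_ex, ← ex_add, sub_eq_add_neg]
    simp only [this]
    rw [← Finset.sum_filter]
    symm
    refine Finset.sum_bij (fun n _ => n + q₂) ?_ ?_ ?_ ?_
    · intro n hn; simp only [I, Finset.mem_filter, Finset.mem_Ioc] at *; omega
    · intro n _ m _ h; omega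
    · intro m hm
      simp only [I, Finset.mem_filter, Finset.mem_Ioc] at hm
      exact ⟨m - q₂, by simp only [Finset.mem_Ioc]; omega, by omega⟩
    · intro n hn
      rw [Nat.add_sub_cancel, show n + q₂ - q₁ = n + (q₂ - q₁) by omega]
  have hdiag : ∀ q ∈ Finset.range Q, ‖∑ m ∈ I, z q m * (starRingEnd ℂ) (z q m)‖ ≤ b - a := by
    intro q hq
    have : ∀ m, z q m * (starRingEnd ℂ) (z q m) = if a + q < m ∧ m ≤ b + q then 1 else 0 := by
      intro m
      simp only [hz]
      split_ifs
      · rw [conj_ex, ← ex_add, add_neg_cancel, ex_zero]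
      · simp
    simp only [this]
    rw [Finset.sum_boole, Complex.norm_natCast]
    have : (Finset.filter (fun m => a + q < m ∧ m ≤ b + q) I).card ≤ b - a := by
      have : Finset.filter (fun m => a + q < m ∧ m ≤ b + q) I ⊆ Finset.Ioc (a + q) (b + q) := by
        intro m hm; simp at hm ⊢; exact hm.2
      refine (Finset.card_le_card this).trans ?_
      simp; omega
    calc _ ≤ (((b - a : ℕ)) : ℝ) := by exact_mod_cast this
      _ = _ := by rw [Nat.cast_sub hab]
  have e1 : (Q : ℂ) * ∑ n ∈ Finset.Ioc a b, ex (f n) = ∑ m ∈ I, ∑ q ∈ Finset.range Q, z q m := by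
    rw [Finset.sum_comm, Finset.sum_congr rfl hsum]; simp
  have e2 : (Q : ℝ) ^ 2 * ‖∑ n ∈ Finset.Ioc a b, ex (f n)‖ ^ 2 =
      ‖∑ m ∈ I, ∑ q ∈ Finset.range Q, z q m‖ ^ 2 := by
    rw [← e1, norm_mul, mul_pow]; simp
  have e3 : ‖∑ m ∈ I, ∑ q ∈ Finset.range Q, z q m‖ ^ 2 ≤
      (I.card : ℝ) * ∑ m ∈ I, ‖∑ q ∈ Finset.range Q, z q m‖ ^ 2 := by
    refine (pow_le_pow_left₀ (norm_nonneg _) (norm_sum_le _ _) 2).trans ?_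
    exact sq_sum_le_card_mul_sum_sq
  have hcard : (I.card : ℝ) = b - a + Q := by
    simp only [I, Nat.card_Ioc]
    rw [Nat.cast_sub (by omega)]; push_cast; ring
  have e4 : ((∑ m ∈ I, ‖∑ q ∈ Finset.range Q, z q m‖ ^ 2 : ℝ) : ℂ) =
      ∑ q₁ ∈ Finset.range Q, ∑ q₂ ∈ Finset.range Q, ∑ m ∈ I, z q₁ m * (starRingEnd ℂ) (z q₂ m) := by
    simp only [Complex.ofReal_sum, Complex.ofReal_pow]
    simp only [← Complex.mul_conj', map_sum, Finset.sum_mul_sum]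
    rw [Finset.sum_comm]
    exact Finset.sum_congr rfl fun q _ => Finset.sum_comm
  have e5 : ∑ m ∈ I, ‖∑ q ∈ Finset.range Q, z q m‖ ^ 2 ≤ Q * (b - a) + Q ^ 2 * B := by
    have : ∑ m ∈ I, ‖∑ q ∈ Finset.range Q, z q m‖ ^ 2 =
        ‖((∑ m ∈ I, ‖∑ q ∈ Finset.range Q, z q m‖ ^ 2 : ℝ) : ℂ)‖ := by
      rw [Complex.norm_real, Real.norm_of_nonneg (Finset.sum_nonneg fun _ _ => sq_nonneg _)]
    rw [this, e4]
    clear e4 this e3 e2 e1 hcard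
    have hab' : (0:ℝ) ≤ b - a := by
      have : (a:ℝ) ≤ b := by exact_mod_cast hab
      linarith
    calc _ ≤ ∑ q₁ ∈ Finset.range Q, ∑ q₂ ∈ Finset.range Q,
          ‖∑ m ∈ I, z q₁ m * (starRingEnd ℂ) (z q₂ m)‖ :=
        (norm_sum_le _ _).trans (Finset.sum_le_sum fun _ _ => norm_sum_le _ _)
      _ ≤ ∑ q₁ ∈ Finset.range Q, ∑ q₂ ∈ Finset.range Q, ((if q₁ = q₂ then (b - a : ℝ) else 0) + B) := by
        refine Finset.sum_le_sum fun q₁ h1 => Finset.sum_le_sum fun q₂ h2 => ?_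
        rcases lt_trichotomy q₁ q₂ with h | h | h
        · rw [if_neg h.ne, zero_add]; exact hcorr _ _ h (Finset.mem_range.1 h2)
        · subst h; simp only [if_true]; linarith [hdiag _ h1]
        · rw [if_neg h.ne', zero_add]
          refine le_trans (le_of_eq ?_) (hcorr _ _ h (Finset.mem_range.1 h1))
          rw [← Complex.norm_conj, map_sum]
          congr 1
          refine Finset.sum_congr rfl fun m _ => ?_
          rw [map_mul, Complex.conj_conj, mul_comm]
      _ = _ := by
        have : ∀ q₁ ∈ Finset.range Q, ∑ q₂ ∈ Finset.range Q, ((if q₁ = q₂ then (b - a : ℝ) else 0) + B)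
            = (b - a) + Q * B := fun q₁ h1 => by
          rw [Finset.sum_add_distrib, Finset.sum_ite_eq, if_pos h1]; simp
        rw [Finset.sum_congr rfl this]
        simp only [Finset.sum_const, Finset.card_range, nsmul_eq_mul]
        ring
  rw [e2]
  refine e3.trans ?_
  rw [hcard]
  refine mul_le_mul_of_nonneg_left e5 ?_
  rw [← hcard]; exact Nat.cast_nonneg _

/-- Gap between consecutive differences of `log`. -/
lemma log_second_diff {n : ℕ} (hn : 1 ≤ n) :
    1 / ((n : ℝ) + 1) ^ 2 ≤ (Real.log ((n + 1 : ℕ) : ℝ) - Real.log n) -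
      (Real.log ((n + 2 : ℕ) : ℝ) - Real.log ((n + 1 : ℕ) : ℝ)) := by
  have h0 : (0:ℝ) < n := by exact_mod_cast hn
  have e : (Real.log ((n + 1 : ℕ) : ℝ) - Real.log n) -
      (Real.log ((n + 2 : ℕ) : ℝ) - Real.log ((n + 1 : ℕ) : ℝ)) =
      -Real.log ((n * (n + 2)) / (n + 1) ^ 2) := by
    rw [Real.log_div (by positivity) (by positivity), Real.log_mul h0.ne' (by positivity), Real.log_pow]
    push_cast; ring
  rw [e]
  have := Real.log_le_sub_one_of_pos (x := (n * ((n:ℝ) + 2)) / (n + 1) ^ 2) (by positivity)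
  have e2 : (n * ((n:ℝ) + 2)) / (n + 1) ^ 2 = 1 - 1 / ((n : ℝ) + 1) ^ 2 := by
    field_simp; ring
  linarith

lemma log_diff_bounds {n : ℕ} (hn : 1 ≤ n) :
    1 / ((n : ℝ) + 1) ≤ Real.log ((n + 1 : ℕ) : ℝ) - Real.log n ∧
      Real.log ((n + 1 : ℕ) : ℝ) - Real.log n ≤ 1 / n := by
  have h0 : (0:ℝ) < n := by exact_mod_cast hn
  rw [← Real.log_div (by positivity) h0.ne']
  constructor
  · have := Real.one_sub_inv_le_log_of_pos (x := ((n + 1 : ℕ) : ℝ) / n) (by positivity)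
    refine le_trans (le_of_eq ?_) this
    push_cast; field_simp; ring
  · have := Real.log_le_sub_one_of_pos (x := ((n + 1 : ℕ) : ℝ) / n) (by positivity)
    refine this.trans (le_of_eq ?_)
    push_cast; field_simp; ring

/-- Bound for the zeta sum over a dyadic interval, useful for either small or large frequency. -/
lemma norm_sum_ex_log_le (D : ℕ) (hD : 1 ≤ D) {c : ℝ} (hc : 0 ≤ c) :
    ‖∑ n ∈ Finset.Ioc D (2 * D), ex (c * Real.log n)‖ ≤ 12 * D / (1 + c) + 60 * Real.sqrt c := by
  have hD0 : (1:ℝ) ≤ D := by exact_mod_cast hD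
  have triv : ‖∑ n ∈ Finset.Ioc D (2 * D), ex (c * Real.log n)‖ ≤ D := by
    refine (norm_sum_le _ _).trans ?_
    simp only [norm_ex, Finset.sum_const, Nat.card_Ioc, nsmul_eq_mul, mul_one]
    rw [Nat.cast_sub (by omega)]; push_cast; linarith
  have hI : Finset.Ioc D (2 * D) = Finset.Icc (D + 1) (2 * D) := by
    ext n; simp only [Finset.mem_Ioc, Finset.mem_Icc]; omega
  have hs := Real.sqrt_nonneg c
  rcases le_total c 1 with h1 | h1
  · have : (D:ℝ) ≤ 12 * D / (1 + c) := by
      rw [le_div_iff₀ (by linarith)]; nlinarith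
    linarith
  rcases le_total c (D / 2) with h2 | h2
  · have := kusmin_landau (fun n => c * Real.log n) 0 (δ := c / (3 * D)) (by positivity) (D + 1) (2 * D)
      (by omega) (fun n hn => by
        rw [Finset.mem_Icc] at hn
        have hb := log_diff_bounds (n := n) (by omega)
        have l1 : (D:ℝ) + 1 ≤ n := by exact_mod_cast hn.1
        have l2 : (n:ℝ) ≤ 2 * D := by exact_mod_cast hn.2
        have i1 : 1 / (3 * (D:ℝ)) ≤ 1 / ((n:ℝ) + 1) := one_div_le_one_div_of_le (by linarith) (by linarith)
        have i2 : 1 / (n:ℝ) ≤ 1 / D := one_div_le_one_div_of_le (by linarith) (by linarith)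
        have i3 : c * (1 / (D:ℝ)) ≤ 1 / 2 := by rw [mul_one_div, div_le_iff₀ (by linarith)]; linarith
        have i4 : c / (3 * D) = c * (1 / (3 * (D:ℝ))) := by ring
        have i5 : c * (1 / (3 * (D:ℝ))) = c * (1 / (D:ℝ)) / 3 := by ring
        simp only [← mul_sub]
        constructor
        · rw [i4]; simp only [Int.cast_zero, zero_add]
          exact mul_le_mul_of_nonneg_left (i1.trans hb.1) hc
        · have := mul_le_mul_of_nonneg_left (hb.2.trans i2) hc
          rw [i4, Int.cast_zero]; linarith)
      (fun n hn => by
        rw [Finset.mem_Ico] at hn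
        have := log_second_diff (n := n) (by omega)
        have h3 : (0:ℝ) ≤ 1 / ((n : ℝ) + 1) ^ 2 := by positivity
        simp only [← mul_sub]
        exact mul_le_mul_of_nonneg_left (by linarith) hc)
    rw [← hI] at this
    refine this.trans ?_
    have : 2 / (c / (3 * D)) ≤ 12 * D / (1 + c) := by
      have e : 2 / (c / (3 * (D:ℝ))) = 6 * D / c := by field_simp; norm_num
      rw [e, div_le_div_iff₀ (by linarith) (by linarith)]
      nlinarith
    linarith
  have hp : 0 ≤ 12 * D / (1 + c) := by positivity
  rcases le_total (4 * D ^ 2 : ℝ) c with h3 | h3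
  · have : 2 * (D:ℝ) ≤ Real.sqrt c := Real.le_sqrt_of_sq_le (by linarith)
    linarith
  have hc0 : 0 < c := by linarith
  have := second_derivative_test (fun n => c * Real.log n) (l := c / (4 * D ^ 2)) (by positivity)
    (by rw [div_le_one (by positivity)]; exact h3) (D + 1) (2 * D) (by omega) (fun n hn => by
      rw [Finset.mem_Ico] at hn
      have h4 := log_second_diff (n := n) (by omega)
      have l2 : (n:ℝ) + 1 ≤ 2 * D := by exact_mod_cast hn.2
      have h5 : 1 / (4 * (D:ℝ) ^ 2) ≤ 1 / ((n : ℝ) + 1) ^ 2 :=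
        one_div_le_one_div_of_le (by positivity) (by nlinarith)
      simp only [← mul_sub]
      rw [div_eq_mul_one_div]
      exact mul_le_mul_of_nonneg_left (h5.trans h4) hc)
  rw [← hI] at this
  refine this.trans ?_
  have q1 := (log_diff_bounds (n := D + 1) (by omega)).2
  have q2 := (log_diff_bounds (n := 2 * D) (by omega)).1
  have q3 : (0:ℝ) ≤ 1 / (((2 * D : ℕ) : ℝ) + 1) := by positivity
  have q4 : 1 / ((D + 1 : ℕ) : ℝ) ≤ 1 / D := one_div_le_one_div_of_le (by linarith) (by push_cast; linarith)
  have e1 : Real.sqrt (c / (4 * D ^ 2)) = Real.sqrt c / (2 * D) := by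
    rw [Real.sqrt_div hc, show (4 * (D:ℝ) ^ 2) = (2 * D) ^ 2 by ring, Real.sqrt_sq (by positivity)]
  have hs0 : 0 < Real.sqrt c := Real.sqrt_pos.2 hc0
  have hss : Real.sqrt c * Real.sqrt c = c := Real.mul_self_sqrt hc
  have key : (c * (1 / (D:ℝ)) + 2) * (6 / (Real.sqrt c / (2 * D))) ≤ 60 * Real.sqrt c := by
    have : (c * (1 / (D:ℝ)) + 2) * (6 / (Real.sqrt c / (2 * D))) = (12 * c + 24 * D) / Real.sqrt c := by
      field_simp
      ring
    rw [this, div_le_iff₀ hs0, mul_assoc, hss]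
    linarith
  have : (c * Real.log ((D + 1 + 1 : ℕ) : ℝ) - c * Real.log ((D + 1 : ℕ) : ℝ)
      - (c * Real.log ((2 * D + 1 : ℕ) : ℝ) - c * Real.log ((2 * D : ℕ) : ℝ)) + 2) *
        (6 / Real.sqrt (c / (4 * D ^ 2))) ≤ (c * (1 / (D:ℝ)) + 2) * (6 / (Real.sqrt c / (2 * D))) := by
    rw [e1]
    refine mul_le_mul_of_nonneg_right ?_ (by positivity)
    rw [← mul_sub, ← mul_sub, ← mul_sub]
    have := mul_le_mul_of_nonneg_left
      (show Real.log ((D + 1 + 1 : ℕ) : ℝ) - Real.log ((D + 1 : ℕ) : ℝ)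
        - (Real.log ((2 * D + 1 : ℕ) : ℝ) - Real.log ((2 * D : ℕ) : ℝ)) ≤ 1 / D by linarith) hc
    linarith
  linarith

lemma sum_Ioc_mul_eq_abel (w z : ℕ → ℂ) (a b : ℕ) (hab : a ≤ b) :
    ∑ n ∈ Finset.Ioc a b, w n * z n = w (b + 1) * ∑ n ∈ Finset.Ioc a b, z n +
      ∑ m ∈ Finset.Ioc a b, (w m - w (m + 1)) * ∑ n ∈ Finset.Ioc a m, z n := by
  induction b, hab using Nat.le_induction with
  | base => simp
  | succ b hb ih =>
    rw [Finset.sum_Ioc_succ_top (by omega), Finset.sum_Ioc_succ_top (by omega),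
      Finset.sum_Ioc_succ_top (by omega), ih, Finset.sum_Ioc_succ_top (by omega)]
    ring

lemma norm_sum_antitone_mul_le (w : ℕ → ℝ) (z : ℕ → ℂ) (a b : ℕ) (hab : a ≤ b) {M : ℝ}
    (hw : ∀ n, 0 ≤ w n) (hw2 : ∀ n, a < n → w (n + 1) ≤ w n)
    (h : ∀ m, a < m → m ≤ b → ‖∑ n ∈ Finset.Ioc a m, z n‖ ≤ M) (hM : 0 ≤ M) :
    ‖∑ n ∈ Finset.Ioc a b, (w n : ℂ) * z n‖ ≤ w (a + 1) * M := by
  have tel : ∀ m, a ≤ m → ∑ n ∈ Finset.Ioc a m, (w n - w (n + 1)) = w (a + 1) - w (m + 1) := by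
    intro m hm
    induction m, hm using Nat.le_induction with
    | base => simp
    | succ m hm ih => rw [Finset.sum_Ioc_succ_top (by omega), ih]; ring
  rw [sum_Ioc_mul_eq_abel (fun n => (w n : ℂ)) z a b hab]
  refine (norm_add_le _ _).trans ?_
  have h1 : ‖(w (b + 1) : ℂ) * ∑ n ∈ Finset.Ioc a b, z n‖ ≤ w (b + 1) * M := by
    rw [norm_mul, Complex.norm_real, Real.norm_of_nonneg (hw _)]
    refine mul_le_mul_of_nonneg_left ?_ (hw _)
    rcases hab.eq_or_lt with rfl | h'
    · simpa using hM
    · exact h b h' le_rfl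
  have h2 : ‖∑ m ∈ Finset.Ioc a b, ((w m : ℂ) - w (m + 1)) * ∑ n ∈ Finset.Ioc a m, z n‖ ≤
      ∑ m ∈ Finset.Ioc a b, (w m - w (m + 1)) * M := by
    refine (norm_sum_le _ _).trans (Finset.sum_le_sum fun m hm => ?_)
    rw [Finset.mem_Ioc] at hm
    rw [norm_mul, ← Complex.ofReal_sub, Complex.norm_real,
      Real.norm_of_nonneg (sub_nonneg.2 (hw2 m hm.1))]
    exact mul_le_mul_of_nonneg_left (h m hm.1 hm.2) (sub_nonneg.2 (hw2 m hm.1))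
  rw [← Finset.sum_mul, tel b hab] at h2
  linarith

lemma log_shift_second_diff {n q : ℕ} (hn : 1 ≤ n) (hq : q ≤ n + 1) :
    (q : ℝ) / (2 * ((n : ℝ) + 1) ^ 3) ≤
      ((Real.log ((n + 1 : ℕ) : ℝ) - Real.log n) -
        (Real.log ((n + 1 + q : ℕ) : ℝ) - Real.log ((n + q : ℕ) : ℝ))) -
      ((Real.log ((n + 2 : ℕ) : ℝ) - Real.log ((n + 1 : ℕ) : ℝ)) -
        (Real.log ((n + 2 + q : ℕ) : ℝ) - Real.log ((n + 1 + q : ℕ) : ℝ))) := by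
  have h0 : (1:ℝ) ≤ n := by exact_mod_cast hn
  have hq' : (q:ℝ) ≤ n + 1 := by exact_mod_cast hq
  have hq0 : (0:ℝ) ≤ q := Nat.cast_nonneg q
  set x : ℝ := (n * (n + 2)) / (n + 1) ^ 2 with hx
  set y : ℝ := ((n + q) * (n + 2 + q)) / (n + 1 + q) ^ 2 with hy
  have ex' : Real.log x = Real.log n + Real.log (n + 2) - 2 * Real.log (n + 1) := by
    rw [hx, Real.log_div (by positivity) (by positivity), Real.log_mul (by positivity) (by positivity),
      Real.log_pow]; push_cast; ring
  have ey : Real.log y = Real.log (n + q) + Real.log (n + 2 + q) - 2 * Real.log (n + 1 + q) := by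
    rw [hy, Real.log_div (by positivity) (by positivity), Real.log_mul (by positivity) (by positivity),
      Real.log_pow]; push_cast; ring
  have hx0 : 0 < x := by positivity
  have hy0 : 0 < y := by positivity
  have hx1 : x = 1 - 1 / (n + 1) ^ 2 := by rw [hx]; field_simp; ring
  have hy1 : y = 1 - 1 / (n + 1 + q) ^ 2 := by rw [hy]; field_simp; ring
  have hyle : y ≤ 1 := by
    rw [hy1]; have : (0:ℝ) ≤ 1 / (n + 1 + q) ^ 2 := by positivity
    linarith
  have hdiff : (q : ℝ) / (2 * ((n : ℝ) + 1) ^ 3) ≤ y - x := by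
    rw [hx1, hy1]
    set m : ℝ := n + 1 with hm
    have hm0 : 0 < m := by positivity
    have : (1 - 1 / (m + q) ^ 2) - (1 - 1 / m ^ 2) = (2 * m * q + q ^ 2) / (m ^ 2 * (m + q) ^ 2) := by
      field_simp; ring
    rw [this, div_le_div_iff₀ (by positivity) (by positivity)]
    have h1 : (m + q) ^ 2 ≤ (2 * m) ^ 2 := pow_le_pow_left₀ (by positivity) (by linarith) 2
    calc (q:ℝ) * (m ^ 2 * (m + q) ^ 2) ≤ q * (m ^ 2 * (2 * m) ^ 2) := by gcongr
      _ = (2 * m * q) * (2 * m ^ 3) := by ring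
      _ ≤ _ := by gcongr; nlinarith
  have hlog : y - x ≤ Real.log y - Real.log x := by
    rw [← Real.log_div hy0.ne' hx0.ne']
    refine le_trans ?_ (Real.one_sub_inv_le_log_of_pos (by positivity))
    rw [inv_div, one_sub_div hy0.ne', le_div_iff₀ hy0]
    by_cases hxy : x ≤ y
    · nlinarith
    · exfalso
      have : 0 ≤ (q : ℝ) / (2 * ((n : ℝ) + 1) ^ 3) := by positivity
      linarith
  push_cast
  linarith

lemma log_shift_diff_bounds {n q : ℕ} (hn : 1 ≤ n) :
    0 ≤ (Real.log ((n + 1 : ℕ) : ℝ) - Real.log n) -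
        (Real.log ((n + 1 + q : ℕ) : ℝ) - Real.log ((n + q : ℕ) : ℝ)) ∧
    (Real.log ((n + 1 : ℕ) : ℝ) - Real.log n) -
        (Real.log ((n + 1 + q : ℕ) : ℝ) - Real.log ((n + q : ℕ) : ℝ)) ≤ q / (n : ℝ) ^ 2 := by
  have h0 : (1:ℝ) ≤ n := by exact_mod_cast hn
  have hq0 : (0:ℝ) ≤ q := Nat.cast_nonneg q
  set x : ℝ := ((n + 1) * (n + q)) / (n * (n + 1 + q)) with hx
  have ex' : Real.log x = (Real.log ((n + 1 : ℕ) : ℝ) - Real.log n) -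
        (Real.log ((n + 1 + q : ℕ) : ℝ) - Real.log ((n + q : ℕ) : ℝ)) := by
    rw [hx, Real.log_div (by positivity) (by positivity), Real.log_mul (by positivity) (by positivity),
      Real.log_mul (by positivity) (by positivity)]; push_cast; ring
  have hx1 : x = 1 + q / (n * (n + 1 + q)) := by rw [hx]; field_simp; ring
  rw [← ex']
  constructor
  · refine Real.log_nonneg ?_
    rw [hx1]; have : (0:ℝ) ≤ q / (n * (n + 1 + q)) := by positivity
    linarith
  · refine (Real.log_le_sub_one_of_pos (by positivity)).trans ?_
    rw [hx1, add_sub_cancel_left]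
    exact div_le_div_of_nonneg_left hq0 (by positivity) (by nlinarith)

lemma norm_sum_ex_neg (s : Finset ℕ) (f : ℕ → ℝ) :
    ‖∑ n ∈ s, ex (-f n)‖ = ‖∑ n ∈ s, ex (f n)‖ := by
  rw [← Complex.norm_conj, map_sum]
  simp only [conj_ex, neg_neg]

lemma norm_shifted_sum_le {C0 u : ℝ} (hC0 : 1 ≤ C0) (hu : 2 ≤ u) (a b q : ℕ)
    (hb : (b : ℝ) ≤ C0 * (a + 1)) (hb2 : (b : ℝ) ^ 2 ≤ C0 ^ 2 * u ^ 3) (hN : u ≤ a + 1)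
    (hq1 : 1 ≤ q) (hq : (q : ℝ) * u ≤ 2 * (a + 1)) :
    ‖∑ n ∈ Finset.Ioc a (b - q), ex (u ^ 3 * Real.log (n + q : ℕ) - u ^ 3 * Real.log n)‖ ≤
      36 * C0 ^ 4 * u := by
  rcases le_or_gt (b - q) a with hab | hab
  · rw [Finset.Ioc_eq_empty (by omega)]; simp; positivity
  set N : ℝ := a + 1 with hNdef
  have hNb : N ≤ b := by
    have : ((a + 1 : ℕ) : ℝ) ≤ b := by exact_mod_cast (by omega : a + 1 ≤ b)
    push_cast at this; exact this
  have hq1' : (1:ℝ) ≤ q := by exact_mod_cast hq1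
  have hN0 : 0 < N := by linarith
  have hqN : (q:ℝ) ≤ N := by nlinarith
  have hqa : q ≤ a + 1 := by
    have : (q:ℝ) ≤ ((a + 1 : ℕ) : ℝ) := by push_cast; exact hqN
    exact_mod_cast this
  have hI : Finset.Ioc a (b - q) = Finset.Icc (a + 1) (b - q) := by
    ext n; simp only [Finset.mem_Ioc, Finset.mem_Icc]; omega
  set x : ℝ := u ^ 3 * q / N ^ 2 with hx
  have hx0 : 0 < x := by positivity
  have hC3 : 1 ≤ C0 ^ 3 := one_le_pow₀ hC0
  have key := second_derivative_test
    (fun n => -(u ^ 3 * Real.log (n + q : ℕ) - u ^ 3 * Real.log n))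
    (l := x / (2 * C0 ^ 3 * N)) (by positivity) (by
      rw [div_le_one (by positivity), hx, div_le_iff₀ (by positivity)]
      calc u ^ 3 * q = u ^ 2 * (q * u) := by ring
        _ ≤ N ^ 2 * (2 * N) := by gcongr
        _ ≤ C0 ^ 3 * (N ^ 2 * (2 * N)) := le_mul_of_one_le_left (by positivity) hC3
        _ = _ := by ring)
    (a + 1) (b - q) hab (fun n hn => by
      rw [Finset.mem_Ico] at hn
      have h1 := log_shift_second_diff (n := n) (q := q) (by omega) (by omega)
      have h2 : (n:ℝ) + 1 ≤ C0 * N := by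
        have : ((n + 1 : ℕ) : ℝ) ≤ b := by exact_mod_cast (by omega : n + 1 ≤ b)
        push_cast at this; linarith
      have h3 : (q:ℝ) / (2 * (C0 * N) ^ 3) ≤ q / (2 * ((n:ℝ) + 1) ^ 3) := by gcongr
      have h4 := mul_le_mul_of_nonneg_left (h3.trans h1) (show 0 ≤ u ^ 3 by positivity)
      have e : u ^ 3 * ((q:ℝ) / (2 * (C0 * N) ^ 3)) = x / (2 * C0 ^ 3 * N) := by
        rw [hx]; field_simp
      rw [e] at h4
      refine h4.trans (le_of_eq ?_)
      rw [show n + 1 + q = n + q + 1 by omega]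
      ring_nf)
  rw [← hI, norm_sum_ex_neg] at key
  refine key.trans ?_
  have g1 := (log_shift_diff_bounds (n := a + 1) (q := q) (by omega)).2
  have g2 := (log_shift_diff_bounds (n := b - q) (q := q) (by omega)).1
  have hu3 : 0 ≤ u ^ 3 := by positivity
  have g3 := mul_le_mul_of_nonneg_left g1 hu3
  have g4 := mul_nonneg hu3 g2
  have e3 : u ^ 3 * ((q:ℝ) / ((a + 1 : ℕ) : ℝ) ^ 2) = x := by rw [hx, hNdef]; push_cast; ring
  rw [e3] at g3
  set l := x / (2 * C0 ^ 3 * N) with hl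
  have hl0 : 0 < l := by positivity
  have hx2 : x + 2 ≤ 3 * C0 ^ 2 * x := by
    have hC2 : 1 ≤ C0 ^ 2 := one_le_pow₀ hC0
    have : 1 ≤ C0 ^ 2 * x := by
      rw [hx, mul_div_assoc', le_div_iff₀ (by positivity), one_mul]
      calc N ^ 2 ≤ (b:ℝ) ^ 2 := by gcongr
        _ ≤ C0 ^ 2 * u ^ 3 := hb2
        _ ≤ C0 ^ 2 * (u ^ 3 * q) := by
          gcongr; exact le_mul_of_one_le_right (by positivity) hq1'
    nlinarith
  have hxN : x * N ≤ 2 * u ^ 2 := by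
    rw [hx, div_mul_eq_mul_div, div_le_iff₀ (by positivity)]
    calc u ^ 3 * q * N = u ^ 2 * (q * u) * N := by ring
      _ ≤ u ^ 2 * (2 * N) * N := by gcongr
      _ = _ := by ring
  have h5 : (x + 2) * (6 / Real.sqrt l) ≤ 36 * C0 ^ 4 * u := by
    have hs : 0 < Real.sqrt l := Real.sqrt_pos.2 hl0
    rw [mul_div_assoc', div_le_iff₀ hs]
    have : (18 * C0 ^ 2 * x / (36 * C0 ^ 4 * u)) ≤ Real.sqrt l := by
      apply Real.le_sqrt_of_sq_le
      rw [hl, div_pow, div_le_div_iff₀ (by positivity) (by positivity)]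
      calc (18 * C0 ^ 2 * x) ^ 2 * (2 * C0 ^ 3 * N) = (648 * C0 ^ 7 * x) * (x * N) := by ring
        _ ≤ (648 * C0 ^ 7 * x) * (2 * u ^ 2) := by gcongr
        _ = x * (1296 * C0 ^ 7 * u ^ 2) := by ring
        _ ≤ x * (1296 * C0 ^ 8 * u ^ 2) := by
          gcongr
          norm_num
        _ = _ := by ring
    rw [div_le_iff₀ (by positivity)] at this
    linarith
  refine le_trans (mul_le_mul_of_nonneg_right ?_ (by positivity)) h5
  rw [show a + 1 + 1 + q = a + 1 + q + 1 by omega, show b - q + 1 + q = b - q + q + 1 by omega] at *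
  linarith

/-- The Weyl bound for zeta sums. -/
lemma weyl_log_sum {C0 u : ℝ} (hC0 : 1 ≤ C0) (hu : 2 ≤ u) (a b : ℕ)
    (hb : (b : ℝ) ≤ C0 * (a + 1)) (hb2 : (b : ℝ) ^ 2 ≤ C0 ^ 2 * u ^ 3) :
    ‖∑ n ∈ Finset.Ioc a b, ex (u ^ 3 * Real.log n)‖ ^ 2 ≤ 74 * C0 ^ 5 * (a + 1) * u := by
  rcases le_or_gt b a with hab | hab
  · rw [Finset.Ioc_eq_empty (by omega)]; simp; positivity
  set N : ℝ := a + 1 with hNdef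
  have hN0 : 0 < N := by positivity
  have hba : (b:ℝ) - a ≤ C0 * N := by
    have : (0:ℝ) ≤ a := Nat.cast_nonneg a
    linarith
  have hba0 : (0:ℝ) ≤ b - a := by
    have : (a:ℝ) ≤ b := by exact_mod_cast hab.le
    linarith
  rcases le_total N u with h | h
  · have triv : ‖∑ n ∈ Finset.Ioc a b, ex (u ^ 3 * Real.log n)‖ ≤ C0 * N := by
      refine (norm_sum_le _ _).trans ?_
      simp only [norm_ex, Finset.sum_const, Nat.card_Ioc, nsmul_eq_mul, mul_one]
      rw [Nat.cast_sub hab.le]; exact hba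
    calc _ ≤ (C0 * N) ^ 2 := pow_le_pow_left₀ (norm_nonneg _) triv 2
      _ = C0 ^ 2 * N * N := by ring
      _ ≤ C0 ^ 2 * N * u := by gcongr
      _ ≤ 74 * C0 ^ 5 * N * u := by
        gcongr
        calc C0 ^ 2 ≤ C0 ^ 5 := pow_le_pow_right₀ hC0 (by norm_num)
          _ ≤ _ := by linarith [pow_pos (show 0 < C0 by linarith) 5]
  have hu0 : 0 < u := by linarith
  set Q := ⌈N / u⌉₊ with hQ
  have hQ1 : N / u ≤ Q := Nat.le_ceil _
  have hQ2 : (Q:ℝ) ≤ N / u + 1 := (Nat.ceil_lt_add_one (by positivity)).le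
  have hNu : 1 ≤ N / u := by rw [le_div_iff₀ hu0]; linarith
  have hQ3 : (Q:ℝ) * u ≤ 2 * N := by
    have : (N / u + 1) * u = N + u := by field_simp
    nlinarith
  have hQN : (Q:ℝ) ≤ N := by nlinarith
  have hQ0 : (0:ℝ) < Q := by linarith
  have := weyl_vdc (fun n => u ^ 3 * Real.log n) a b Q hab.le (B := 36 * C0 ^ 4 * u) (by positivity)
    (fun q hq1 hq2 => norm_shifted_sum_le hC0 hu a b q hb hb2 h hq1 (by
      have : (q:ℝ) ≤ Q := by exact_mod_cast hq2.le
      nlinarith))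
  have hNQ : N ≤ Q * u := by rwa [div_le_iff₀ hu0] at hQ1
  have h2 : ((b - a : ℝ) + Q) * (Q * (b - a) + Q ^ 2 * (36 * C0 ^ 4 * u)) ≤
      (Q:ℝ) ^ 2 * (74 * C0 ^ 5 * N * u) := by
    calc _ ≤ (C0 * N + C0 * N) * (Q * (C0 * (Q * u)) + Q ^ 2 * (36 * C0 ^ 4 * u)) := by
          gcongr
          · nlinarith
          · exact hba.trans (by gcongr)
      _ = (Q:ℝ) ^ 2 * N * u * (2 * C0 ^ 2 + 72 * C0 ^ 5) := by ring
      _ ≤ (Q:ℝ) ^ 2 * N * u * (2 * C0 ^ 5 + 72 * C0 ^ 5) := by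
          gcongr
          norm_num
      _ = _ := by ring
  exact le_of_mul_le_mul_left (this.trans h2) (by positivity)

/-- The oscillating factor `y ↦ y ^ (-it)`. -/
noncomputable def osc (t y : ℝ) : ℂ := Complex.exp (((-(t * Real.log y) : ℝ) : ℂ) * Complex.I)

lemma norm_osc (t y : ℝ) : ‖osc t y‖ = 1 := Complex.norm_exp_ofReal_mul_I _

lemma osc_eq_ex (t y : ℝ) : osc t y = ex (-(t / (2 * Real.pi) * Real.log y)) := by
  rw [osc, ex]
  congr 3
  field_simp

lemma conj_osc (t y : ℝ) : (starRingEnd ℂ) (osc t y) = osc (-t) y := by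
  rw [osc_eq_ex, osc_eq_ex, conj_ex]; congr 1; ring

lemma osc_mul (t : ℝ) {x y : ℝ} (hx : x ≠ 0) (hy : y ≠ 0) : osc t (x * y) = osc t x * osc t y := by
  rw [osc_eq_ex, osc_eq_ex, osc_eq_ex, ← ex_add, Real.log_mul hx hy]; congr 1; ring

lemma osc_add (s t y : ℝ) : osc (s + t) y = osc s y * osc t y := by
  rw [osc_eq_ex, osc_eq_ex, osc_eq_ex, ← ex_add]; congr 1; ring

/-- The sum of `n ^ (-1/2 - it)` over `a < n ≤ b`. -/
noncomputable def zsum (a b : ℕ) (t : ℝ) : ℂ :=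
  ∑ n ∈ Finset.Ioc a b, (((Real.sqrt n)⁻¹ : ℝ) : ℂ) * osc t n

lemma norm_zsum_le (a b : ℕ) (t : ℝ) : ‖zsum a b t‖ ≤ b := by
  refine (norm_sum_le _ _).trans ?_
  have : ∀ n ∈ Finset.Ioc a b, ‖(((Real.sqrt n)⁻¹ : ℝ) : ℂ) * osc t n‖ ≤ 1 := fun n hn => by
    rw [norm_mul, norm_osc, mul_one, Complex.norm_real, Real.norm_of_nonneg (by positivity)]
    apply inv_le_one_of_one_le₀
    rw [Real.one_le_sqrt]
    rw [Finset.mem_Ioc] at hn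
    exact_mod_cast (by omega : 1 ≤ n)
  refine (Finset.sum_le_sum this).trans ?_
  simp

lemma sup_zsum {C0 t : ℝ} (hC0 : 1 ≤ C0) (ht : 1 ≤ t) (a b : ℕ)
    (hb : (b : ℝ) ≤ C0 * (a + 1)) (hb2 : (b : ℝ) ≤ C0 * Real.sqrt t) :
    ‖zsum a b t‖ ^ 2 ≤ 74 * (3 * C0) ^ 5 * t ^ (1 / 3 : ℝ) := by
  rcases le_or_gt b a with hab | hab
  · rw [zsum, Finset.Ioc_eq_empty (by omega)]; simp; positivity
  have hpi := Real.pi_gt_three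
  have hpi2 := Real.pi_lt_d2
  have hb3 : (b:ℝ) ^ 2 ≤ C0 ^ 2 * t := by
    calc (b:ℝ) ^ 2 ≤ (C0 * Real.sqrt t) ^ 2 := by gcongr
      _ = C0 ^ 2 * t := by rw [mul_pow, Real.sq_sqrt (by linarith)]
  have ht3 : 1 ≤ t ^ (1 / 3 : ℝ) := Real.one_le_rpow ht (by norm_num)
  rcases le_total t (16 * Real.pi) with h | h
  · have h1 := pow_le_pow_left₀ (norm_nonneg _) (norm_zsum_le a b t) 2
    have hC : C0 ^ 2 ≤ C0 ^ 5 := pow_le_pow_right₀ hC0 (by norm_num)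
    calc _ ≤ C0 ^ 2 * t := h1.trans hb3
      _ ≤ C0 ^ 5 * 51 := by gcongr; linarith
      _ ≤ C0 ^ 5 * (74 * 3 ^ 5 * t ^ (1 / 3 : ℝ)) := by gcongr; linarith
      _ = _ := by ring
  set u := (t / (2 * Real.pi)) ^ (1 / 3 : ℝ) with hu
  have hu3 : u ^ 3 = t / (2 * Real.pi) := by
    rw [hu, ← Real.rpow_natCast, ← Real.rpow_mul (by positivity)]; norm_num
  have hu2 : 2 ≤ u := by
    by_contra hlt
    push Not at hlt
    have : u ^ 3 < 2 ^ 3 := pow_lt_pow_left₀ hlt (by positivity) (by norm_num)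
    rw [hu3, div_lt_iff₀ (by positivity)] at this
    linarith
  have hut : u ≤ t ^ (1 / 3 : ℝ) := by
    apply Real.rpow_le_rpow (by positivity) _ (by norm_num)
    rw [div_le_iff₀ (by positivity)]; nlinarith
  set M := Real.sqrt (74 * (3 * C0) ^ 5 * (a + 1) * u) with hM
  have key := norm_sum_antitone_mul_le (fun n => (Real.sqrt n)⁻¹) (fun n => osc t n) a b hab.le (M := M)
    (fun n => by positivity) (fun n hn => by
      have : (0:ℝ) < n := by exact_mod_cast (by omega : 0 < n)
      apply inv_anti₀ (Real.sqrt_pos.2 this)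
      exact Real.sqrt_le_sqrt (by push_cast; linarith))
    (fun m hm1 hm2 => by
      have hmb : (m:ℝ) ≤ b := by exact_mod_cast hm2
      apply Real.le_sqrt_of_sq_le
      simp only [osc_eq_ex]
      rw [norm_sum_ex_neg, ← hu3]
      refine weyl_log_sum (by linarith) hu2 a m (hmb.trans (hb.trans ?_)) ?_
      · gcongr; linarith
      · rw [hu3]
        calc (m:ℝ) ^ 2 ≤ b ^ 2 := by gcongr
          _ ≤ C0 ^ 2 * t := hb3
          _ = C0 ^ 2 * (2 * Real.pi) * (t / (2 * Real.pi)) := by field_simp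
          _ ≤ _ := by
            gcongr
            nlinarith [sq_nonneg C0])
    (Real.sqrt_nonneg _)
  have h2 := pow_le_pow_left₀ (norm_nonneg _) key 2
  rw [mul_pow, hM, Real.sq_sqrt (by positivity), inv_pow, Real.sq_sqrt (by positivity)] at h2
  refine h2.trans ?_
  push_cast
  calc ((a:ℝ) + 1)⁻¹ * (74 * (3 * C0) ^ 5 * (a + 1) * u) = 74 * (3 * C0) ^ 5 * u := by field_simp
    _ ≤ _ := by gcongr

lemma sum_geom_dist_le {ρ : ℝ} (h0 : 0 ≤ ρ) (h1 : ρ < 1) (m M : ℕ) (hm : m ≤ M) :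
    ∑ n ∈ Finset.range (M + 1), ρ ^ (max m n - min m n) ≤ 2 / (1 - ρ) := by
  have geo : ∀ k, ∑ j ∈ Finset.range k, ρ ^ j ≤ 1 / (1 - ρ) := fun k => by
    rw [le_div_iff₀ (by linarith), mul_comm, mul_neg_geom_sum]
    linarith [pow_nonneg h0 k]
  have split : ∑ n ∈ Finset.range (M + 1), ρ ^ (max m n - min m n) =
      ∑ n ∈ Finset.range (m + 1), ρ ^ (m - n) + ∑ n ∈ Finset.Ico (m + 1) (M + 1), ρ ^ (n - m) := by
    rw [← Finset.sum_range_add_sum_Ico _ (by omega : m + 1 ≤ M + 1)]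
    congr 1
    · refine Finset.sum_congr rfl fun n hn => ?_
      rw [Finset.mem_range] at hn
      rw [max_eq_left (by omega), min_eq_right (by omega)]
    · refine Finset.sum_congr rfl fun n hn => ?_
      rw [Finset.mem_Ico] at hn
      rw [max_eq_right (by omega), min_eq_left (by omega)]
  rw [split, show 2 / (1 - ρ) = 1 / (1 - ρ) + 1 / (1 - ρ) by ring]
  refine add_le_add ?_ ?_
  · have := Finset.sum_range_reflect (fun j => ρ ^ j) (m + 1)
    simp only [Nat.add_sub_cancel] at this
    rw [this]; exact geo _
  · rw [Finset.sum_Ico_eq_sum_range]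
    refine le_trans (Finset.sum_le_sum fun j _ => ?_) (geo (M + 1 - (m + 1)))
    exact pow_le_pow_of_le_one h0 h1.le (by omega)

lemma abs_log_div_ge {m n M : ℕ} (hm : 1 ≤ m) (hn : 1 ≤ n) (hmM : m ≤ M) (hnM : n ≤ M) :
    ((max m n - min m n : ℕ) : ℝ) / M ≤ |Real.log n - Real.log m| := by
  wlog h : m ≤ n generalizing m n
  · rw [max_comm, min_comm, abs_sub_comm]
    exact this hn hm hnM hmM (by omega)
  rw [max_eq_right h, min_eq_left h, Nat.cast_sub h]
  have hm0 : (0:ℝ) < m := by exact_mod_cast hm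
  have hn0 : (0:ℝ) < n := by exact_mod_cast hn
  have hle : (m:ℝ) ≤ n := by exact_mod_cast h
  have hM : (n:ℝ) ≤ M := by exact_mod_cast hnM
  refine le_trans ?_ (le_abs_self _)
  rw [← Real.log_div hn0.ne' hm0.ne']
  refine le_trans ?_ (Real.one_sub_inv_le_log_of_pos (by positivity))
  rw [inv_div, one_sub_div hn0.ne']
  exact div_le_div_of_nonneg_left (by linarith) hn0 hM

lemma gaussian_row_sum {T : ℝ} (hT : 0 < T) (m M : ℕ) (hm : 1 ≤ m) (hmM : m ≤ M) :
    ∑ n ∈ Finset.Icc 1 M, Real.exp (-(T * (Real.log n - Real.log m) / 2) ^ 2) ≤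
      4 * (1 + 2 * M / T) := by
  have hM0 : (0:ℝ) < M := by exact_mod_cast (by omega : 0 < M)
  set r := T / (2 * M) with hr
  have hr0 : 0 < r := by positivity
  set ρ := Real.exp (-r) with hρ
  have hρ1 : ρ < 1 := by rw [hρ, Real.exp_lt_one_iff]; linarith
  have step : ∀ n ∈ Finset.Icc 1 M, Real.exp (-(T * (Real.log n - Real.log m) / 2) ^ 2) ≤
      Real.exp (1 / 4) * ρ ^ (max m n - min m n) := by
    intro n hn
    rw [Finset.mem_Icc] at hn
    have h := abs_log_div_ge hm hn.1 hmM hn.2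
    rw [hρ, ← Real.exp_nat_mul, ← Real.exp_add]
    apply Real.exp_le_exp.2
    set x := |T * (Real.log n - Real.log m) / 2| with hx
    have e : (T * (Real.log n - Real.log m) / 2) ^ 2 = x ^ 2 := (sq_abs _).symm
    have h2 : ((max m n - min m n : ℕ) : ℝ) * r ≤ x := by
      rw [hx, abs_div, abs_mul, abs_of_pos hT, abs_two]
      calc ((max m n - min m n : ℕ) : ℝ) * r = T * (((max m n - min m n : ℕ) : ℝ) / M) / 2 := by
            rw [hr]; ring
        _ ≤ _ := by gcongr
    rw [e]
    nlinarith [sq_nonneg (x - 1 / 2)]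
  refine (Finset.sum_le_sum step).trans ?_
  rw [← Finset.mul_sum]
  have h3 : ∑ n ∈ Finset.Icc 1 M, ρ ^ (max m n - min m n) ≤ 2 / (1 - ρ) := by
    refine le_trans ?_ (sum_geom_dist_le (Real.exp_pos _).le hρ1 m M hmM)
    refine Finset.sum_le_sum_of_subset_of_nonneg (fun n hn => ?_) (fun _ _ _ => by positivity)
    simp at hn ⊢; omega
  have h4 : 1 / (1 - ρ) ≤ 1 + 1 / r := by
    have : ρ ≤ 1 / (1 + r) := by
      rw [hρ, Real.exp_neg, ← one_div]
      exact one_div_le_one_div_of_le (by linarith) (by linarith [Real.add_one_le_exp r])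
    have e : 1 + 1 / r = 1 / (1 - 1 / (1 + r)) := by
      clear_value r
      have e0 : 1 - 1 / (1 + r) = r / (1 + r) := by field_simp; ring
      rw [e0, one_div_div, add_div, div_self hr0.ne', add_comm]
    rw [e]
    refine one_div_le_one_div_of_le ?_ (by linarith)
    rw [sub_pos, div_lt_one (by linarith)]; linarith
  have h5 : Real.exp (1 / 4) ≤ 2 := by
    have := Real.exp_one_lt_d9
    have h6 : Real.exp (1 / 4) ≤ Real.exp (1/2) := Real.exp_le_exp.2 (by norm_num)
    have h7 : Real.exp (1 / 2) * Real.exp (1/2) = Real.exp 1 := by rw [← Real.exp_add]; norm_num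
    nlinarith [Real.exp_pos (1/2)]
  calc Real.exp (1 / 4) * ∑ n ∈ Finset.Icc 1 M, ρ ^ (max m n - min m n)
      ≤ 2 * (2 * (1 + 1 / r)) := by
        gcongr
        refine h3.trans ?_
        rw [div_eq_mul_one_div]; gcongr
    _ = _ := by rw [hr]; field_simp; ring


/-- The mean value theorem for Dirichlet polynomials, with a Gaussian weight. -/
lemma gaussian_mean_value {T : ℝ} (hT : 0 < T) (M : ℕ) (b : ℕ → ℂ) :
    ∫ t : ℝ, Real.exp (-(1 / T ^ 2) * t ^ 2) * ‖∑ m ∈ Finset.Icc 1 M, b m * osc t m‖ ^ 2 ≤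
      8 * (T + 2 * M) * ∑ m ∈ Finset.Icc 1 M, ‖b m‖ ^ 2 := by
  set K : ℕ → ℕ → ℝ := fun m n => Real.exp (-(T * (Real.log n - Real.log m) / 2) ^ 2) with hK
  have hbre : 0 < ((1 / T ^ 2 : ℝ) : ℂ).re := by rw [Complex.ofReal_re]; positivity
  have hint : ∀ x : ℝ, Integrable fun t : ℝ => Complex.exp (Complex.I * (x : ℂ) * t) *
      Complex.exp (-((1 / T ^ 2 : ℝ) : ℂ) * (t : ℂ) ^ 2) := fun x => by
    refine (integrable_cexp_neg_mul_sq hbre).bdd_mul (c := 1) (by fun_prop)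
      (Filter.Eventually.of_forall fun t => ?_)
    rw [show Complex.I * (x : ℂ) * t = ((x * t : ℝ) : ℂ) * Complex.I by push_cast; ring,
      Complex.norm_exp_ofReal_mul_I]
  have hval : ∀ x : ℝ, ‖∫ t : ℝ, Complex.exp (Complex.I * (x : ℂ) * t) *
      Complex.exp (-((1 / T ^ 2 : ℝ) : ℂ) * (t : ℂ) ^ 2)‖ ≤ 2 * T * Real.exp (-(T * x / 2) ^ 2) := fun x => by
    rw [fourierIntegral_gaussian hbre, norm_mul]
    have e1 : ((Real.pi : ℂ) / ((1 / T ^ 2 : ℝ) : ℂ)) = ((Real.pi * T ^ 2 : ℝ) : ℂ) := by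
      push_cast; field_simp
    have e2 : -(x : ℂ) ^ 2 / (4 * ((1 / T ^ 2 : ℝ) : ℂ)) = ((-(T * x / 2) ^ 2 : ℝ) : ℂ) := by
      push_cast; field_simp; ring
    rw [e1, e2, ← Complex.ofReal_exp, Complex.norm_real, Real.norm_of_nonneg (Real.exp_pos _).le,
      Complex.norm_cpow_eq_rpow_re_of_pos (by positivity)]
    gcongr
    have : ((1 / 2 : ℂ)).re = 1 / 2 := by norm_num
    rw [this, ← Real.sqrt_eq_rpow]
    apply Real.sqrt_le_iff.2 ⟨by positivity, ?_⟩
    nlinarith [Real.pi_lt_four, sq_nonneg T]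
  have hexp : ∀ t : ℝ, ((Real.exp (-(1 / T ^ 2) * t ^ 2) *
      ‖∑ m ∈ Finset.Icc 1 M, b m * osc t m‖ ^ 2 : ℝ) : ℂ) =
      ∑ m ∈ Finset.Icc 1 M, ∑ n ∈ Finset.Icc 1 M, (b m * (starRingEnd ℂ) (b n)) *
        (Complex.exp (Complex.I * ((Real.log n - Real.log m : ℝ) : ℂ) * t) *
        Complex.exp (-((1 / T ^ 2 : ℝ) : ℂ) * (t : ℂ) ^ 2)) := fun t => by
    rw [Complex.ofReal_mul, Complex.ofReal_pow, ← Complex.mul_conj', map_sum, Finset.sum_mul_sum,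
      Finset.mul_sum]
    refine Finset.sum_congr rfl fun m _ => ?_
    rw [Finset.mul_sum]
    refine Finset.sum_congr rfl fun n _ => ?_
    rw [map_mul, conj_osc]
    have : osc t m * osc (-t) n = Complex.exp (Complex.I * ((Real.log n - Real.log m : ℝ) : ℂ) * t) := by
      rw [osc, osc, ← Complex.exp_add]; congr 1; push_cast; ring
    rw [← this]
    push_cast
    ring
  have hre : ((∫ t : ℝ, Real.exp (-(1 / T ^ 2) * t ^ 2) *
      ‖∑ m ∈ Finset.Icc 1 M, b m * osc t m‖ ^ 2 : ℝ) : ℂ) =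
      ∑ m ∈ Finset.Icc 1 M, ∑ n ∈ Finset.Icc 1 M, (b m * (starRingEnd ℂ) (b n)) *
        ∫ t : ℝ, (Complex.exp (Complex.I * ((Real.log n - Real.log m : ℝ) : ℂ) * t) *
        Complex.exp (-((1 / T ^ 2 : ℝ) : ℂ) * (t : ℂ) ^ 2)) := by
    refine (integral_ofReal (𝕜 := ℂ)).symm.trans ?_
    refine (integral_congr_ae (Filter.Eventually.of_forall hexp)).trans ?_
    rw [integral_finsetSum _ fun m _ => integrable_finsetSum _ fun n _ => (hint _).const_mul _]
    refine Finset.sum_congr rfl fun m _ => ?_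
    rw [integral_finsetSum _ fun n _ => (hint _).const_mul _]
    exact Finset.sum_congr rfl fun n _ => integral_const_mul _ _
  have hnn : 0 ≤ ∫ t : ℝ, Real.exp (-(1 / T ^ 2) * t ^ 2) *
      ‖∑ m ∈ Finset.Icc 1 M, b m * osc t m‖ ^ 2 := integral_nonneg fun t => by positivity
  rw [← Real.norm_of_nonneg hnn, ← Complex.norm_real, hre]
  have hsymm : ∀ m n, K m n = K n m := fun m n => by simp only [hK]; congr 1; ring
  calc _ ≤ ∑ m ∈ Finset.Icc 1 M, ∑ n ∈ Finset.Icc 1 M,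
        ((‖b m‖ ^ 2 * (T * K m n)) + (‖b n‖ ^ 2 * (T * K n m))) := by
        refine (norm_sum_le _ _).trans (Finset.sum_le_sum fun m _ =>
          (norm_sum_le _ _).trans (Finset.sum_le_sum fun n _ => ?_))
        rw [norm_mul, norm_mul, RCLike.norm_conj, hsymm n m]
        have hKp : 0 < K m n := Real.exp_pos _
        calc _ ≤ ‖b m‖ * ‖b n‖ * (2 * T * K m n) := by gcongr; exact hval _
          _ = (2 * ‖b m‖ * ‖b n‖) * (T * K m n) := by ring
          _ ≤ (‖b m‖ ^ 2 + ‖b n‖ ^ 2) * (T * K m n) := by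
            gcongr; exact two_mul_le_add_sq _ _
          _ = _ := by ring
    _ = 2 * ∑ m ∈ Finset.Icc 1 M, ‖b m‖ ^ 2 * (T * ∑ n ∈ Finset.Icc 1 M, K m n) := by
        simp only [Finset.sum_add_distrib]
        rw [Finset.sum_comm (f := fun m n => ‖b n‖ ^ 2 * (T * K n m)), ← two_mul]
        simp only [Finset.mul_sum]
    _ ≤ 2 * ∑ m ∈ Finset.Icc 1 M, ‖b m‖ ^ 2 * (T * (4 * (1 + 2 * M / T))) := by
        gcongr with m hm
        rw [Finset.mem_Icc] at hm
        exact gaussian_row_sum hT m M hm.1 hm.2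
    _ = _ := by
        rw [← Finset.sum_mul]
        field_simp
        ring

lemma continuous_osc (y : ℝ) : Continuous fun t => osc t y := by
  unfold osc; fun_prop

/-- The mean value theorem for Dirichlet polynomials. -/
lemma mean_value {T : ℝ} (hT : 0 < T) (M : ℕ) (b : ℕ → ℂ) :
    ∫ t in (-T)..T, ‖∑ m ∈ Finset.Icc 1 M, b m * osc t m‖ ^ 2 ≤
      50 * (T + M) * ∑ m ∈ Finset.Icc 1 M, ‖b m‖ ^ 2 := by
  have hcont : Continuous fun t => ‖∑ m ∈ Finset.Icc 1 M, b m * osc t m‖ ^ 2 :=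
    ((continuous_finsetSum _ fun m _ => continuous_const.mul (continuous_osc _)).norm).pow 2
  have hint : Integrable fun t : ℝ => Real.exp (-(1 / T ^ 2) * t ^ 2) *
      ‖∑ m ∈ Finset.Icc 1 M, b m * osc t m‖ ^ 2 := by
    refine (integrable_exp_neg_mul_sq (by positivity)).mul_bdd
      (c := (∑ m ∈ Finset.Icc 1 M, ‖b m‖) ^ 2) hcont.aestronglyMeasurable
      (Filter.Eventually.of_forall fun t => ?_)
    rw [Real.norm_of_nonneg (by positivity)]
    gcongr
    refine (norm_sum_le _ _).trans (Finset.sum_le_sum fun m _ => ?_)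
    rw [norm_mul, norm_osc, mul_one]
  have hS : 0 ≤ ∑ m ∈ Finset.Icc 1 M, ‖b m‖ ^ 2 := Finset.sum_nonneg fun _ _ => by positivity
  rw [intervalIntegral.integral_of_le (by linarith)]
  have h1 : ∫ t in Set.Ioc (-T) T, ‖∑ m ∈ Finset.Icc 1 M, b m * osc t m‖ ^ 2 ≤
      ∫ t in Set.Ioc (-T) T, Real.exp 1 * (Real.exp (-(1 / T ^ 2) * t ^ 2) *
      ‖∑ m ∈ Finset.Icc 1 M, b m * osc t m‖ ^ 2) := by
    refine setIntegral_mono_on (hcont.integrableOn_Ioc) (hint.const_mul _).integrableOn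
      measurableSet_Ioc fun t ht => ?_
    rw [← mul_assoc, ← Real.exp_add]
    refine le_mul_of_one_le_left (by positivity) (Real.one_le_exp ?_)
    have : t ^ 2 ≤ T ^ 2 := sq_le_sq' ht.1.le ht.2
    have : 1 / T ^ 2 * t ^ 2 ≤ 1 := by
      rw [one_div_mul_eq_div, div_le_one (by positivity)]; exact this
    linarith
  have h2 := setIntegral_le_integral (s := Set.Ioc (-T) T) (hint.const_mul (Real.exp 1))
    (Filter.Eventually.of_forall fun t => by simp only [Pi.zero_apply]; positivity)
  have h2 := h2.trans_eq (integral_const_mul _ _)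
  have h3 := gaussian_mean_value hT M b
  refine h1.trans (h2.trans ?_)
  have he := Real.exp_one_lt_d9
  have hM0 : (0:ℝ) ≤ M := Nat.cast_nonneg M
  calc _ ≤ 3 * (8 * (T + 2 * M) * ∑ m ∈ Finset.Icc 1 M, ‖b m‖ ^ 2) := by
        gcongr
        linarith
    _ ≤ 3 * (8 * (2 * T + 2 * M) * ∑ m ∈ Finset.Icc 1 M, ‖b m‖ ^ 2) := by gcongr; linarith
    _ = (48 * (T + M)) * ∑ m ∈ Finset.Icc 1 M, ‖b m‖ ^ 2 := by ring
    _ ≤ _ := by gcongr; norm_num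

lemma card_divisors_le {η : ℝ} (hη : 0 < η) :
    ∃ C : ℝ, 1 ≤ C ∧ ∀ n : ℕ, (n.divisors.card : ℝ) ≤ C * (n : ℝ) ^ η := by
  set N := ⌈(2:ℝ) ^ (1 / η)⌉₊ with hN
  set c := 1 + 2 / η with hc
  have hc1 : 1 ≤ c := by rw [hc]; linarith [div_pos two_pos hη]
  refine ⟨c ^ N, one_le_pow₀ hc1, fun n => ?_⟩
  rcases Nat.eq_zero_or_pos n with rfl | hn
  · simp; positivity
  have hprod : ((n : ℝ)) ^ η = ∏ p ∈ n.primeFactors, ((p : ℝ) ^ η) ^ (n.factorization p) := by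
    conv_lhs => rw [← Nat.prod_factorization_pow_eq_self hn.ne', Finsupp.prod]
    push_cast
    rw [← Real.finsetProd_rpow _ _ fun i _ => by positivity]
    refine Finset.prod_congr rfl fun p _ => ?_
    rw [← Real.rpow_natCast, ← Real.rpow_natCast, ← Real.rpow_mul (by positivity),
      ← Real.rpow_mul (by positivity), mul_comm]
  have hterm : ∀ p ∈ n.primeFactors, ((n.factorization p + 1 : ℕ) : ℝ) ≤
      (if p < N then c else 1) * ((p : ℝ) ^ η) ^ (n.factorization p) := by
    intro p hp
    have hp2 : 2 ≤ p := (Nat.prime_of_mem_primeFactors hp).two_le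
    set a := n.factorization p
    have hpr : (2:ℝ) ≤ p := by exact_mod_cast hp2
    split_ifs with h
    · have h1 : 1 + η / 2 ≤ (p : ℝ) ^ η := by
        have : Real.log 2 * η ≤ Real.log p * η := by gcongr
        rw [Real.rpow_def_of_pos (by linarith)]
        have := Real.add_one_le_exp (Real.log p * η)
        nlinarith [Real.log_two_gt_d9]
      have h2 : 1 + (a : ℝ) * (η / 2) ≤ (1 + η / 2) ^ a := one_add_mul_le_pow (by linarith) a
      calc ((a + 1 : ℕ) : ℝ) ≤ c * (1 + (a : ℝ) * (η / 2)) := by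
            rw [hc]; push_cast
            have : (1 + 2 / η) * (1 + (a : ℝ) * (η / 2)) = a + 1 + (a * (η / 2) + 2 / η) := by
              field_simp; ring
            rw [this]
            have : 0 ≤ (a : ℝ) * (η / 2) + 2 / η := by positivity
            linarith
        _ ≤ _ := by
            gcongr
            exact h2.trans (by gcongr)
    · have h1 : 2 ≤ (p : ℝ) ^ η := by
        have : (2:ℝ) ^ (1 / η) ≤ p := (Nat.le_ceil _).trans (by exact_mod_cast not_lt.1 h)
        calc (2:ℝ) = ((2:ℝ) ^ (1 / η)) ^ η := by
              rw [← Real.rpow_mul (by norm_num), one_div_mul_cancel hη.ne', Real.rpow_one]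
          _ ≤ _ := by gcongr
      rw [one_mul]
      calc ((a + 1 : ℕ) : ℝ) ≤ (2:ℝ) ^ a := by exact_mod_cast Nat.lt_two_pow_self
        _ ≤ _ := by gcongr
  rw [Nat.card_divisors hn.ne', Nat.cast_prod, hprod]
  refine (Finset.prod_le_prod (fun _ _ => by positivity) hterm).trans ?_
  rw [Finset.prod_mul_distrib]
  gcongr
  rw [Finset.prod_ite, Finset.prod_const, Finset.prod_const_one, mul_one]
  refine pow_le_pow_right₀ hc1 ?_
  calc _ ≤ (Finset.range N).card := Finset.card_le_card fun p hp => by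
        rw [Finset.mem_filter] at hp; exact Finset.mem_range.2 hp.2
    _ = N := Finset.card_range N

lemma fourth_moment {η C0 : ℝ} (hη : 0 < η) (hC0 : 1 ≤ C0) :
    ∃ K : ℝ, 0 < K ∧ ∀ (T : ℝ) (b : ℕ), 1 ≤ T → (b : ℝ) ≤ C0 * √T →
      ∫ t in (-T)..T, ‖zsum 0 b t‖ ^ 4 ≤ K * T ^ (1 + (η + η)) := by
  obtain ⟨C, hC, hdiv⟩ := card_divisors_le hη
  refine ⟨50 * (1 + C0 ^ 2) * (C * (C0 ^ 2) ^ η * ((1 + 1 / η) ^ 2 * (C0 ^ 2) ^ η)), by positivity,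
    fun T b hT hb2 => ?_⟩
  set S := Finset.Ioc 0 b ×ˢ Finset.Ioc 0 b with hS
  set c : ℕ → ℝ := fun m => ((S.filter fun p => p.1 * p.2 = m).card : ℝ) with hc
  have hmaps : ∀ p ∈ S, p.1 * p.2 ∈ Finset.Icc 1 (b * b) := by
    intro p hp
    rw [hS, Finset.mem_product, Finset.mem_Ioc, Finset.mem_Ioc] at hp
    rw [Finset.mem_Icc]
    exact ⟨Nat.mul_pos (by omega) (by omega), Nat.mul_le_mul hp.1.2 hp.2.2⟩
  have hsq : ∀ t, zsum 0 b t ^ 2 =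
      ∑ m ∈ Finset.Icc 1 (b * b), ((c m * (√m)⁻¹ : ℝ) : ℂ) * osc t m := by
    intro t
    rw [sq, zsum, Finset.sum_mul_sum, ← Finset.sum_product', ← hS,
      ← Finset.sum_fiberwise_of_maps_to hmaps]
    refine Finset.sum_congr rfl fun m hm => ?_
    have : ∀ p ∈ S.filter (fun p => p.1 * p.2 = m),
        (((√(p.1:ℝ))⁻¹ : ℝ) : ℂ) * osc t p.1 * ((((√(p.2:ℝ))⁻¹ : ℝ) : ℂ) * osc t p.2) =
        (((√(m:ℝ))⁻¹ : ℝ) : ℂ) * osc t m := by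
      intro p hp
      rw [Finset.mem_filter, hS, Finset.mem_product, Finset.mem_Ioc, Finset.mem_Ioc] at hp
      obtain ⟨⟨h1, h2⟩, rfl⟩ := hp
      have n1 : (p.1 : ℝ) ≠ 0 := by exact_mod_cast (by omega : p.1 ≠ 0)
      have n2 : (p.2 : ℝ) ≠ 0 := by exact_mod_cast (by omega : p.2 ≠ 0)
      rw [Nat.cast_mul, osc_mul _ n1 n2, Real.sqrt_mul (Nat.cast_nonneg _), mul_inv]
      push_cast; ring
    rw [Finset.sum_congr rfl this, Finset.sum_const, nsmul_eq_mul]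
    simp only [hc]
    push_cast; ring
  have hcm : ∀ m ∈ Finset.Icc 1 (b * b), c m ≤ C * (C0 ^ 2) ^ η * T ^ η := by
    intro m hm
    rw [Finset.mem_Icc] at hm
    have h1 : (S.filter fun p => p.1 * p.2 = m).card ≤ m.divisors.card := by
      refine Finset.card_le_card_of_injOn Prod.fst (fun p hp => ?_) (fun p hp q hq h => ?_)
      · rw [Finset.mem_coe, Finset.mem_filter] at hp
        rw [Finset.mem_coe, Nat.mem_divisors]
        exact ⟨⟨p.2, hp.2.symm⟩, by omega⟩
      · rw [Finset.mem_coe, Finset.mem_filter] at hp hq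
        have hp0 : 0 < p.1 := Nat.pos_of_ne_zero fun h0 => by
          have := hp.2; rw [h0, zero_mul] at this; omega
        refine Prod.ext h (Nat.eq_of_mul_eq_mul_left hp0 ?_)
        have h' : p.1 = q.1 := h
        rw [hp.2, h', hq.2]
    calc c m ≤ m.divisors.card := by simp only [hc]; exact_mod_cast h1
      _ ≤ C * (m : ℝ) ^ η := hdiv m
      _ ≤ C * (C0 ^ 2 * T) ^ η := by
          gcongr
          calc (m : ℝ) ≤ (b : ℝ) * b := by exact_mod_cast hm.2
            _ ≤ (C0 * √T) * (C0 * √T) := by gcongr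
            _ = C0 ^ 2 * T := by
              rw [mul_mul_mul_comm, Real.mul_self_sqrt (by linarith)]; ring
      _ = _ := by rw [Real.mul_rpow (by positivity) (by linarith)]; ring
  have hc0 : ∀ m, 0 ≤ c m := fun m => Nat.cast_nonneg _
  have hharm : ∑ n ∈ Finset.Ioc 0 b, ((n : ℝ))⁻¹ ≤ (1 + 1 / η) * (C0 * √T) ^ η := by
    have h1 : ∑ n ∈ Finset.Ioc 0 b, ((n : ℝ))⁻¹ ≤ 1 + Real.log b := by
      have := harmonic_le_one_add_log b
      rw [harmonic_eq_sum_Icc] at this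
      push_cast at this
      exact this
    have h2 := Real.log_le_rpow_div (Nat.cast_nonneg b) hη
    have h3 : (b : ℝ) ^ η ≤ (C0 * √T) ^ η := by gcongr
    have h4 : 1 ≤ (C0 * √T) ^ η := by
      refine Real.one_le_rpow ?_ hη.le
      nlinarith [Real.one_le_sqrt.2 hT]
    calc _ ≤ 1 + (b : ℝ) ^ η / η := by linarith
      _ ≤ (C0 * √T) ^ η + (C0 * √T) ^ η / η := by gcongr
      _ = _ := by ring
  have hharm0 : 0 ≤ ∑ n ∈ Finset.Ioc 0 b, ((n : ℝ))⁻¹ :=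
    Finset.sum_nonneg fun _ _ => by positivity
  have hcsum : ∑ m ∈ Finset.Icc 1 (b * b), c m * (m : ℝ)⁻¹ =
      (∑ n ∈ Finset.Ioc 0 b, ((n : ℝ))⁻¹) ^ 2 := by
    rw [sq, Finset.sum_mul_sum, ← Finset.sum_product', ← hS,
      ← Finset.sum_fiberwise_of_maps_to hmaps]
    refine Finset.sum_congr rfl fun m hm => ?_
    have : ∀ p ∈ S.filter (fun p => p.1 * p.2 = m), (p.1 : ℝ)⁻¹ * (p.2 : ℝ)⁻¹ = (m : ℝ)⁻¹ := by
      intro p hp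
      rw [Finset.mem_filter] at hp
      rw [← hp.2, Nat.cast_mul, mul_inv]
    rw [Finset.sum_congr rfl this, Finset.sum_const, nsmul_eq_mul]
  have hl2 : ∑ m ∈ Finset.Icc 1 (b * b), ‖((c m * (√m)⁻¹ : ℝ) : ℂ)‖ ^ 2 ≤
      C * (C0 ^ 2) ^ η * T ^ η * ((1 + 1 / η) ^ 2 * ((C0 ^ 2) ^ η * T ^ η)) := by
    have e : ((1 + 1 / η) * (C0 * √T) ^ η) ^ 2 = (1 + 1 / η) ^ 2 * ((C0 ^ 2) ^ η * T ^ η) := by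
      rw [mul_pow, ← Real.rpow_natCast ((C0 * √T) ^ η), ← Real.rpow_mul (by positivity), mul_comm η,
        Real.rpow_mul (by positivity), Real.rpow_natCast, mul_pow, Real.sq_sqrt (by linarith),
        Real.mul_rpow (by positivity) (by linarith)]
    calc _ ≤ ∑ m ∈ Finset.Icc 1 (b * b), (C * (C0 ^ 2) ^ η * T ^ η) * (c m * (m : ℝ)⁻¹) := by
          refine Finset.sum_le_sum fun m hm => ?_
          rw [Complex.norm_real, Real.norm_of_nonneg (mul_nonneg (hc0 m) (by positivity)), mul_pow,
            inv_pow, Real.sq_sqrt (Nat.cast_nonneg _), sq, mul_assoc]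
          exact mul_le_mul_of_nonneg_right (hcm m hm) (mul_nonneg (hc0 m) (by positivity))
      _ ≤ _ := by
          rw [← Finset.mul_sum, hcsum, ← e]
          gcongr
  have hmv := mean_value (by linarith : 0 < T) (b * b) fun m => ((c m * (√m)⁻¹ : ℝ) : ℂ)
  have heq : ∀ t, ‖zsum 0 b t‖ ^ 4 =
      ‖∑ m ∈ Finset.Icc 1 (b * b), ((c m * (√m)⁻¹ : ℝ) : ℂ) * osc t m‖ ^ 2 := fun t => by
    rw [← hsq, norm_pow, ← pow_mul]
  simp_rw [heq]
  refine hmv.trans ?_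
  have hbb : ((b * b : ℕ) : ℝ) ≤ C0 ^ 2 * T := by
    push_cast
    calc (b : ℝ) * b ≤ (C0 * √T) * (C0 * √T) := by gcongr
            _ = C0 ^ 2 * T := by
              rw [mul_mul_mul_comm, Real.mul_self_sqrt (by linarith)]; ring
  calc _ ≤ 50 * (T + C0 ^ 2 * T) * (C * (C0 ^ 2) ^ η * T ^ η *
        ((1 + 1 / η) ^ 2 * ((C0 ^ 2) ^ η * T ^ η))) := by gcongr
    _ = _ := by rw [Real.rpow_add (by linarith), Real.rpow_add (by linarith), Real.rpow_one]; ring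

lemma norm_zsum_zero_le {η C0 : ℝ} (hη : 0 < η) (hC0 : 1 ≤ C0) :
    ∃ K : ℝ, 0 < K ∧ ∀ (t : ℝ) (b : ℕ), 1 ≤ t → (b : ℝ) ≤ C0 * √t →
      ‖zsum 0 b t‖ ≤ K * t ^ (1 / 6 + η) := by
  set A := √(74 * (3 * (2 * C0)) ^ 5) with hA
  have hA0 : 0 < A := Real.sqrt_pos.2 (by positivity)
  have hdy : ∀ (n : ℕ) (t : ℝ) (b : ℕ), 1 ≤ t → (b : ℝ) ≤ C0 * √t → b < 2 ^ n →
      ‖zsum 0 b t‖ ≤ n * (A * t ^ (1 / 6 : ℝ)) := by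
    intro n
    induction n with
    | zero =>
      intro t b _ _ hb
      have : b = 0 := by simpa using hb
      simp [this, zsum]
    | succ n ih =>
      intro t b ht hb hbn
      have hsplit : zsum 0 b t = zsum 0 (b / 2) t + zsum (b / 2) b t := by
        rw [zsum, zsum, zsum, ← Finset.sum_Ioc_consecutive _ (Nat.zero_le _) (Nat.div_le_self b 2)]
      have h1 := ih t (b / 2) ht ((Nat.cast_le.2 (Nat.div_le_self b 2)).trans hb)
        (by rw [pow_succ] at hbn; omega)
      have hbb : (b : ℝ) ≤ 2 * C0 * (((b / 2 : ℕ) : ℝ) + 1) := by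
        have : (b : ℝ) ≤ 2 * (((b / 2 : ℕ) : ℝ) + 1) := by exact_mod_cast (by omega : b ≤ 2 * (b / 2 + 1))
        nlinarith [(Nat.cast_nonneg (b / 2) : (0:ℝ) ≤ ((b / 2 : ℕ) : ℝ))]
      have h2 := sup_zsum (by linarith : 1 ≤ 2 * C0) ht (b / 2) b hbb
        (hb.trans (by nlinarith [Real.sqrt_nonneg t]))
      have h3 : ‖zsum (b / 2) b t‖ ≤ A * t ^ (1 / 6 : ℝ) := by
        refine abs_le_of_sq_le_sq' ?_ (by positivity) |>.2
        rw [mul_pow, hA, Real.sq_sqrt (by positivity), ← Real.rpow_natCast (t ^ (1 / 6 : ℝ)),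
          ← Real.rpow_mul (by linarith)]
        norm_num at h2 ⊢
        exact h2
      rw [hsplit]
      push_cast
      linarith [norm_add_le (zsum 0 (b / 2) t) (zsum (b / 2) b t)]
  refine ⟨(1 + 1 / (η * Real.log 2)) * A * C0 ^ (2 * η), by
    have := Real.log_pos one_lt_two
    positivity, fun t b ht hb => ?_⟩
  have hl2 := Real.log_pos one_lt_two
  have hst := Real.one_le_sqrt.2 ht
  have h1 : 1 ≤ C0 * √t := by nlinarith
  have hlog : ((Nat.log 2 b + 1 : ℕ) : ℝ) ≤ (1 + 1 / (η * Real.log 2)) * (C0 * √t) ^ (2 * η) := by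
    have e1 : (C0 * √t) ^ η ≤ (C0 * √t) ^ (2 * η) := by
      apply Real.rpow_le_rpow_of_exponent_le h1; linarith
    have e2 : 1 ≤ (C0 * √t) ^ η := Real.one_le_rpow h1 hη.le
    have e3 : ((Nat.log 2 b : ℕ) : ℝ) ≤ Real.log b / Real.log 2 := by
      rw [← Real.logb]; exact Real.natLog_le_logb b 2
    have e4 := Real.log_le_rpow_div (Nat.cast_nonneg b) hη
    have e5 : (b : ℝ) ^ η ≤ (C0 * √t) ^ η := by gcongr
    push_cast
    calc _ ≤ ((C0 * √t) ^ η / η) / Real.log 2 + (C0 * √t) ^ η := by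
          refine add_le_add (e3.trans ?_) e2
          gcongr
          exact e4.trans (by gcongr)
      _ = (1 + 1 / (η * Real.log 2)) * (C0 * √t) ^ η := by field_simp; ring
      _ ≤ _ := by gcongr
  have e6 : (C0 * √t) ^ (2 * η) = C0 ^ (2 * η) * t ^ η := by
    rw [Real.mul_rpow (by linarith) (by positivity), Real.sqrt_eq_rpow, ← Real.rpow_mul (by linarith)]
    congr 2; ring
  calc _ ≤ ((Nat.log 2 b + 1 : ℕ) : ℝ) * (A * t ^ (1 / 6 : ℝ)) :=
        hdy _ t b ht hb (Nat.lt_pow_succ_log_self (by norm_num) b)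
    _ ≤ ((1 + 1 / (η * Real.log 2)) * (C0 ^ (2 * η) * t ^ η)) * (A * t ^ (1 / 6 : ℝ)) := by
        rw [← e6]; gcongr
    _ = _ := by rw [Real.rpow_add (by linarith)]; ring

lemma first_derivative_test_integral {θ θ' θ'' : ℝ → ℝ} {c d m : ℝ} (hcd : c ≤ d) (hm : 0 < m)
    (h1 : ∀ u ∈ Set.Icc c d, HasDerivAt θ (θ' u) u)
    (h2 : ∀ u ∈ Set.Icc c d, HasDerivAt θ' (θ'' u) u)
    (hc : ContinuousOn θ'' (Set.Icc c d)) (hpos : ∀ u ∈ Set.Icc c d, 0 ≤ θ'' u)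
    (hb : ∀ u ∈ Set.Icc c d, m ≤ |θ' u|) :
    ‖∫ u in c..d, Complex.exp ((θ u : ℂ) * Complex.I)‖ ≤ 4 / m := by
  have hne : ∀ u ∈ Set.Icc c d, θ' u ≠ 0 := fun u hu h => by
    have := hb u hu; rw [h, abs_zero] at this; linarith
  have hI : Set.uIcc c d = Set.Icc c d := Set.uIcc_of_le hcd
  set E : ℝ → ℂ := fun u => Complex.exp ((θ u : ℂ) * Complex.I) with hE
  have hnE : ∀ u, ‖E u‖ = 1 := fun u => Complex.norm_exp_ofReal_mul_I _
  have hθc : ContinuousOn θ (Set.Icc c d) := fun u hu => (h1 u hu).continuousAt.continuousWithinAt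
  have hθc' : ContinuousOn θ' (Set.Icc c d) := fun u hu => (h2 u hu).continuousAt.continuousWithinAt
  have hEc : ContinuousOn E (Set.Icc c d) := by
    refine Complex.continuous_exp.comp_continuousOn ?_
    exact (Complex.continuous_ofReal.comp_continuousOn hθc).mul continuousOn_const
  have hdE : ∀ u ∈ Set.uIcc c d, HasDerivAt E (E u * ((θ' u : ℂ) * Complex.I)) u := fun u hu =>
    (((h1 u (hI ▸ hu)).ofReal_comp).mul_const Complex.I).cexp
  set h : ℝ → ℂ := fun u => (((θ' u)⁻¹ : ℝ) : ℂ) with hh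
  set h' : ℝ → ℝ := fun u => -θ'' u / θ' u ^ 2 with hh'
  have hdr : ∀ u ∈ Set.uIcc c d, HasDerivAt (fun u => (θ' u)⁻¹) (h' u) u := fun u hu =>
    (h2 u (hI ▸ hu)).inv (hne u (hI ▸ hu))
  have hdh : ∀ u ∈ Set.uIcc c d, HasDerivAt h ((h' u : ℝ) : ℂ) u := fun u hu =>
    (hdr u hu).ofReal_comp
  have hh'c : ContinuousOn h' (Set.Icc c d) :=
    hc.neg.div (hθc'.pow 2) fun u hu => pow_ne_zero 2 (hne u hu)
  have hh'i : IntervalIntegrable h' volume c d := (hI ▸ hh'c : ContinuousOn h' _).intervalIntegrable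
  have hparts := intervalIntegral.integral_mul_deriv_eq_deriv_mul hdh hdE
    (ContinuousOn.intervalIntegrable (by
      rw [hI]; exact Complex.continuous_ofReal.comp_continuousOn hh'c))
    (ContinuousOn.intervalIntegrable (by
      rw [hI]; exact hEc.mul ((Complex.continuous_ofReal.comp_continuousOn hθc').mul continuousOn_const)))
  have hlhs : ∫ u in c..d, h u * (E u * ((θ' u : ℂ) * Complex.I)) =
      (∫ u in c..d, E u) * Complex.I := by
    rw [← intervalIntegral.integral_mul_const]
    refine intervalIntegral.integral_congr fun u hu => ?_
    have : (θ' u : ℂ) ≠ 0 := by exact_mod_cast hne u (hI ▸ hu)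
    simp only [hh]; push_cast; field_simp
  rw [hlhs] at hparts
  have hnh : ∀ u ∈ Set.Icc c d, |(θ' u)⁻¹| ≤ 1 / m := fun u hu => by
    rw [abs_inv, ← one_div]; exact one_div_le_one_div_of_le hm (hb u hu)
  have hrest : ‖∫ u in c..d, ((h' u : ℝ) : ℂ) * E u‖ ≤ 2 / m := by
    calc _ ≤ ∫ u in c..d, ‖((h' u : ℝ) : ℂ) * E u‖ :=
          intervalIntegral.norm_integral_le_integral_norm hcd
      _ = ∫ u in c..d, -h' u := by
          refine intervalIntegral.integral_congr fun u hu => ?_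
          have hu' := hI ▸ hu
          simp only [norm_mul, hnE, mul_one, Complex.norm_real, Real.norm_eq_abs]
          apply abs_of_nonpos
          simp only [hh']
          exact div_nonpos_of_nonpos_of_nonneg (neg_nonpos.2 (hpos u hu')) (sq_nonneg _)
      _ = (θ' c)⁻¹ - (θ' d)⁻¹ := by
          rw [intervalIntegral.integral_neg,
            intervalIntegral.integral_eq_sub_of_hasDerivAt hdr hh'i]; ring
      _ ≤ |(θ' c)⁻¹| + |(θ' d)⁻¹| := by
          linarith [le_abs_self (θ' c)⁻¹, neg_abs_le (θ' d)⁻¹]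
      _ ≤ 1 / m + 1 / m := add_le_add (hnh c ⟨le_rfl, hcd⟩) (hnh d ⟨hcd, le_rfl⟩)
      _ = 2 / m := by ring
  have e : ‖∫ u in c..d, E u‖ = ‖(∫ u in c..d, E u) * Complex.I‖ := by
    rw [norm_mul, Complex.norm_I, mul_one]
  have hn : ∀ u ∈ Set.Icc c d, ‖h u * E u‖ ≤ 1 / m := fun u hu => by
    rw [norm_mul, hnE, mul_one, Complex.norm_real]; exact hnh u hu
  rw [e, hparts]
  calc _ ≤ ‖h d * E d‖ + ‖h c * E c‖ + ‖∫ u in c..d, ((h' u : ℝ) : ℂ) * E u‖ :=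
        (norm_sub_le _ _).trans (by gcongr; exact norm_sub_le _ _)
    _ ≤ 1 / m + 1 / m + 2 / m :=
        add_le_add (add_le_add (hn d ⟨hcd, le_rfl⟩) (hn c ⟨le_rfl, hcd⟩)) hrest
    _ = _ := by ring

lemma osc_mul_ex_eq (t u : ℝ) : osc t u * ex u =
    Complex.exp (((2 * Real.pi * u - t * Real.log u : ℝ) : ℂ) * Complex.I) := by
  rw [osc, ex, ← Complex.exp_add]; congr 1; push_cast; ring

lemma continuousOn_osc (t : ℝ) : ContinuousOn (fun u => osc t u) (Set.Ioi 0) := by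
  unfold osc
  refine Complex.continuous_exp.comp_continuousOn ((Complex.continuous_ofReal.comp_continuousOn ?_).mul
    continuousOn_const)
  exact (continuousOn_const.mul (Real.continuousOn_log.mono fun u hu => (ne_of_gt hu))).neg

lemma continuous_ex : Continuous ex := by
  unfold ex; fun_prop

/-- The second derivative test for `∫ u ^ (-it) e(u) du`. -/
lemma norm_integral_osc_mul_ex_le {t a b : ℝ} (ht : 1 ≤ t) (ha : 0 < a) (hab : a ≤ b) :
    ‖∫ u in a..b, osc t u * ex u‖ ≤ 18 * b / √t := by
  have hb : 0 < b := ha.trans_le hab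
  have hst : 1 ≤ √t := Real.one_le_sqrt.2 ht
  set δ := b / √t with hδ
  have hδ0 : 0 < δ := by positivity
  have hδb : δ ≤ b := div_le_self hb.le hst
  set u0 := t / (2 * Real.pi) with hu0
  have hu0p : 0 < u0 := by positivity
  have h2pi : 2 * Real.pi = t / u0 := by rw [hu0]; field_simp
  set p := max a (min b (u0 - δ)) with hp
  set q := max a (min b (u0 + δ)) with hq
  have hap : a ≤ p := le_max_left _ _
  have hpq : p ≤ q := max_le_max le_rfl (min_le_min le_rfl (by linarith))
  have hqb : q ≤ b := max_le hab (min_le_left _ _)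
  have hqp : q - p ≤ 2 * δ := by
    have h1 : min b (u0 + δ) ≤ min b (u0 - δ) + 2 * δ := by
      rw [← min_add_add_right]
      exact min_le_min (by linarith) (by linarith)
    have : q ≤ p + 2 * δ := max_le (by linarith) (h1.trans (by gcongr; exact le_max_right _ _))
    linarith
  have hd1 : ∀ u : ℝ, 0 < u → HasDerivAt (fun u => 2 * Real.pi * u - t * Real.log u)
      (2 * Real.pi - t / u) u := fun u hu => by
    have := ((hasDerivAt_id u).const_mul (2 * Real.pi)).sub ((Real.hasDerivAt_log hu.ne').const_mul t)
    rw [mul_one, ← div_eq_mul_inv] at this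
    exact this
  have hd2 : ∀ u : ℝ, 0 < u → HasDerivAt (fun u => 2 * Real.pi - t / u) (t / u ^ 2) u := fun u hu => by
    have := ((hasDerivAt_inv hu.ne').const_mul t).const_sub (2 * Real.pi)
    simpa [div_eq_mul_inv] using this
  set m := √t / (2 * b) with hm
  have hm0 : 0 < m := by positivity
  have hmδ : t * δ / (b * (2 * b)) = m := by
    rw [hm, hδ]
    nth_rewrite 1 [← Real.mul_self_sqrt (by linarith : (0:ℝ) ≤ t)]
    field_simp
  have piece : ∀ c d : ℝ, 0 < c → c ≤ d → (∀ u ∈ Set.Icc c d, m ≤ |2 * Real.pi - t / u|) →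
      ‖∫ u in c..d, osc t u * ex u‖ ≤ 8 * δ := fun c d hc hcd h => by
    simp_rw [osc_mul_ex_eq]
    refine (first_derivative_test_integral hcd hm0 (fun u hu => hd1 u (hc.trans_le hu.1))
      (fun u hu => hd2 u (hc.trans_le hu.1)) ?_ (fun u _ => by positivity) h).trans (le_of_eq ?_)
    · exact continuousOn_const.div (continuousOn_id.pow 2)
        fun u hu => pow_ne_zero 2 (hc.trans_le hu.1).ne'
    · rw [hm, hδ]; field_simp; norm_num
  have hi : ∀ c d : ℝ, 0 < c → 0 < d → IntervalIntegrable (fun u => osc t u * ex u) volume c d :=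
    fun c d hc hd => (((continuousOn_osc t).mul continuous_ex.continuousOn).mono fun u hu =>
      (lt_min hc hd).trans_le hu.1).intervalIntegrable
  have hp0 := ha.trans_le hap
  have hq0 := hp0.trans_le hpq
  rw [← intervalIntegral.integral_add_adjacent_intervals (hi a p ha hp0) (hi p b hp0 hb),
    ← intervalIntegral.integral_add_adjacent_intervals (hi p q hp0 hq0) (hi q b hq0 hb)]
  have b1 : ‖∫ u in a..p, osc t u * ex u‖ ≤ 8 * δ := by
    rcases le_or_gt (min b (u0 - δ)) a with h | h
    · rw [hp, max_eq_left h, intervalIntegral.integral_same, norm_zero]; positivity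
    · refine piece a p ha hap fun u hu => ?_
      have hup : u ≤ u0 - δ := by
        refine hu.2.trans ?_
        rw [hp, max_eq_right h.le]; exact min_le_right _ _
      have hu0' : 0 < u := ha.trans_le hu.1
      have hub : u ≤ b := hu.2.trans (hpq.trans hqb)
      rw [abs_sub_comm, ← hmδ]
      refine le_trans ?_ (le_abs_self _)
      rw [h2pi]
      calc t * δ / (b * (2 * b)) ≤ t * δ / (u * (u + δ)) := by
            gcongr; linarith
        _ = t / u - t / (u + δ) := by field_simp; ring
        _ ≤ _ := by gcongr; linarith
  have b3 : ‖∫ u in q..b, osc t u * ex u‖ ≤ 8 * δ := by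
    rcases le_or_gt b (u0 + δ) with h | h
    · have : q = b := by rw [hq, min_eq_left h, max_eq_right hab]
      rw [this, intervalIntegral.integral_same, norm_zero]; positivity
    · refine piece q b hq0 hqb fun u hu => ?_
      have hup : u0 + δ ≤ u := by
        refine le_trans ?_ hu.1
        rw [hq, min_eq_right h.le]; exact le_max_right _ _
      have hu0' : 0 < u := hq0.trans_le hu.1
      have hud : 0 < u - δ := by linarith
      rw [← hmδ]
      refine le_trans ?_ (le_abs_self _)
      rw [h2pi]
      calc t * δ / (b * (2 * b)) ≤ t * δ / (u * (u - δ)) := by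
            gcongr
            · exact hu.2
            · linarith [hu.2]
        _ = t / (u - δ) - t / u := by field_simp; ring
        _ ≤ _ := by gcongr; linarith
  have b2 : ‖∫ u in p..q, osc t u * ex u‖ ≤ 2 * δ := by
    refine (intervalIntegral.norm_integral_le_of_norm_le_const (C := 1) fun u _ => ?_).trans ?_
    · rw [norm_mul, norm_osc, norm_ex, mul_one]
    · rw [one_mul, abs_of_nonneg (by linarith)]; exact hqp
  calc _ ≤ 8 * δ + (2 * δ + 8 * δ) :=
        (norm_add_le _ _).trans (add_le_add b1 ((norm_add_le _ _).trans (add_le_add b2 b3)))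
    _ = _ := by rw [hδ]; ring

/-- A smooth cutoff, equal to `1` on `(-∞, 1]` and to `0` on `[2, ∞)`. -/
noncomputable def cut (x : ℝ) : ℝ := Real.smoothTransition (2 - x)

lemma cut_one {x : ℝ} (hx : x ≤ 1) : cut x = 1 := Real.smoothTransition.one_of_one_le (by linarith)
lemma cut_zero {x : ℝ} (hx : 2 ≤ x) : cut x = 0 := Real.smoothTransition.zero_of_nonpos (by linarith)
lemma cut_nonneg (x : ℝ) : 0 ≤ cut x := Real.smoothTransition.nonneg _
lemma cut_le_one (x : ℝ) : cut x ≤ 1 := Real.smoothTransition.le_one _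
lemma contDiff_cut {n : ℕ∞} : ContDiff ℝ n cut :=
  Real.smoothTransition.contDiff.comp (contDiff_const.sub contDiff_id)
lemma antitone_cut : Antitone cut := fun x y h => Real.smoothTransition.monotone (by linarith)

/-- A smooth bump supported on `[1/2, 2]`, whose dyadic dilates telescope. -/
noncomputable def bump (x : ℝ) : ℝ := cut x - cut (2 * x)

lemma bump_of_le {x : ℝ} (hx : x ≤ 1 / 2) : bump x = 0 := by
  rw [bump, cut_one (by linarith), cut_one (by linarith), sub_self]
lemma bump_of_ge {x : ℝ} (hx : 2 ≤ x) : bump x = 0 := by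
  rw [bump, cut_zero hx, cut_zero (by linarith), sub_self]
lemma contDiff_bump {n : ℕ∞} : ContDiff ℝ n bump :=
  contDiff_cut.sub (contDiff_cut.comp (contDiff_const.mul contDiff_id))

lemma contDiff_mul_of_eq_zero {h g : ℝ → ℝ} {n : ℕ∞} (hh : ContDiff ℝ n h)
    (h0 : ∀ x < 1 / 2, h x = 0) (hg : ∀ x : ℝ, 0 < x → ContDiffAt ℝ n g x) :
    ContDiff ℝ n fun x => h x * g x := by
  rw [contDiff_iff_contDiffAt]
  intro x
  rcases lt_or_ge 0 x with hx | hx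
  · exact hh.contDiffAt.mul (hg x hx)
  · refine ContDiffAt.congr_of_eventuallyEq (contDiffAt_const (c := (0:ℝ))) ?_
    filter_upwards [Iio_mem_nhds (by linarith : x < 1 / 2)] with y hy
    rw [h0 y hy, zero_mul]

lemma deriv_eq_zero_of_forall_lt {h : ℝ → ℝ} {c x : ℝ} (h0 : ∀ x < c, h x = 0) (hx : x < c) :
    deriv h x = 0 := by
  have : h =ᶠ[nhds x] fun _ => (0:ℝ) := by
    filter_upwards [Iio_mem_nhds hx] with y hy using h0 y hy
  rw [this.deriv_eq, deriv_const]

lemma deriv_eq_zero_of_forall_gt {h : ℝ → ℝ} {c x : ℝ} (h0 : ∀ x > c, h x = 0) (hx : c < x) :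
    deriv h x = 0 := by
  have : h =ᶠ[nhds x] fun _ => (0:ℝ) := by
    filter_upwards [Ioi_mem_nhds hx] with y hy using h0 y hy
  rw [this.deriv_eq, deriv_const]

/-- The weight `bump x / √x`. -/
noncomputable def wgt (x : ℝ) : ℝ := bump x * (√x)⁻¹

lemma wgt_of_le {x : ℝ} (hx : x ≤ 1 / 2) : wgt x = 0 := by rw [wgt, bump_of_le hx, zero_mul]
lemma wgt_of_ge {x : ℝ} (hx : 2 ≤ x) : wgt x = 0 := by rw [wgt, bump_of_ge hx, zero_mul]

lemma contDiff_wgt {n : ℕ∞} : ContDiff ℝ n wgt :=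
  contDiff_mul_of_eq_zero contDiff_bump (fun _ hx => bump_of_le hx.le) fun _ hx =>
    (Real.contDiffAt_sqrt hx.ne').inv (Real.sqrt_pos.2 hx).ne'

lemma hasCompactSupport_wgt : HasCompactSupport wgt :=
  HasCompactSupport.intro (isCompact_Icc (a := 1 / 2) (b := 2)) fun x hx => by
    rw [Set.mem_Icc, not_and_or, not_le, not_le] at hx
    rcases hx with h | h
    · exact wgt_of_le h.le
    · exact wgt_of_ge h.le

lemma contDiff_deriv_wgt {n : ℕ} : ContDiff ℝ n (deriv wgt) :=
  (contDiff_succ_iff_deriv.1 (contDiff_wgt (n := ((n + 1 : ℕ) : ℕ∞)))).2.2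

lemma contDiff_deriv_deriv_wgt {n : ℕ} : ContDiff ℝ n (deriv (deriv wgt)) :=
  (contDiff_succ_iff_deriv.1 (contDiff_deriv_wgt (n := n + 1))).2.2

lemma hasDerivAt_wgt (x : ℝ) : HasDerivAt wgt (deriv wgt x) x :=
  ((contDiff_wgt (n := 1)).differentiable (by simp)).differentiableAt.hasDerivAt

lemma hasDerivAt_deriv_wgt (x : ℝ) : HasDerivAt (deriv wgt) (deriv (deriv wgt) x) x :=
  ((contDiff_deriv_wgt (n := 1)).differentiable (by simp)).differentiableAt.hasDerivAt

lemma deriv_wgt_of_lt {x : ℝ} (hx : x < 1 / 2) : deriv wgt x = 0 :=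
  deriv_eq_zero_of_forall_lt (fun _ h => wgt_of_le h.le) hx
lemma deriv_wgt_of_gt {x : ℝ} (hx : 2 < x) : deriv wgt x = 0 :=
  deriv_eq_zero_of_forall_gt (fun _ h => wgt_of_ge h.le) hx

lemma exists_wgt_bounds : ∃ C : ℝ, 1 ≤ C ∧ (∀ x, |wgt x| ≤ C) ∧ (∀ x, |deriv wgt x| ≤ C) ∧
    (∀ x, |deriv (deriv wgt) x| ≤ C) ∧
    ∀ x y, |deriv wgt x * √x ^ 3 - deriv wgt y * √y ^ 3| ≤ C * |x - y| := by
  obtain ⟨C0, h0⟩ := (contDiff_wgt (n := 0)).continuous.bounded_above_of_compact_support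
    hasCompactSupport_wgt
  obtain ⟨C1, h1⟩ := (contDiff_deriv_wgt (n := 0)).continuous.bounded_above_of_compact_support
    hasCompactSupport_wgt.deriv
  obtain ⟨C2, h2⟩ := (contDiff_deriv_deriv_wgt (n := 0)).continuous.bounded_above_of_compact_support
    hasCompactSupport_wgt.deriv.deriv
  have hs : ContDiff ℝ ((1 : ℕ) : ℕ∞) fun x => deriv wgt x * √x ^ 3 :=
    contDiff_mul_of_eq_zero contDiff_deriv_wgt (fun _ hx => deriv_wgt_of_lt hx) fun _ hx =>
      (Real.contDiffAt_sqrt hx.ne').pow 3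
  obtain ⟨K, hK⟩ := ContDiff.lipschitzWith_of_hasCompactSupport
    (hasCompactSupport_wgt.deriv.mul_right (f' := fun x => √x ^ 3)) hs (by simp)
  refine ⟨|C0| + |C1| + |C2| + K + 1, ?_, fun x => ?_, fun x => ?_, fun x => ?_, fun x y => ?_⟩
  · have := K.2; have := abs_nonneg C0; have := abs_nonneg C1; have := abs_nonneg C2; linarith [K.coe_nonneg]
  · have := h0 x; rw [Real.norm_eq_abs] at this
    linarith [K.coe_nonneg, abs_nonneg C1, abs_nonneg C2, le_abs_self C0]
  · have := h1 x; rw [Real.norm_eq_abs] at this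
    linarith [K.coe_nonneg, abs_nonneg C0, abs_nonneg C2, le_abs_self C1]
  · have := h2 x; rw [Real.norm_eq_abs] at this
    linarith [K.coe_nonneg, abs_nonneg C0, abs_nonneg C1, le_abs_self C2]
  · have := hK.dist_le_mul x y
    rw [Real.dist_eq, Real.dist_eq] at this
    refine this.trans ?_
    gcongr
    linarith [abs_nonneg C0, abs_nonneg C1, abs_nonneg C2]

lemma integral_by_parts_osc {c d : ℝ} (hcd : c ≤ d) {w w' h h' : ℝ → ℝ} {E : ℝ → ℂ}
    (hw : ∀ v ∈ Set.Icc c d, HasDerivAt w (w' v) v) (hw' : ContinuousOn w' (Set.Icc c d))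
    (hh : ∀ v ∈ Set.Icc c d, HasDerivAt h (h' v) v) (hh' : ContinuousOn h' (Set.Icc c d))
    (h0 : ∀ v ∈ Set.Icc c d, h v ≠ 0)
    (hE : ∀ v ∈ Set.Icc c d, HasDerivAt E (E v * ((((h v)⁻¹ : ℝ) : ℂ) * Complex.I)) v)
    (hc : w c = 0) (hd : w d = 0) :
    ∫ v in c..d, (w v : ℂ) * E v =
      Complex.I * ∫ v in c..d, ((w' v * h v + w v * h' v : ℝ) : ℂ) * E v := by
  have hI : Set.uIcc c d = Set.Icc c d := Set.uIcc_of_le hcd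
  have hwc : ContinuousOn w (Set.Icc c d) := fun u hu => (hw u hu).continuousAt.continuousWithinAt
  have hhc : ContinuousOn h (Set.Icc c d) := fun u hu => (hh u hu).continuousAt.continuousWithinAt
  have hEc : ContinuousOn E (Set.Icc c d) := fun u hu => (hE u hu).continuousAt.continuousWithinAt
  have hparts := intervalIntegral.integral_mul_deriv_eq_deriv_mul
    (u := fun v => ((w v * h v : ℝ) : ℂ)) (u' := fun v => ((w' v * h v + w v * h' v : ℝ) : ℂ))
    (fun v hv => ((hw v (hI ▸ hv)).mul (hh v (hI ▸ hv))).ofReal_comp) (fun v hv => hE v (hI ▸ hv))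
    (ContinuousOn.intervalIntegrable (by
      rw [hI]
      exact Complex.continuous_ofReal.comp_continuousOn ((hw'.mul hhc).add (hwc.mul hh'))))
    (ContinuousOn.intervalIntegrable (by
      rw [hI]
      exact hEc.mul ((Complex.continuous_ofReal.comp_continuousOn (hhc.inv₀ h0)).mul
        continuousOn_const)))
  have hlhs : ∫ v in c..d, ((w v * h v : ℝ) : ℂ) * (E v * ((((h v)⁻¹ : ℝ) : ℂ) * Complex.I)) =
      Complex.I * ∫ v in c..d, (w v : ℂ) * E v := by
    rw [← intervalIntegral.integral_const_mul]
    refine intervalIntegral.integral_congr fun u hu => ?_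
    have : (h u : ℂ) ≠ 0 := by exact_mod_cast h0 u (hI ▸ hu)
    push_cast; field_simp
  rw [hlhs, hc, hd] at hparts
  simp only [zero_mul, Complex.ofReal_zero, sub_zero, zero_sub] at hparts
  have h2 : Complex.I * (Complex.I * ∫ v in c..d, (w v : ℂ) * E v) =
    Complex.I * -∫ v in c..d, ((w' v * h v + w v * h' v : ℝ) : ℂ) * E v := congrArg _ hparts
  rw [← mul_assoc, Complex.I_mul_I] at h2
  linear_combination -h2

/-- The nonstationary case: the integral decays like `ξ⁻²`. -/
lemma exists_norm_integral_wgt_le : ∃ C : ℝ, 1 ≤ C ∧ ∀ t ξ : ℝ, 1 ≤ t → ξ ≠ 0 →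
    (ξ < 0 ∨ 8 * t ≤ 2 * Real.pi * ξ) →
    ‖∫ v, (wgt v : ℂ) * (osc t v * ex (ξ * v))‖ ≤ C / ξ ^ 2 := by
  obtain ⟨C, hC, b0, b1, b2, -⟩ := exists_wgt_bounds
  refine ⟨2752 * C * 4, by linarith, fun t ξ ht hξ hcase => ?_⟩
  set κ := 2 * Real.pi * ξ with hκ
  have hpi := Real.pi_gt_three
  have hκ0 : κ ≠ 0 := by rw [hκ]; positivity
  have hκa : 0 < |κ| := abs_pos.2 hκ0
  have hsupp : Function.support (fun v => (wgt v : ℂ) * (osc t v * ex (ξ * v))) ⊆ Set.Ioc (1 / 4) 4 := by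
    intro v hv
    rw [Function.mem_support] at hv
    by_contra hcon
    apply hv
    rw [Set.mem_Ioc, not_and_or, not_lt, not_le] at hcon
    rcases hcon with h | h
    · rw [wgt_of_le (by linarith)]; simp
    · rw [wgt_of_ge (by linarith)]; simp
  rw [← intervalIntegral.integral_eq_integral_of_support_subset hsupp]
  set E : ℝ → ℂ := fun v => osc t v * ex (ξ * v) with hE
  have hden : ∀ v ∈ Set.Icc (1 / 4 : ℝ) 4, |κ| / 8 ≤ |κ * v - t| ∧ t ≤ |κ * v - t| := by
    intro v hv
    rcases hcase with h | h
    · have hneg : κ < 0 := by rw [hκ]; exact mul_neg_of_pos_of_neg (by positivity) h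
      have h3 : |κ * v - t| = -κ * v + t := by
        rw [abs_of_neg (by nlinarith [hv.1])]; ring
      rw [abs_of_neg hneg, h3]
      constructor <;> nlinarith [hv.1]
    · have hp : 0 < κ := by linarith
      have h3 : κ * (1 / 4) ≤ κ * v := mul_le_mul_of_nonneg_left hv.1 hp.le
      rw [abs_of_pos hp, abs_of_pos (by linarith)]
      constructor <;> linarith
  have hdne : ∀ v ∈ Set.Icc (1 / 4 : ℝ) 4, κ * v - t ≠ 0 := fun v hv h => by
    have := (hden v hv).1; rw [h, abs_zero] at this; linarith
  have hv0 : ∀ v ∈ Set.Icc (1 / 4 : ℝ) 4, v ≠ 0 := fun v hv => by have := hv.1; intro h; linarith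
  set h : ℝ → ℝ := fun v => v / (κ * v - t) with hh
  set h' : ℝ → ℝ := fun v => -t / (κ * v - t) ^ 2 with hh'
  set h'' : ℝ → ℝ := fun v => 2 * t * κ / (κ * v - t) ^ 3 with hh''
  have dlin : ∀ v : ℝ, HasDerivAt (fun v => κ * v - t) κ v := fun v => by
    have := ((hasDerivAt_id v).const_mul κ).sub_const t
    rw [mul_one] at this; exact this
  have d1 : ∀ v ∈ Set.Icc (1 / 4 : ℝ) 4, HasDerivAt h (h' v) v := fun v hv => by
    have := (hasDerivAt_id v).div (dlin v) (hdne v hv)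
    refine this.congr_deriv ?_
    simp only [hh', id]; congr 1; ring
  have d2 : ∀ v ∈ Set.Icc (1 / 4 : ℝ) 4, HasDerivAt h' (h'' v) v := fun v hv => by
    have := (hasDerivAt_const v (-t)).div ((dlin v).pow 2) (pow_ne_zero 2 (hdne v hv))
    refine this.congr_deriv ?_
    have := hdne v hv
    simp only [hh'', Pi.pow_apply]; field_simp; push_cast; ring
  have c0 : ContinuousOn (fun v => κ * v - t) (Set.Icc (1 / 4 : ℝ) 4) := by fun_prop
  have c1 : ContinuousOn h' (Set.Icc (1 / 4 : ℝ) 4) :=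
    continuousOn_const.div (c0.pow 2) fun v hv => pow_ne_zero 2 (hdne v hv)
  have c2 : ContinuousOn h'' (Set.Icc (1 / 4 : ℝ) 4) :=
    continuousOn_const.div (c0.pow 3) fun v hv => pow_ne_zero 3 (hdne v hv)
  have hne : ∀ v ∈ Set.Icc (1 / 4 : ℝ) 4, h v ≠ 0 := fun v hv => div_ne_zero (hv0 v hv) (hdne v hv)
  have hEE : ∀ v : ℝ, E v = Complex.exp (((κ * v - t * Real.log v : ℝ) : ℂ) * Complex.I) := fun v => by
    simp only [hE, osc, ex]
    rw [← Complex.exp_add]; congr 1; push_cast; rw [hκ]; push_cast; ring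
  have dE : ∀ v ∈ Set.Icc (1 / 4 : ℝ) 4,
      HasDerivAt E (E v * ((((h v)⁻¹ : ℝ) : ℂ) * Complex.I)) v := fun v hv => by
    have hlog := (Real.hasDerivAt_log (hv0 v hv)).const_mul t
    have hlin := (hasDerivAt_id v).const_mul κ
    have := (((hlin.sub hlog).ofReal_comp).mul_const Complex.I).cexp
    have e : E = fun v => Complex.exp (((κ * v - t * Real.log v : ℝ) : ℂ) * Complex.I) := funext hEE
    rw [e]
    refine this.congr_deriv ?_
    simp only [hh, Pi.sub_apply, id]
    congr 3
    have := hv0 v hv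
    rw [inv_div]; field_simp
  have nE : ∀ v, ‖E v‖ = 1 := fun v => by rw [hEE]; exact Complex.norm_exp_ofReal_mul_I _
  have e1 := integral_by_parts_osc (by norm_num : (1 / 4 : ℝ) ≤ 4) (fun v _ => hasDerivAt_wgt v)
    (contDiff_deriv_wgt (n := 0)).continuous.continuousOn d1 c1 hne dE
    (wgt_of_le (by norm_num)) (wgt_of_ge (by norm_num))
  have hwc := (contDiff_wgt (n := 0)).continuous.continuousOn (s := Set.Icc (1 / 4 : ℝ) 4)
  have hwc1 := (contDiff_deriv_wgt (n := 0)).continuous.continuousOn (s := Set.Icc (1 / 4 : ℝ) 4)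
  have hwc2 := (contDiff_deriv_deriv_wgt (n := 0)).continuous.continuousOn (s := Set.Icc (1 / 4 : ℝ) 4)
  have hhc : ContinuousOn h (Set.Icc (1 / 4 : ℝ) 4) := fun u hu =>
    (d1 u hu).continuousAt.continuousWithinAt
  have e2 := integral_by_parts_osc (by norm_num : (1 / 4 : ℝ) ≤ 4)
    (w := fun v => deriv wgt v * h v + wgt v * h' v)
    (fun v hv => ((hasDerivAt_deriv_wgt v).mul (d1 v hv)).add ((hasDerivAt_wgt v).mul (d2 v hv)))
    (((hwc2.mul hhc).add (hwc1.mul c1)).add ((hwc1.mul c1).add (hwc.mul c2))) d1 c1 hne dE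
    (by rw [wgt_of_le (by norm_num), deriv_wgt_of_lt (by norm_num)]; ring)
    (by rw [wgt_of_ge (by norm_num), deriv_wgt_of_gt (by norm_num)]; ring)
  rw [e1, e2, norm_mul, norm_mul, Complex.norm_I, one_mul, one_mul]
  set ρ := 1 / |κ| with hρ
  have hρ0 : 0 < ρ := by positivity
  have hdρ : ∀ v ∈ Set.Icc (1 / 4 : ℝ) 4, 1 / |κ * v - t| ≤ 8 * ρ := fun v hv => by
    have := one_div_le_one_div_of_le (by positivity) (hden v hv).1
    rw [one_div_div] at this
    refine this.trans (le_of_eq ?_); rw [hρ]; ring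
  have B0 : ∀ v ∈ Set.Icc (1 / 4 : ℝ) 4, |h v| ≤ 32 * ρ := fun v hv => by
    simp only [hh]
    rw [abs_div, abs_of_pos (by linarith [hv.1]), div_eq_mul_one_div]
    calc v * (1 / |κ * v - t|) ≤ 4 * (8 * ρ) := by
          have := hdρ v hv
          have := hv.2
          gcongr
      _ = _ := by ring
  have B1 : ∀ v ∈ Set.Icc (1 / 4 : ℝ) 4, |h' v| ≤ 8 * ρ := fun v hv => by
    simp only [hh']
    have hD : 0 < |κ * v - t| := abs_pos.2 (hdne v hv)
    rw [abs_div, abs_neg, abs_of_pos (by linarith : 0 < t), abs_pow]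
    calc t / |κ * v - t| ^ 2 ≤ |κ * v - t| / |κ * v - t| ^ 2 := by
          have := (hden v hv).2
          gcongr
      _ = 1 / |κ * v - t| := by rw [sq]; field_simp
      _ ≤ _ := hdρ v hv
  have B2 : ∀ v ∈ Set.Icc (1 / 4 : ℝ) 4, |h'' v| ≤ 128 * ρ := fun v hv => by
    simp only [hh'']
    have hD : 0 < |κ * v - t| := abs_pos.2 (hdne v hv)
    rw [abs_div, abs_mul, abs_pow, abs_of_pos (by linarith : 0 < 2 * t)]
    calc 2 * t * |κ| / |κ * v - t| ^ 3 ≤ 2 * |κ * v - t| * |κ| / |κ * v - t| ^ 3 := by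
          have := (hden v hv).2
          gcongr
      _ = 2 * |κ| * ((1 / |κ * v - t|) * (1 / |κ * v - t|)) := by field_simp
      _ ≤ 2 * |κ| * ((8 * ρ) * (8 * ρ)) := by
          have := hdρ v hv
          gcongr
      _ = _ := by rw [hρ]; field_simp; norm_num
  have habs : ∀ v ∈ Set.Icc (1 / 4 : ℝ) 4, |(deriv (deriv wgt) v * h v + deriv wgt v * h' v +
      (deriv wgt v * h' v + wgt v * h'' v)) * h v +
      (deriv wgt v * h v + wgt v * h' v) * h' v| ≤ 2752 * 4 * C * ρ ^ 2 := fun v hv => by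
    have B0 := B0 v hv
    have B1 := B1 v hv
    have B2 := B2 v hv
    have b0 := b0 v
    have b1 := b1 v
    have b2 := b2 v
    calc _ ≤ (|deriv (deriv wgt) v| * |h v| + |deriv wgt v| * |h' v| +
      (|deriv wgt v| * |h' v| + |wgt v| * |h'' v|)) * |h v| +
      (|deriv wgt v| * |h v| + |wgt v| * |h' v|) * |h' v| := by
          simp only [← abs_mul]
          refine (abs_add_le _ _).trans ?_
          rw [abs_mul, abs_mul (deriv wgt v * h v + wgt v * h' v)]
          gcongr
          · exact (abs_add_le _ _).trans (add_le_add (abs_add_le _ _) (abs_add_le _ _))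
          · exact abs_add_le _ _
      _ ≤ (C * (32 * ρ) + C * (8 * ρ) + (C * (8 * ρ) + C * (128 * ρ))) * (32 * ρ) +
          (C * (32 * ρ) + C * (8 * ρ)) * (8 * ρ) := by gcongr
      _ = 5952 * C * ρ ^ 2 := by ring
      _ ≤ _ := by gcongr; norm_num
  have hfin := intervalIntegral.norm_integral_le_of_norm_le_const (a := 1 / 4) (b := 4)
    (C := 2752 * 4 * C * ρ ^ 2)
    (f := fun v => (((deriv (deriv wgt) v * h v + deriv wgt v * h' v +
      (deriv wgt v * h' v + wgt v * h'' v)) * h v +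
      (deriv wgt v * h v + wgt v * h' v) * h' v : ℝ) : ℂ) * E v) (fun v hv => by
      rw [Set.uIoc_of_le (by norm_num)] at hv
      rw [norm_mul, nE, mul_one, Complex.norm_real]
      exact habs v ⟨hv.1.le, hv.2⟩)
  refine hfin.trans ?_
  have hρξ : ρ ^ 2 * 36 ≤ 1 / ξ ^ 2 := by
    rw [hρ, div_pow, one_pow, sq_abs, hκ, div_mul_eq_mul_div, one_mul, div_le_div_iff₀ (by positivity) (by positivity)]
    have h36 : 36 ≤ (2 * Real.pi) ^ 2 := by nlinarith
    rw [one_mul, mul_pow]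
    gcongr
  have h4 : |(4:ℝ) - 1 / 4| ≤ 4 := by norm_num
  calc _ ≤ 2752 * 4 * C * ρ ^ 2 * 4 := by gcongr
    _ ≤ 2752 * C * 4 * (ρ ^ 2 * 36) := by nlinarith [sq_nonneg ρ]
    _ ≤ 2752 * C * 4 * (1 / ξ ^ 2) := by gcongr
    _ = _ := by ring

section Fourier

open FourierTransform

/-- The function `y ↦ bump (y / N) y ^ (-1/2 - it)`. -/
noncomputable def bumpOsc (t N y : ℝ) : ℂ := (((√N)⁻¹ * wgt (y / N) : ℝ) : ℂ) * osc t y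

/-- The integral of `bumpOsc t ξ u * e(u)` over `u`. -/
noncomputable def dualInt (t ξ : ℝ) : ℂ := ∫ u, bumpOsc t ξ u * ex u

lemma bumpOsc_of_le {t N y : ℝ} (hN : 0 < N) (hy : y ≤ N / 2) : bumpOsc t N y = 0 := by
  rw [bumpOsc, wgt_of_le (by rw [div_le_iff₀ hN]; linarith)]; simp

lemma bumpOsc_of_ge {t N y : ℝ} (hN : 0 < N) (hy : 2 * N ≤ y) : bumpOsc t N y = 0 := by
  rw [bumpOsc, wgt_of_ge (by rw [le_div_iff₀ hN]; linarith)]; simp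

lemma continuous_bumpOsc (t : ℝ) {N : ℝ} (hN : 0 < N) : Continuous (bumpOsc t N) := by
  rw [continuous_iff_continuousAt]
  intro y
  rcases lt_or_ge 0 y with hy | hy
  · refine ContinuousAt.mul ?_ ((continuousOn_osc t).continuousAt (Ioi_mem_nhds hy))
    have : Continuous fun y => (((√N)⁻¹ * wgt (y / N) : ℝ) : ℂ) :=
      Complex.continuous_ofReal.comp (continuous_const.mul
        ((contDiff_wgt (n := 0)).continuous.comp (continuous_id.div_const N)))
    exact this.continuousAt
  · have : bumpOsc t N =ᶠ[nhds y] fun _ => (0:ℂ) := by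
      filter_upwards [Iio_mem_nhds (by linarith : y < N / 2)] with x hx using bumpOsc_of_le hN hx.le
    exact continuousAt_const.congr this.symm

lemma integral_bumpOsc_mul_ex (t ℓ : ℝ) {N : ℝ} (hN : 0 < N) :
    ∫ y, bumpOsc t N y * ex (ℓ * y) =
      ((√N : ℝ) : ℂ) * osc t N * ∫ v, (wgt v : ℂ) * (osc t v * ex (ℓ * N * v)) := by
  have h := Measure.integral_comp_mul_left (fun y => bumpOsc t N y * ex (ℓ * y)) N
  have h2 : ∫ y, bumpOsc t N y * ex (ℓ * y) =
      (N : ℂ) * ∫ v, bumpOsc t N (N * v) * ex (ℓ * (N * v)) := by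
    rw [h, abs_of_pos (by positivity), Complex.real_smul, ← mul_assoc, ← Complex.ofReal_mul,
      mul_inv_cancel₀ hN.ne', Complex.ofReal_one, one_mul]
  rw [h2, ← integral_const_mul, ← integral_const_mul]
  refine integral_congr_ae (Filter.Eventually.of_forall fun v => ?_)
  simp only []
  rcases le_or_gt v (1 / 2) with hv | hv
  · rw [wgt_of_le hv, bumpOsc_of_le hN (by nlinarith)]; simp
  · have e1 : N * v / N = v := by field_simp
    have e2 : (N : ℂ) * ((√N : ℝ) : ℂ)⁻¹ = ((√N : ℝ) : ℂ) := by
      rw [← Complex.ofReal_inv, ← Complex.ofReal_mul, ← div_eq_mul_inv, Real.div_sqrt]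
    rw [bumpOsc, e1, osc_mul t hN.ne' (by linarith : v ≠ 0), mul_assoc ℓ N v, Complex.ofReal_mul,
      Complex.ofReal_inv]
    linear_combination ((wgt v : ℂ) * osc t N * osc t v * ex (ℓ * (N * v))) * e2

lemma integral_bumpOsc_mul_ex_nat (t : ℝ) {N : ℝ} (hN : 0 < N) {k : ℝ} (hk : 0 < k) :
    ∫ y, bumpOsc t N y * ex (k * y) =
      (((√k)⁻¹ : ℝ) : ℂ) * osc (-t) k * dualInt t (k * N) := by
  have h := Measure.integral_comp_mul_left (fun y => bumpOsc t (k * N) y * ex y) k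
  have h2 : dualInt t (k * N) = (k : ℂ) * ∫ v, bumpOsc t (k * N) (k * v) * ex (k * v) := by
    rw [h, abs_of_pos (by positivity), Complex.real_smul, ← mul_assoc, ← Complex.ofReal_mul,
      mul_inv_cancel₀ hk.ne', Complex.ofReal_one, one_mul, dualInt]
  rw [h2, ← integral_const_mul, ← integral_const_mul]
  refine integral_congr_ae (Filter.Eventually.of_forall fun v => ?_)
  simp only []
  rcases le_or_gt v (N / 2) with hv | hv
  · rw [bumpOsc_of_le hN hv, bumpOsc_of_le (by positivity) (by nlinarith)]; simp
  · have hv0 : v ≠ 0 := by linarith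
    have e1 : k * v / (k * N) = v / N := by field_simp
    have e2 : (k : ℂ) * (((√k : ℝ) : ℂ)⁻¹ * ((√k : ℝ) : ℂ)⁻¹) = 1 := by
      rw [← Complex.ofReal_inv, ← Complex.ofReal_mul, ← Complex.ofReal_mul, ← mul_inv,
        Real.mul_self_sqrt hk.le, mul_inv_cancel₀ hk.ne', Complex.ofReal_one]
    have e3 : osc (-t) k * osc t k = 1 := by
      rw [← osc_add, neg_add_cancel, osc]; simp
    rw [bumpOsc, bumpOsc, e1, osc_mul t hk.ne' hv0, Real.sqrt_mul hk.le, mul_inv]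
    push_cast
    linear_combination (-((√N : ℝ) : ℂ)⁻¹ * (wgt (v / N) : ℂ) * osc t v * ex (k * v)) * e3 +
      (-((√N : ℝ) : ℂ)⁻¹ * (wgt (v / N) : ℂ) * osc t v * ex (k * v)) * (osc (-t) k * osc t k) * e2

lemma exists_norm_integral_bumpOsc_le : ∃ C : ℝ, 1 ≤ C ∧ ∀ t N ℓ : ℝ, 1 ≤ t → 0 < N → ℓ ≠ 0 →
    (ℓ < 0 ∨ 8 * t ≤ 2 * Real.pi * (ℓ * N)) →
    ‖∫ y, bumpOsc t N y * ex (ℓ * y)‖ ≤ C * (√N / N ^ 2) * (1 / ℓ ^ 2) := by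
  obtain ⟨C, hC, h⟩ := exists_norm_integral_wgt_le
  refine ⟨C, hC, fun t N ℓ ht hN hℓ hcase => ?_⟩
  rw [integral_bumpOsc_mul_ex t ℓ hN, norm_mul, norm_mul, norm_osc, mul_one, Complex.norm_real,
    Real.norm_of_nonneg (Real.sqrt_nonneg _)]
  have := h t (ℓ * N) ht (mul_ne_zero hℓ hN.ne')
    (hcase.imp (fun h => mul_neg_of_neg_of_pos h hN) id)
  calc _ ≤ √N * (C / (ℓ * N) ^ 2) := by gcongr
    _ = _ := by rw [mul_pow]; field_simp

lemma exists_norm_dualInt_le : ∃ C : ℝ, 1 ≤ C ∧ ∀ t ξ : ℝ, 1 ≤ t → 1 ≤ ξ →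
    8 * t ≤ 2 * Real.pi * ξ → ‖dualInt t ξ‖ ≤ C := by
  obtain ⟨C, hC, h⟩ := exists_norm_integral_bumpOsc_le
  refine ⟨C, hC, fun t ξ ht hξ hcase => ?_⟩
  have := h t ξ 1 ht (by linarith) one_ne_zero (Or.inr (by linarith))
  simp only [one_mul] at this
  refine this.trans ?_
  have h2 : √ξ / ξ ^ 2 ≤ 1 := by
    rw [div_le_one (by positivity)]
    calc √ξ ≤ ξ := Real.sqrt_le_iff.2 ⟨by linarith, by nlinarith⟩
      _ ≤ ξ ^ 2 := by nlinarith
  nlinarith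

lemma exists_norm_dualInt_sub_le : ∃ C : ℝ, 1 ≤ C ∧ ∀ t ξ ξ' : ℝ, 1 ≤ t → 0 < ξ → ξ ≤ ξ' →
    ξ' ≤ 2 * ξ → ‖dualInt t ξ - dualInt t ξ'‖ ≤ C * (√ξ / √t) * ((ξ' - ξ) / ξ) := by
  obtain ⟨C, hC, -, -, -, hlip⟩ := exists_wgt_bounds
  refine ⟨73728 * C, by linarith, fun t ξ ξ' ht hξ hle hle2 => ?_⟩
  have hξ' : 0 < ξ' := by linarith
  set a := ξ / 4 with ha
  set b := 8 * ξ with hb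
  have ha0 : 0 < a := by positivity
  have hab : a ≤ b := by rw [ha, hb]; linarith
  have hsupp : ∀ η, ξ ≤ η → η ≤ 2 * ξ →
      Function.support (fun u => bumpOsc t η u * ex u) ⊆ Set.Ioc a b := by
    intro η h1 h2 u hu
    rw [Function.mem_support] at hu
    by_contra hcon
    apply hu
    rw [Set.mem_Ioc, not_and_or, not_lt, not_le] at hcon
    rcases hcon with h | h
    · rw [bumpOsc_of_le (by linarith) (by rw [ha] at h; linarith), zero_mul]
    · rw [bumpOsc_of_ge (by linarith) (by rw [hb] at h; linarith), zero_mul]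
  set g : ℝ → ℂ := fun u => osc t u * ex u with hg
  have hgc : ContinuousOn g (Set.Ioi 0) := (continuousOn_osc t).mul continuous_ex.continuousOn
  set q : ℝ → ℝ := fun u => (√ξ)⁻¹ * wgt (u / ξ) - (√ξ')⁻¹ * wgt (u / ξ') with hq
  set q' : ℝ → ℝ := fun u => (√ξ)⁻¹ * (deriv wgt (u / ξ) / ξ) - (√ξ')⁻¹ * (deriv wgt (u / ξ') / ξ')
    with hq'
  have hcb : ∀ η, 0 < η → IntervalIntegrable (fun u => bumpOsc t η u * ex u) volume a b :=
    fun η hη => ((continuous_bumpOsc t hη).mul continuous_ex).intervalIntegrable _ _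
  have hdiff : dualInt t ξ - dualInt t ξ' = ∫ u in a..b, (q u : ℂ) * g u := by
    rw [dualInt, dualInt,
      ← intervalIntegral.integral_eq_integral_of_support_subset (hsupp ξ le_rfl (by linarith)),
      ← intervalIntegral.integral_eq_integral_of_support_subset (hsupp ξ' hle hle2),
      ← intervalIntegral.integral_sub (hcb ξ hξ) (hcb ξ' hξ')]
    refine intervalIntegral.integral_congr fun u _ => ?_
    simp only [bumpOsc, hq, hg]; push_cast; ring
  have hdw : ∀ η u : ℝ, HasDerivAt (fun u => wgt (u / η)) (deriv wgt (u / η) / η) u := fun η u => by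
    have := (hasDerivAt_wgt (u / η)).comp u ((hasDerivAt_id u).div_const η)
    refine this.congr_deriv ?_
    ring
  have hdq : ∀ u, HasDerivAt q (q' u) u := fun u =>
    ((hdw ξ u).const_mul _).sub ((hdw ξ' u).const_mul _)
  have hq'c : Continuous q' := by
    have := (contDiff_deriv_wgt (n := 0)).continuous
    simp only [hq']
    fun_prop
  set B : ℝ → ℂ := fun x => ∫ u in a..x, g u with hB
  have hI : Set.uIcc a b = Set.Icc a b := Set.uIcc_of_le hab
  have hgi : ∀ x ∈ Set.Icc a b, IntervalIntegrable g volume a x := fun x hx =>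
    (hgc.mono fun u hu => by
      rw [Set.uIcc_of_le hx.1] at hu; exact ha0.trans_le hu.1).intervalIntegrable
  have hdB : ∀ x ∈ Set.uIcc a b, HasDerivAt B (g x) x := fun x hx => by
    have hx' := hI ▸ hx
    have hx0 : 0 < x := ha0.trans_le hx'.1
    exact intervalIntegral.integral_hasDerivAt_right (hgi x hx')
      (hgc.stronglyMeasurableAtFilter isOpen_Ioi x hx0) (hgc.continuousAt (Ioi_mem_nhds hx0))
  have hparts := intervalIntegral.integral_mul_deriv_eq_deriv_mul
    (fun x (_ : x ∈ Set.uIcc a b) => (hdq x).ofReal_comp) hdB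
    ((Complex.continuous_ofReal.comp hq'c).intervalIntegrable _ _) (hgi b ⟨hab, le_rfl⟩)
  have hqb : q b = 0 := by
    simp only [hq]
    rw [wgt_of_ge, wgt_of_ge] <;> [skip; (rw [le_div_iff₀ hξ']; linarith); (rw [le_div_iff₀ hξ]; linarith)]
    simp
  have hBa : B a = 0 := intervalIntegral.integral_same
  rw [hqb, hBa, Complex.ofReal_zero, zero_mul, mul_zero, sub_zero, zero_sub] at hparts
  rw [hdiff, hparts, norm_neg]
  have hq'b : ∀ u ∈ Set.Ioc a b, |q' u| ≤ 64 * C * ((ξ' - ξ) / (ξ * √ξ * ξ)) := by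
    intro u hu
    have hu0 : 0 < u := ha0.trans hu.1
    have hs0 : 0 < √u := Real.sqrt_pos.2 hu0
    have hre : ∀ η, 0 < η → (√η)⁻¹ * (deriv wgt (u / η) / η) =
        (√u ^ 3)⁻¹ * (deriv wgt (u / η) * √(u / η) ^ 3) := fun η hη => by
      have h1 : 0 < √η := Real.sqrt_pos.2 hη
      rw [Real.sqrt_div hu0.le, div_pow]
      have : √η ^ 3 = η * √η := by rw [pow_succ, Real.sq_sqrt hη.le]
      rw [this]
      field_simp
    simp only [hq']
    rw [hre ξ hξ, hre ξ' hξ', ← mul_sub, abs_mul, abs_of_pos (by positivity)]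
    have h1 : |u / ξ - u / ξ'| ≤ 8 * ((ξ' - ξ) / ξ) := by
      have e : u / ξ - u / ξ' = u * ((ξ' - ξ) / (ξ * ξ')) := by field_simp
      rw [e, abs_of_nonneg (mul_nonneg hu0.le (div_nonneg (by linarith) (by positivity)))]
      calc _ ≤ (8 * ξ) * ((ξ' - ξ) / (ξ * ξ)) := by
            have h0 : 0 ≤ ξ' - ξ := by linarith
            have h1 : u ≤ 8 * ξ := hu.2
            gcongr
        _ = _ := by field_simp
    have h2 : (√u ^ 3)⁻¹ ≤ 8 * (ξ * √ξ)⁻¹ := by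
      have h3 : √ξ / 2 ≤ √u := by
        have : √a = √ξ / 2 := by
          rw [ha, Real.sqrt_div hξ.le, show (4:ℝ) = 2 ^ 2 by norm_num, Real.sqrt_sq (by norm_num)]
        rw [← this]; exact Real.sqrt_le_sqrt hu.1.le
      have hsξ : 0 < √ξ := Real.sqrt_pos.2 hξ
      calc (√u ^ 3)⁻¹ ≤ ((√ξ / 2) ^ 3)⁻¹ := by gcongr
        _ = 8 * (√ξ ^ 3)⁻¹ := by field_simp; norm_num
        _ = _ := by rw [pow_succ, Real.sq_sqrt hξ.le]
    calc _ ≤ (8 * (ξ * √ξ)⁻¹) * (C * (8 * ((ξ' - ξ) / ξ))) := by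
          gcongr
          exact (hlip _ _).trans (by gcongr)
      _ = _ := by
          have hsξ : 0 < √ξ := Real.sqrt_pos.2 hξ
          field_simp
          ring
  have hBb : ∀ u ∈ Set.Ioc a b, ‖B u‖ ≤ 18 * b / √t := fun u hu => by
    refine (norm_integral_osc_mul_ex_le ht ha0 hu.1.le).trans ?_
    gcongr
    exact hu.2
  have hfin := intervalIntegral.norm_integral_le_of_norm_le_const (a := a) (b := b)
    (C := 64 * C * ((ξ' - ξ) / (ξ * √ξ * ξ)) * (18 * b / √t))
    (f := fun u => ((q' u : ℝ) : ℂ) * B u) (fun u hu => by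
      rw [Set.uIoc_of_le hab] at hu
      rw [norm_mul, Complex.norm_real]
      exact mul_le_mul (hq'b u hu) (hBb u hu) (norm_nonneg _) (le_trans (abs_nonneg _) (hq'b u hu)))
  refine hfin.trans ?_
  have hsξ : 0 < √ξ := Real.sqrt_pos.2 hξ
  have hst : 0 < √t := Real.sqrt_pos.2 (by linarith)
  have hba : |b - a| ≤ 8 * ξ := by rw [abs_of_nonneg (by linarith)]; linarith
  have h0 : 0 ≤ ξ' - ξ := by linarith
  calc _ ≤ 64 * C * ((ξ' - ξ) / (ξ * √ξ * ξ)) * (18 * (8 * ξ) / √t) * (8 * ξ) := by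
        gcongr
    _ = 73728 * C * (√ξ / √t) * ((ξ' - ξ) / ξ) := by
        have e : √ξ * √ξ = ξ := Real.mul_self_sqrt hξ.le
        have e2 : √ξ ^ 2 = ξ := Real.sq_sqrt hξ.le
        field_simp
        rw [e2]; ring

lemma fourier_eq_integral_ex (f : ℝ → ℂ) (ξ : ℝ) : 𝓕 f ξ = ∫ y, f y * ex (-ξ * y) := by
  rw [Real.fourier_eq']
  refine integral_congr_ae (Filter.Eventually.of_forall fun y => ?_)
  simp only [ex, smul_eq_mul]
  rw [mul_comm]
  congr 2
  simp only [RCLike.inner_apply, conj_trivial]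
  push_cast; ring_nf

lemma exists_norm_poisson_le : ∃ C : ℝ, 1 ≤ C ∧ ∀ (t N : ℝ) (M b : ℕ), 1 ≤ t → 0 < N →
    2 * N ≤ M → 8 * t ≤ 2 * Real.pi * ((b + 1) * N) →
    ‖∑ n ∈ Finset.Ioc 0 M, bumpOsc t N n - (∫ y, bumpOsc t N y) -
      ∑ k ∈ Finset.Ioc 0 b, (((√k)⁻¹ : ℝ) : ℂ) * osc (-t) k * dualInt t (k * N)‖ ≤
        C * (√N / N ^ 2) := by
  obtain ⟨C, hC, h⟩ := exists_norm_integral_bumpOsc_le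
  set A : ℝ := ∑' n : ℤ, 1 / (n : ℝ) ^ 2 with hA
  have hsA : Summable fun n : ℤ => 1 / (n : ℝ) ^ 2 := Real.summable_one_div_int_pow.2 one_lt_two
  have hA0 : 0 ≤ A := tsum_nonneg fun n => by positivity
  refine ⟨C * (A + 1), by nlinarith, fun t N M b ht hN hM hb => ?_⟩
  set s : Finset ℤ := insert 0 ((Finset.Ioc 0 b).image fun k : ℕ => -(k : ℤ)) with hs
  have hF : ∀ n : ℤ, n ∉ s → ‖𝓕 (bumpOsc t N) n‖ ≤ C * (√N / N ^ 2) * (1 / (n : ℝ) ^ 2) := by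
    intro n hn
    rw [hs, Finset.mem_insert, not_or] at hn
    have hn0 : (n : ℝ) ≠ 0 := by exact_mod_cast hn.1
    rw [fourier_eq_integral_ex]
    have := h t N (-n) ht hN (neg_ne_zero.2 hn0) ?_
    · rwa [neg_sq] at this
    · rcases lt_or_gt_of_ne hn.1 with h0 | h0
      · right
        have hbn : (b : ℤ) + 1 ≤ -n := by
          by_contra hcon
          refine hn.2 (Finset.mem_image.2 ⟨(-n).toNat, ?_, ?_⟩)
          · rw [Finset.mem_Ioc]; omega
          · rw [Int.toNat_of_nonneg (by omega)]; ring
        have : (b : ℝ) + 1 ≤ -n := by exact_mod_cast hbn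
        refine hb.trans ?_
        gcongr
      · left
        have : (0:ℝ) < n := by exact_mod_cast h0
        linarith
  have hsum : Summable fun n : ℤ => 𝓕 (bumpOsc t N) n :=
    Summable.of_norm_bounded_eventually (hsA.mul_left (C * (√N / N ^ 2))) (by
      filter_upwards [s.finite_toSet.compl_mem_cofinite] with n hn using hF n hn)
  have hO : (bumpOsc t N) =O[Filter.cocompact ℝ] fun x => |x| ^ (-(2:ℝ)) := by
    have : bumpOsc t N =ᶠ[Filter.cocompact ℝ] fun _ => (0:ℂ) := by
      filter_upwards [(isCompact_Icc (a := (0:ℝ)) (b := 2 * N)).compl_mem_cocompact] with x hx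
      rw [Set.mem_compl_iff, Set.mem_Icc, not_and_or, not_le, not_le] at hx
      rcases hx with hx | hx
      · exact bumpOsc_of_le hN (by linarith)
      · exact bumpOsc_of_ge hN hx.le
    exact this.trans_isBigO (Asymptotics.isBigO_zero _ _)
  have hP := Real.tsum_eq_tsum_fourier_of_rpow_decay_of_summable (continuous_bumpOsc t hN)
    one_lt_two hO hsum 0
  have hL : ∑' n : ℤ, bumpOsc t N (0 + n) = ∑ n ∈ Finset.Ioc 0 M, bumpOsc t N n := by
    rw [tsum_eq_sum (s := (Finset.Ioc 0 M).map Nat.castEmbedding)]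
    · rw [Finset.sum_map]; simp
    · intro n hn
      rw [zero_add]
      rcases le_or_gt n 0 with h0 | h0
      · have : (n : ℝ) ≤ 0 := by exact_mod_cast h0
        exact bumpOsc_of_le hN (by linarith)
      · have : (M : ℤ) < n := by
          by_contra hcon
          refine hn (Finset.mem_map.2 ⟨n.toNat, ?_, ?_⟩)
          · rw [Finset.mem_Ioc]; omega
          · rw [Nat.castEmbedding_apply, Int.toNat_of_nonneg h0.le]
        have : (M : ℝ) < n := by exact_mod_cast this
        exact bumpOsc_of_ge hN (by linarith)
  have hR : ∑' n : ℤ, 𝓕 (bumpOsc t N) n * fourier n ((0 : ℝ) : UnitAddCircle) =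
      ∑' n : ℤ, 𝓕 (bumpOsc t N) n := by
    refine tsum_congr fun n => ?_
    simp
  rw [hL, hR] at hP
  have hS : ∑ n ∈ s, 𝓕 (bumpOsc t N) n = (∫ y, bumpOsc t N y) +
      ∑ k ∈ Finset.Ioc 0 b, (((√k)⁻¹ : ℝ) : ℂ) * osc (-t) k * dualInt t (k * N) := by
    rw [hs, Finset.sum_insert (by simp), Finset.sum_image (by simp)]
    congr 1
    · rw [fourier_eq_integral_ex]; simp [ex_zero]
    · refine Finset.sum_congr rfl fun k hk => ?_
      have hk0 : (0:ℝ) < k := by exact_mod_cast (Finset.mem_Ioc.1 hk).1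
      rw [fourier_eq_integral_ex, ← integral_bumpOsc_mul_ex_nat t hN hk0]
      simp
  rw [sub_sub, ← hS, hP]
  classical
  have hG : ∑' n : ℤ, 𝓕 (bumpOsc t N) n - ∑ n ∈ s, 𝓕 (bumpOsc t N) n =
      ∑' n : ℤ, (𝓕 (bumpOsc t N) n - if n ∈ s then 𝓕 (bumpOsc t N) n else 0) := by
    have h1 : HasSum (fun n : ℤ => if n ∈ s then 𝓕 (bumpOsc t N) n else 0)
        (∑ n ∈ s, if n ∈ s then 𝓕 (bumpOsc t N) n else 0) :=
      hasSum_sum_of_ne_finset_zero fun n hn => if_neg hn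
    rw [(hsum.hasSum.sub h1).tsum_eq]
    congr 1
    exact Finset.sum_congr rfl fun n hn => (if_pos hn).symm
  rw [hG]
  refine (tsum_of_norm_bounded (hsA.hasSum.mul_left (C * (√N / N ^ 2))) fun n => ?_).trans ?_
  · split_ifs with hn
    · rw [sub_self, norm_zero]; positivity
    · rw [sub_zero]; exact hF n hn
  · rw [← hA]
    have : 0 ≤ C * (√N / N ^ 2) := by positivity
    nlinarith

lemma norm_zsum_neg (a b : ℕ) (t : ℝ) : ‖zsum a b (-t)‖ = ‖zsum a b t‖ := by
  rw [← Complex.norm_conj (zsum a b t), zsum, zsum, map_sum]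
  congr 1
  refine Finset.sum_congr rfl fun n _ => ?_
  rw [map_mul, conj_osc, Complex.conj_ofReal]

lemma exists_norm_sum_bumpOsc_sub_le : ∃ C : ℝ, 1 ≤ C ∧ ∀ (t N : ℝ) (M b : ℕ), 1 ≤ t → 1 ≤ N →
    2 * N ≤ M → 8 * t ≤ 2 * Real.pi * ((b + 1) * N) → b * N ≤ 4 * t →
    ‖∑ n ∈ Finset.Ioc 0 M, bumpOsc t N n - (∫ y, bumpOsc t N y)‖ ≤
      C * (√N / N ^ 2 + ‖zsum 0 b t‖ + ∑ m ∈ Finset.Ioc 0 b, (1 / (m : ℝ)) * ‖zsum 0 m t‖) := by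
  obtain ⟨C₁, hC₁, h₁⟩ := exists_norm_poisson_le
  obtain ⟨C₂, hC₂, h₂⟩ := exists_norm_dualInt_le
  obtain ⟨C₃, hC₃, h₃⟩ := exists_norm_dualInt_sub_le
  refine ⟨C₁ + C₂ + 2 * C₃, by linarith, fun t N M b ht hN hM hb hb' => ?_⟩
  have hN0 : 0 < N := by linarith
  have hP := h₁ t N M b ht hN0 hM hb
  have hA : ‖∑ k ∈ Finset.Ioc 0 b, (((√k)⁻¹ : ℝ) : ℂ) * osc (-t) k * dualInt t (k * N)‖ ≤
      C₂ * ‖zsum 0 b t‖ + 2 * C₃ * ∑ m ∈ Finset.Ioc 0 b, (1 / (m : ℝ)) * ‖zsum 0 m t‖ := by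
    have := sum_Ioc_mul_eq_abel (fun k => dualInt t (k * N))
      (fun k => (((√k)⁻¹ : ℝ) : ℂ) * osc (-t) k) 0 b (Nat.zero_le b)
    simp only [mul_comm _ (dualInt t _)]
    rw [this]
    refine (norm_add_le _ _).trans (add_le_add ?_ ?_)
    · rw [norm_mul]
      refine mul_le_mul (h₂ _ _ ht ?_ ?_) (norm_zsum_neg 0 b t).le (norm_nonneg _) (by linarith)
      · push_cast
        have : (0:ℝ) ≤ b := Nat.cast_nonneg b
        nlinarith
      · push_cast; exact hb
    · rw [Finset.mul_sum]
      refine (norm_sum_le _ _).trans (Finset.sum_le_sum fun m hm => ?_)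
      have hm' := Finset.mem_Ioc.1 hm
      have hm1 : (1:ℝ) ≤ m := by exact_mod_cast hm'.1
      have hmb : (m:ℝ) ≤ b := by exact_mod_cast hm'.2
      rw [norm_mul, ← mul_assoc]
      refine mul_le_mul ?_ (norm_zsum_neg 0 m t).le (norm_nonneg _) (by positivity)
      refine (h₃ t (m * N) ((m + 1 : ℕ) * N) ht (by positivity) ?_ ?_).trans ?_
      · push_cast; nlinarith
      · push_cast; nlinarith
      · have e : ((m + 1 : ℕ) * N - m * N) / (m * N) = 1 / (m : ℝ) := by
          push_cast; field_simp; ring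
        rw [e]
        have h4 : √(m * N) / √t ≤ 2 := by
          rw [div_le_iff₀ (Real.sqrt_pos.2 (by linarith))]
          calc √(m * N) ≤ √(2 ^ 2 * t) := Real.sqrt_le_sqrt (by nlinarith)
            _ = 2 * √t := by rw [Real.sqrt_mul (by norm_num), Real.sqrt_sq (by norm_num)]
        have : 0 ≤ 1 / (m:ℝ) := by positivity
        have : C₃ * (√(m * N) / √t) ≤ 2 * C₃ := by nlinarith
        gcongr
  have h0 := norm_nonneg (zsum 0 b t)
  have h5 : 0 ≤ ∑ m ∈ Finset.Ioc 0 b, (1 / (m : ℝ)) * ‖zsum 0 m t‖ :=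
    Finset.sum_nonneg fun m _ => by positivity
  have h6 : 0 ≤ √N / N ^ 2 := by positivity
  have := norm_sub_le_norm_sub_add_norm_sub
    (∑ n ∈ Finset.Ioc 0 M, bumpOsc t N n - (∫ y, bumpOsc t N y))
    (∑ k ∈ Finset.Ioc 0 b, (((√k)⁻¹ : ℝ) : ℂ) * osc (-t) k * dualInt t (k * N)) 0
  rw [sub_zero, sub_zero] at this
  have k1 := mul_nonneg (by linarith : 0 ≤ C₁) h0
  have k2 := mul_nonneg (by linarith : 0 ≤ C₁) h5
  have k3 := mul_nonneg (by linarith : 0 ≤ C₂) h5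
  have k4 := mul_nonneg (by linarith : 0 ≤ C₂) h6
  have k5 := mul_nonneg (by linarith : 0 ≤ C₃) h6
  have k6 := mul_nonneg (by linarith : 0 ≤ C₃) h0
  linarith

end Fourier

lemma integral_fract_mul_deriv {f f' : ℝ → ℂ} {P : ℕ} (hP : 1 ≤ P)
    (hf : ∀ y ∈ Set.Icc (1:ℝ) P, HasDerivAt f (f' y) y) (hf' : ContinuousOn f' (Set.Icc (1:ℝ) P))
    (h0 : f P = 0) :
    ∫ y in (1:ℝ)..P, ((Int.fract y : ℝ) : ℂ) * f' y =
      -f 1 - (∫ y in (1:ℝ)..P, f y) + ∑ n ∈ Finset.Ioc 0 P, f n := by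
  have hP' : (1:ℝ) ≤ P := by exact_mod_cast hP
  have hI : Set.uIcc (1:ℝ) P = Set.Icc (1:ℝ) P := Set.uIcc_of_le hP'
  set c : ℕ → ℂ := fun k => if k = 0 then 0 else 1 with hc
  have hcs : ∀ n : ℕ, ∑ k ∈ Finset.Icc 0 n, c k = n := by
    intro n
    rw [Finset.sum_ite, Finset.sum_const_zero, zero_add, Finset.sum_const, nsmul_eq_mul, mul_one]
    congr 1
    have : Finset.filter (fun k => ¬ k = 0) (Finset.Icc 0 n) = Finset.Ioc 0 n := by
      ext k; simp only [Finset.mem_filter, Finset.mem_Icc, Finset.mem_Ioc]; omega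
    rw [this, Nat.card_Ioc, Nat.sub_zero]
  have hderiv : ∀ y ∈ Set.Icc (1:ℝ) P, deriv f y = f' y := fun y hy => (hf y hy).deriv
  have hfi : IntegrableOn (deriv f) (Set.Icc (1:ℝ) P) :=
    (integrableOn_congr_fun hderiv measurableSet_Icc).2
      (hf'.integrableOn_compact isCompact_Icc)
  have habel := sum_mul_eq_sub_integral_mul₀' c (if_pos rfl) P
    (fun y hy => (hf y hy).differentiableAt) hfi
  simp only [hcs] at habel
  rw [h0, zero_mul, zero_sub] at habel
  have hs : ∑ k ∈ Finset.Icc 0 P, f k * c k = ∑ n ∈ Finset.Ioc 0 P, f n := by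
    have : Finset.Icc 0 P = insert 0 (Finset.Ioc 0 P) := by
      ext k; simp only [Finset.mem_insert, Finset.mem_Icc, Finset.mem_Ioc]; omega
    rw [this, Finset.sum_insert (by simp)]
    simp only [hc, if_true, mul_zero, zero_add]
    refine Finset.sum_congr rfl fun k hk => ?_
    rw [if_neg (by have := (Finset.mem_Ioc.1 hk).1; omega), mul_one]
  rw [hs] at habel
  have hf'i : IntervalIntegrable f' volume 1 P := (hI ▸ hf').intervalIntegrable
  have hparts := intervalIntegral.integral_mul_deriv_eq_deriv_mul
    (u := fun y : ℝ => (y : ℂ)) (u' := fun _ => 1)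
    (fun x (_ : x ∈ Set.uIcc (1:ℝ) P) => (hasDerivAt_id x).ofReal_comp)
    (fun x hx => hf x (hI ▸ hx)) (by simp) hf'i
  simp only [h0, one_mul, mul_zero, Complex.ofReal_one, zero_sub] at hparts
  have hi1 : IntervalIntegrable (fun y : ℝ => (y : ℂ) * f' y) volume 1 P :=
    hf'i.continuousOn_mul Complex.continuous_ofReal.continuousOn
  have hi2 : IntervalIntegrable (fun y : ℝ => f' y * ((⌊y⌋₊ : ℕ) : ℂ)) volume 1 P := by
    rw [intervalIntegrable_iff_integrableOn_Icc_of_le hP']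
    have := integrableOn_mul_sum_Icc c (m := 0) zero_le_one
      ((intervalIntegrable_iff_integrableOn_Icc_of_le hP').1 hf'i)
    simpa only [hcs] using this
  have hsplit : ∫ y in (1:ℝ)..P, ((Int.fract y : ℝ) : ℂ) * f' y =
      (∫ y in (1:ℝ)..P, (y : ℂ) * f' y) - ∫ y in (1:ℝ)..P, f' y * ((⌊y⌋₊ : ℕ) : ℂ) := by
    rw [← intervalIntegral.integral_sub hi1 hi2]
    refine intervalIntegral.integral_congr fun y hy => ?_
    rw [hI] at hy
    have : (Int.fract y : ℝ) = y - (⌊y⌋₊ : ℕ) := by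
      rw [natCast_floor_eq_intCast_floor (by linarith [hy.1]), Int.self_sub_floor]
    simp only [this]
    push_cast; ring
  have h3 : ∫ y in (1:ℝ)..P, f' y * ((⌊y⌋₊ : ℕ) : ℂ) = -∑ n ∈ Finset.Ioc 0 P, f n := by
    rw [habel, neg_neg, intervalIntegral.integral_of_le hP']
    exact setIntegral_congr_fun measurableSet_Ioc fun y hy => by
      rw [hderiv y ⟨hy.1.le, hy.2⟩]
  rw [hsplit, h3, hparts]
  ring

/-- The power `y ^ (-1/2 - it)`. -/
noncomputable def pw (t y : ℝ) : ℂ := (((√y)⁻¹ : ℝ) : ℂ) * osc t y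

lemma norm_pw (t y : ℝ) : ‖pw t y‖ = (√y)⁻¹ := by
  rw [pw, norm_mul, norm_osc, mul_one, Complex.norm_real, Real.norm_of_nonneg (by positivity)]

/-- The point `1/2 + it` on the critical line. -/
noncomputable def crit (t : ℝ) : ℂ := 1 / 2 + t * Complex.I

lemma crit_re (t : ℝ) : (crit t).re = 1 / 2 := by simp [crit]
lemma crit_im (t : ℝ) : (crit t).im = t := by simp [crit]

lemma crit_ne_zero (t : ℝ) : crit t ≠ 0 := fun h => by
  have := crit_re t; rw [h] at this; norm_num at this

lemma pw_eq_cpow (t : ℝ) {y : ℝ} (hy : 0 < y) : pw t y = (y : ℂ) ^ (-crit t) := by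
  rw [Complex.cpow_def_of_ne_zero (by exact_mod_cast hy.ne'), pw, osc, ← Complex.ofReal_log hy.le]
  have : (√y)⁻¹ = Real.exp (-(1 / 2) * Real.log y) := by
    rw [Real.sqrt_eq_rpow, ← Real.rpow_neg hy.le, Real.rpow_def_of_pos hy, mul_comm]
  rw [this, Complex.ofReal_exp, ← Complex.exp_add]
  congr 1
  rw [crit]; push_cast; ring

lemma hasDerivAt_pw (t : ℝ) {y : ℝ} (hy : 0 < y) :
    HasDerivAt (pw t) (-crit t / y * pw t y) y := by
  have hy' : (y : ℂ) ≠ 0 := by exact_mod_cast hy.ne'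
  have h := hasDerivAt_ofReal_cpow_const hy.ne' (neg_ne_zero.2 (crit_ne_zero t))
  have h2 : HasDerivAt (pw t) (-crit t * (y : ℂ) ^ (-crit t - 1)) y :=
    h.congr_of_eventuallyEq (by
      filter_upwards [Ioi_mem_nhds hy] with x hx using pw_eq_cpow t hx)
  refine h2.congr_deriv ?_
  rw [pw_eq_cpow t hy, Complex.cpow_sub _ _ hy', Complex.cpow_one]
  ring

lemma continuousOn_pw (t : ℝ) : ContinuousOn (pw t) (Set.Ioi 0) := fun _ hy =>
  (hasDerivAt_pw t hy).continuousAt.continuousWithinAt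

lemma measurable_pw (t : ℝ) : Measurable (pw t) := by
  unfold pw osc
  fun_prop

/-- The integral of `{y} y ^ (-s-1)` over `y > 0`, for `s = 1/2 + it`. -/
noncomputable def fractInt (t : ℝ) : ℂ :=
  ∫ y in Set.Ioi (0:ℝ), ((Int.fract y / y : ℝ) : ℂ) * pw t y

lemma measurable_fract_pw (t : ℝ) :
    Measurable fun y => ((Int.fract y / y : ℝ) : ℂ) * pw t y :=
  (Complex.measurable_ofReal.comp (measurable_fract.div measurable_id)).mul (measurable_pw t)

lemma norm_fract_pw_le_Ioc (t : ℝ) {y : ℝ} (hy : 0 < y) :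
    ‖((Int.fract y / y : ℝ) : ℂ) * pw t y‖ ≤ y ^ (-(1 / 2) : ℝ) := by
  rw [norm_mul, norm_pw, Complex.norm_real, Real.norm_of_nonneg (div_nonneg (Int.fract_nonneg y) hy.le),
    Real.sqrt_eq_rpow, ← Real.rpow_neg hy.le]
  have : Int.fract y / y ≤ 1 := by
    rw [div_le_one hy, Int.fract]
    have : (0:ℝ) ≤ ⌊y⌋ := by exact_mod_cast Int.floor_nonneg.2 hy.le
    linarith
  have h2 : 0 ≤ y ^ (-(1 / 2) : ℝ) := by positivity
  nlinarith

lemma norm_fract_pw_le_Ioi (t : ℝ) {y : ℝ} (hy : 0 < y) :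
    ‖((Int.fract y / y : ℝ) : ℂ) * pw t y‖ ≤ y ^ (-(3 / 2) : ℝ) := by
  rw [norm_mul, norm_pw, Complex.norm_real, Real.norm_of_nonneg (div_nonneg (Int.fract_nonneg y) hy.le),
    Real.sqrt_eq_rpow, ← Real.rpow_neg hy.le]
  calc Int.fract y / y * y ^ (-(1 / 2) : ℝ) ≤ 1 / y * y ^ (-(1 / 2) : ℝ) := by
        gcongr; exact (Int.fract_lt_one y).le
    _ = y ^ (-1 : ℝ) * y ^ (-(1 / 2) : ℝ) := by rw [Real.rpow_neg_one, one_div]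
    _ = _ := by rw [← Real.rpow_add hy]; norm_num

lemma integrableOn_fract_pw_Ioc (t : ℝ) :
    IntegrableOn (fun y => ((Int.fract y / y : ℝ) : ℂ) * pw t y) (Set.Ioc 0 1) := by
  have : IntegrableOn (fun y : ℝ => y ^ (-(1 / 2) : ℝ)) (Set.Ioc 0 1) := by
    rw [← intervalIntegrable_iff_integrableOn_Ioc_of_le zero_le_one]
    exact intervalIntegral.intervalIntegrable_rpow' (by norm_num)
  refine this.mono' (measurable_fract_pw t).aestronglyMeasurable ?_
  filter_upwards [ae_restrict_mem measurableSet_Ioc] with y hy using norm_fract_pw_le_Ioc t hy.1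

lemma integrableOn_fract_pw_Ioi (t : ℝ) {Y : ℝ} (hY : 0 < Y) :
    IntegrableOn (fun y => ((Int.fract y / y : ℝ) : ℂ) * pw t y) (Set.Ioi Y) := by
  refine (integrableOn_Ioi_rpow_of_lt (by norm_num : (-(3 / 2) : ℝ) < -1) hY).mono'
    (measurable_fract_pw t).aestronglyMeasurable ?_
  filter_upwards [ae_restrict_mem measurableSet_Ioi] with y hy using
    norm_fract_pw_le_Ioi t (hY.trans hy)

lemma integrableOn_fract_pw (t : ℝ) :
    IntegrableOn (fun y => ((Int.fract y / y : ℝ) : ℂ) * pw t y) (Set.Ioi 0) := by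
  rw [← Set.Ioc_union_Ioi_eq_Ioi zero_le_one]
  exact (integrableOn_fract_pw_Ioc t).union (integrableOn_fract_pw_Ioi t one_pos)

lemma integral_Ioi_rpow_three_halves {Y : ℝ} (hY : 0 < Y) :
    ∫ y in Set.Ioi Y, y ^ (-(3 / 2) : ℝ) = 2 * Y ^ (-(1 / 2) : ℝ) := by
  rw [integral_Ioi_rpow_of_lt (by norm_num) hY]
  norm_num
  ring_nf

lemma fractInt_eq (t : ℝ) : fractInt t = 1 / (1 - crit t) +
    ∫ y in Set.Ioi (1:ℝ), ((Int.fract y / y : ℝ) : ℂ) * pw t y := by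
  rw [fractInt, ← Set.Ioc_union_Ioi_eq_Ioi zero_le_one, setIntegral_union
    (Set.Ioc_disjoint_Ioi le_rfl) measurableSet_Ioi (integrableOn_fract_pw_Ioc t)
    (integrableOn_fract_pw_Ioi t one_pos)]
  congr 1
  have : ∫ y in Set.Ioc (0:ℝ) 1, ((Int.fract y / y : ℝ) : ℂ) * pw t y =
      ∫ y in (0:ℝ)..1, (y : ℂ) ^ (-crit t) := by
    rw [intervalIntegral.integral_of_le zero_le_one, integral_Ioc_eq_integral_Ioo,
      integral_Ioc_eq_integral_Ioo]
    refine setIntegral_congr_fun measurableSet_Ioo fun y hy => ?_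
    rw [Int.fract_eq_self.2 ⟨hy.1.le, hy.2⟩, div_self hy.1.ne', pw_eq_cpow t hy.1]
    simp
  rw [this, integral_cpow (Or.inl (by rw [Complex.neg_re, crit_re]; norm_num))]
  have hne : -crit t + 1 ≠ 0 := fun h => by
    have := congrArg Complex.re h
    rw [Complex.add_re, Complex.neg_re, crit_re] at this; norm_num at this
  rw [Complex.ofReal_one, Complex.one_cpow, Complex.ofReal_zero, Complex.zero_cpow hne]
  ring

/-- The function `s ∫ {y} y ^ (-s-1) dy` (which is `-ζ(s)`) at `s = 1/2 + it`. -/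
noncomputable def zz (t : ℝ) : ℂ := crit t * fractInt t

lemma norm_one_sub_crit (t : ℝ) : ‖1 - crit t‖ = ‖crit t‖ := by
  have : 1 - crit t = (starRingEnd ℂ) (crit t) := by
    apply Complex.ext <;> simp [crit]; norm_num
  rw [this, Complex.norm_conj]

lemma norm_zz_le (t : ℝ) : ‖zz t‖ ≤ 1 + ‖crit t * ∫ y in Set.Ioi (1:ℝ),
    ((Int.fract y / y : ℝ) : ℂ) * pw t y‖ := by
  rw [zz, fractInt_eq, mul_add]
  refine (norm_add_le _ _).trans (add_le_add_left ?_ _)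
  rw [norm_mul, norm_div, norm_one_sub_crit, norm_one, mul_one_div, div_self]
  exact norm_ne_zero_iff.2 (crit_ne_zero t)

lemma norm_crit_le (t : ℝ) : ‖crit t‖ ≤ 1 + |t| := by
  rw [crit]
  refine (norm_add_le _ _).trans ?_
  rw [norm_mul, Complex.norm_I, mul_one, Complex.norm_real, Real.norm_eq_abs]
  norm_num

lemma norm_tail_le (t : ℝ) {Y : ℝ} (hY : 0 < Y) :
    ∫ y in Set.Ioi Y, ‖((Int.fract y / y : ℝ) : ℂ) * pw t y‖ ≤ 2 * Y ^ (-(1 / 2) : ℝ) := by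
  rw [← integral_Ioi_rpow_three_halves hY]
  exact setIntegral_mono_on (integrableOn_fract_pw_Ioi t hY).norm
    (integrableOn_Ioi_rpow_of_lt (by norm_num) hY) measurableSet_Ioi
    fun y hy => norm_fract_pw_le_Ioi t (hY.trans hy)

lemma norm_zz_le_linear (t : ℝ) : ‖zz t‖ ≤ 3 + 2 * |t| := by
  refine (norm_zz_le t).trans ?_
  rw [norm_mul]
  have h1 := (norm_integral_le_integral_norm _).trans (norm_tail_le t one_pos)
  rw [Real.one_rpow, mul_one] at h1
  have := mul_le_mul (norm_crit_le t) h1 (norm_nonneg _) (by positivity)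
  linarith

lemma norm_zz_neg (t : ℝ) : ‖zz (-t)‖ = ‖zz t‖ := by
  rw [← Complex.norm_conj (zz t), zz, zz, map_mul, fractInt, fractInt, ← integral_conj]
  congr 2
  · apply Complex.ext <;> simp [crit]
  · refine integral_congr_ae (Filter.Eventually.of_forall fun y => ?_)
    simp only [pw]
    rw [map_mul, map_mul, conj_osc, Complex.conj_ofReal, Complex.conj_ofReal]

lemma continuous_zz : Continuous zz := by
  unfold zz
  refine Continuous.mul (by unfold crit; fun_prop) ?_
  unfold fractInt
  refine continuous_of_dominated (bound := fun y => ‖((Int.fract y / y : ℝ) : ℂ) * pw 0 y‖)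
    (fun t => (measurable_fract_pw t).aestronglyMeasurable) (fun t => ?_)
    (integrableOn_fract_pw 0).norm ?_
  · refine Filter.Eventually.of_forall fun y => ?_
    rw [norm_mul, norm_mul, norm_pw, norm_pw]
  · refine Filter.Eventually.of_forall fun y => ?_
    unfold pw
    have := continuous_osc y
    fun_prop

lemma hasDerivAt_cut (x : ℝ) : HasDerivAt cut (deriv cut x) x :=
  ((contDiff_cut (n := 1)).differentiable (by simp)).differentiableAt.hasDerivAt

lemma continuous_deriv_cut : Continuous (deriv cut) :=
  (contDiff_cut (n := 1)).continuous_deriv (by simp)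

lemma deriv_cut_of_le {x : ℝ} (hx : x ≤ 1) : deriv cut x = 0 := by
  refine IsLocalMax.deriv_eq_zero (Filter.Eventually.of_forall fun y => ?_)
  rw [cut_one hx]; exact cut_le_one y

lemma deriv_cut_of_ge {x : ℝ} (hx : 2 ≤ x) : deriv cut x = 0 := by
  refine IsLocalMin.deriv_eq_zero (Filter.Eventually.of_forall fun y => ?_)
  rw [cut_zero hx]; exact cut_nonneg y

lemma exists_deriv_cut_bound : ∃ C : ℝ, 1 ≤ C ∧ ∀ x, |deriv cut x| ≤ C := by
  have hs : HasCompactSupport (deriv cut) :=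
    HasCompactSupport.intro (isCompact_Icc (a := 1) (b := 2)) fun x hx => by
      rw [Set.mem_Icc, not_and_or, not_le, not_le] at hx
      rcases hx with h | h
      · exact deriv_cut_of_le h.le
      · exact deriv_cut_of_ge h.le
  obtain ⟨C, hC⟩ := continuous_deriv_cut.bounded_above_of_compact_support hs
  exact ⟨max 1 C, le_max_left _ _, fun x => (hC x).trans (le_max_right _ _)⟩

/-- The smoothly truncated power `y ^ (-1/2 - it)`, supported on `y ≤ 2 * Y`. -/
noncomputable def cutPw (t Y y : ℝ) : ℂ := ((cut (y / Y) : ℝ) : ℂ) * pw t y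

lemma cutPw_of_ge {t Y y : ℝ} (hY : 0 < Y) (hy : 2 * Y ≤ y) : cutPw t Y y = 0 := by
  rw [cutPw, cut_zero (by rwa [le_div_iff₀ hY])]; simp

lemma norm_cutPw_le (t Y y : ℝ) : ‖cutPw t Y y‖ ≤ (√y)⁻¹ := by
  rw [cutPw, norm_mul, norm_pw, Complex.norm_real, Real.norm_of_nonneg (cut_nonneg _)]
  have : 0 ≤ (√y)⁻¹ := by positivity
  nlinarith [cut_le_one (y / Y)]

lemma hasDerivAt_cut_div (Y y : ℝ) :
    HasDerivAt (fun y => ((cut (y / Y) : ℝ) : ℂ)) ((deriv cut (y / Y) / Y : ℝ) : ℂ) y := by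
  have := (hasDerivAt_cut (y / Y)).comp y ((hasDerivAt_id y).div_const Y)
  refine (this.ofReal_comp).congr_deriv ?_
  congr 1; ring

lemma hasDerivAt_cutPw (t Y : ℝ) {y : ℝ} (hy : 0 < y) :
    HasDerivAt (cutPw t Y) (((deriv cut (y / Y) / Y : ℝ) : ℂ) * pw t y +
      ((cut (y / Y) : ℝ) : ℂ) * (-crit t / y * pw t y)) y :=
  (hasDerivAt_cut_div Y y).mul (hasDerivAt_pw t hy)

lemma exists_norm_zz_le : ∃ C : ℝ, 1 ≤ C ∧ ∀ (t Y : ℝ) (P : ℕ), 1 ≤ Y → 2 * Y ≤ P →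
    ‖zz t‖ ≤ 2 + ‖(∫ y in (1:ℝ)..P, cutPw t Y y) - ∑ n ∈ Finset.Ioc 0 P, cutPw t Y n‖ +
      C * (1 + |t|) / √Y := by
  obtain ⟨C, hC, hCb⟩ := exists_deriv_cut_bound
  refine ⟨C + 2, by linarith, fun t Y P hY hP => ?_⟩
  have hY0 : 0 < Y := by linarith
  have hsY : 0 < √Y := Real.sqrt_pos.2 hY0
  have hP1 : (1:ℝ) ≤ P := by linarith
  have hcd : Continuous fun y : ℝ => ((deriv cut (y / Y) / Y : ℝ) : ℂ) := by
    have := continuous_deriv_cut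
    fun_prop
  have hcc : Continuous fun y : ℝ => ((cut (y / Y) : ℝ) : ℂ) := by
    have := (contDiff_cut (n := 0)).continuous
    fun_prop
  have hsub : Set.Icc (1:ℝ) P ⊆ Set.Ioi 0 := fun y hy => lt_of_lt_of_le one_pos hy.1
  have hpc : ContinuousOn (pw t) (Set.Icc (1:ℝ) P) := (continuousOn_pw t).mono hsub
  have hc1 : ContinuousOn (fun y : ℝ => ((deriv cut (y / Y) / Y : ℝ) : ℂ) * pw t y)
      (Set.Icc (1:ℝ) P) := hcd.continuousOn.mul hpc
  have hc2 : ContinuousOn (fun y : ℝ => ((cut (y / Y) : ℝ) : ℂ) * (-crit t / y * pw t y))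
      (Set.Icc (1:ℝ) P) := by
    refine hcc.continuousOn.mul (ContinuousOn.mul (ContinuousOn.div continuousOn_const
      Complex.continuous_ofReal.continuousOn fun y hy => ?_) hpc)
    have := hsub hy
    exact_mod_cast (ne_of_gt this)
  have hmain := integral_fract_mul_deriv (by exact_mod_cast hP1)
    (fun y hy => hasDerivAt_cutPw t Y (hsub hy)) (hc1.add hc2) (cutPw_of_ge (t := t) hY0 hP)
  set h : ℝ → ℂ := fun y => ((Int.fract y / y : ℝ) : ℂ) * pw t y with hh
  have hint : IntegrableOn h (Set.Ioi 1) := integrableOn_fract_pw_Ioi t one_pos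
  have hcint : IntegrableOn (fun y => ((cut (y / Y) : ℝ) : ℂ) * h y) (Set.Ioi 1) := by
    refine hint.bdd_mul (c := 1) hcc.aestronglyMeasurable (Filter.Eventually.of_forall fun y => ?_)
    rw [Complex.norm_real, Real.norm_of_nonneg (cut_nonneg _)]
    exact cut_le_one _
  have hF : ‖(∫ y in Set.Ioi 1, h y) - ∫ y in Set.Ioi 1, ((cut (y / Y) : ℝ) : ℂ) * h y‖ ≤
      2 / √Y := by
    rw [← integral_sub hint hcint]
    have e : ∫ y in Set.Ioi 1, (h y - ((cut (y / Y) : ℝ) : ℂ) * h y) =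
        ∫ y in Set.Ioi Y, (h y - ((cut (y / Y) : ℝ) : ℂ) * h y) := by
      refine setIntegral_eq_of_subset_of_forall_sdiff_eq_zero measurableSet_Ioi
        (Set.Ioi_subset_Ioi hY) fun y hy => ?_
      have : y ≤ Y := not_lt.1 hy.2
      rw [cut_one (by rw [div_le_one hY0]; exact this)]
      simp
    rw [e]
    have e2 := norm_tail_le t hY0
    rw [Real.rpow_neg hY0.le, ← Real.sqrt_eq_rpow, ← div_eq_mul_inv] at e2
    refine (norm_integral_le_integral_norm _).trans (le_trans ?_ e2)
    have hi := integrableOn_fract_pw_Ioi t hY0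
    refine setIntegral_mono_on ?_ hi.norm measurableSet_Ioi fun y _ => ?_
    · have h1 : IntegrableOn (fun y => h y - ((cut (y / Y) : ℝ) : ℂ) * h y) (Set.Ioi 1) :=
        hint.sub hcint
      exact (h1.mono_set (Set.Ioi_subset_Ioi hY)).norm
    · have : h y - ((cut (y / Y) : ℝ) : ℂ) * h y = ((1 - cut (y / Y) : ℝ) : ℂ) * h y := by
        push_cast; ring
      rw [this, norm_mul, Complex.norm_real,
        Real.norm_of_nonneg (by linarith [cut_le_one (y / Y)])]
      have h0 := norm_nonneg (h y)
      nlinarith [cut_nonneg (y / Y)]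
  have hcP : ∫ y in Set.Ioi 1, ((cut (y / Y) : ℝ) : ℂ) * h y =
      ∫ y in (1:ℝ)..P, ((cut (y / Y) : ℝ) : ℂ) * h y := by
    rw [intervalIntegral.integral_of_le hP1]
    refine setIntegral_eq_of_subset_of_forall_sdiff_eq_zero measurableSet_Ioi
      Set.Ioc_subset_Ioi_self fun y hy => ?_
    have : (P:ℝ) < y := by
      by_contra hcon
      exact hy.2 ⟨hy.1, not_lt.1 hcon⟩
    rw [cut_zero (by rw [le_div_iff₀ hY0]; linarith)]
    simp
  set u : ℝ → ℂ := fun y => ((Int.fract y : ℝ) : ℂ) * (((deriv cut (y / Y) / Y : ℝ) : ℂ) * pw t y)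
    with hu
  have hfm : ∀ q : ℝ → ℂ, ContinuousOn q (Set.Icc (1:ℝ) P) →
      IntervalIntegrable (fun y => ((Int.fract y : ℝ) : ℂ) * q y) volume 1 P := by
    intro q hq
    rw [intervalIntegrable_iff_integrableOn_Icc_of_le hP1]
    refine (hq.integrableOn_compact isCompact_Icc).bdd_mul (c := 1)
      (Complex.measurable_ofReal.comp measurable_fract).aestronglyMeasurable
      (Filter.Eventually.of_forall fun y => ?_)
    rw [Complex.norm_real, Real.norm_of_nonneg (Int.fract_nonneg _)]
    exact (Int.fract_lt_one y).le
  have hid : crit t * ∫ y in (1:ℝ)..P, ((cut (y / Y) : ℝ) : ℂ) * h y =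
      (∫ y in (1:ℝ)..P, u y) - ∫ y in (1:ℝ)..P, ((Int.fract y : ℝ) : ℂ) *
        (((deriv cut (y / Y) / Y : ℝ) : ℂ) * pw t y +
          ((cut (y / Y) : ℝ) : ℂ) * (-crit t / y * pw t y)) := by
    have hi2 : IntervalIntegrable (fun y => ((Int.fract y : ℝ) : ℂ) *
        (((deriv cut (y / Y) / Y : ℝ) : ℂ) * pw t y +
          ((cut (y / Y) : ℝ) : ℂ) * (-crit t / y * pw t y))) volume 1 P := hfm _ (hc1.add hc2)
    rw [← intervalIntegral.integral_sub (hfm _ hc1) hi2,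
      ← intervalIntegral.integral_const_mul]
    refine intervalIntegral.integral_congr fun y hy => ?_
    rw [Set.uIcc_of_le hP1] at hy
    have : (y : ℂ) ≠ 0 := by exact_mod_cast (ne_of_gt (hsub hy))
    simp only [hh]
    push_cast
    field_simp
    ring
  have hub : ‖∫ y in (1:ℝ)..P, u y‖ ≤ C / √Y := by
    have e : ∫ y in (1:ℝ)..P, u y = ∫ y in Y..(2 * Y), u y := by
      rw [intervalIntegral.integral_of_le hP1, intervalIntegral.integral_of_le (by linarith)]
      refine setIntegral_eq_of_subset_of_forall_sdiff_eq_zero measurableSet_Ioc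
        (Set.Ioc_subset_Ioc hY hP) fun y hy => ?_
      have : deriv cut (y / Y) = 0 := by
        rcases le_or_gt y Y with h1 | h1
        · exact deriv_cut_of_le (by rwa [div_le_one hY0])
        · refine deriv_cut_of_ge ?_
          rw [le_div_iff₀ hY0]
          by_contra hcon
          exact hy.2 ⟨h1, (not_le.1 hcon).le⟩
      simp only [hu, this]; simp
    rw [e]
    have := intervalIntegral.norm_integral_le_of_norm_le_const (a := Y) (b := 2 * Y) (f := u)
      (C := C / Y * (√Y)⁻¹) (fun y hy => by
        rw [Set.uIoc_of_le (by linarith)] at hy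
        simp only [hu]
        rw [norm_mul, norm_mul, norm_pw, Complex.norm_real, Complex.norm_real,
          Real.norm_of_nonneg (Int.fract_nonneg _), Real.norm_eq_abs, abs_div, abs_of_pos hY0]
        have h1 : |deriv cut (y / Y)| / Y ≤ C / Y := by gcongr; exact hCb _
        have h2 : (√y)⁻¹ ≤ (√Y)⁻¹ := by gcongr; exact hy.1.le
        have h3 : 0 ≤ |deriv cut (y / Y)| / Y * (√y)⁻¹ := by positivity
        calc _ ≤ 1 * (|deriv cut (y / Y)| / Y * (√y)⁻¹) := by
              gcongr; exact (Int.fract_lt_one y).le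
          _ ≤ _ := by rw [one_mul]; gcongr)
    refine this.trans (le_of_eq ?_)
    rw [show 2 * Y - Y = Y by ring, abs_of_pos hY0]
    field_simp
  refine (norm_zz_le t).trans ?_
  have hdec : crit t * (∫ y in Set.Ioi 1, h y) = (∫ y in (1:ℝ)..P, u y) + cutPw t Y 1 +
      ((∫ y in (1:ℝ)..P, cutPw t Y y) - ∑ n ∈ Finset.Ioc 0 P, cutPw t Y n) +
      crit t * ((∫ y in Set.Ioi 1, h y) - ∫ y in Set.Ioi 1, ((cut (y / Y) : ℝ) : ℂ) * h y) := by
    rw [mul_sub, hcP, hid, hmain]; ring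
  rw [hdec]
  have h1 : ‖cutPw t Y 1‖ ≤ 1 := (norm_cutPw_le t Y 1).trans (by simp)
  have h2 : ‖crit t * ((∫ y in Set.Ioi 1, h y) -
      ∫ y in Set.Ioi 1, ((cut (y / Y) : ℝ) : ℂ) * h y)‖ ≤ (1 + |t|) * (2 / √Y) := by
    rw [norm_mul]
    exact mul_le_mul (norm_crit_le t) hF (norm_nonneg _) (by positivity)
  have h3 : C / √Y ≤ C * (1 + |t|) / √Y := by
    gcongr
    nlinarith [abs_nonneg t]
  have h4 : (C + 2) * (1 + |t|) / √Y = C * (1 + |t|) / √Y + (1 + |t|) * (2 / √Y) := by ring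
  rw [h4]
  refine (add_le_add_right ((norm_add_le _ _).trans (add_le_add_left ((norm_add_le _ _).trans
    (add_le_add_left (norm_add_le _ _) _)) _)) _).trans ?_
  linarith

/-- The difference between the integral and the sum of `cutPw t Y`. -/
noncomputable def cutDefect (t Y : ℝ) (P : ℕ) : ℂ :=
  (∫ y in (1:ℝ)..P, cutPw t Y y) - ∑ n ∈ Finset.Ioc 0 P, cutPw t Y n

lemma bumpOsc_eq_cutPw_sub (t : ℝ) {N y : ℝ} (hN : 0 < N) (hy : 0 < y) :
    bumpOsc t N y = cutPw t N y - cutPw t (N / 2) y := by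
  have h1 : (√N)⁻¹ * wgt (y / N) = (cut (y / N) - cut (y / (N / 2))) * (√y)⁻¹ := by
    have e : y / (N / 2) = 2 * (y / N) := by field_simp
    have := Real.sqrt_pos.2 hN
    have := Real.sqrt_pos.2 hy
    rw [wgt, bump, e, Real.sqrt_div hy.le]
    field_simp
  rw [bumpOsc, h1, cutPw, cutPw, pw]
  push_cast; ring

lemma continuousOn_cutPw (t Y : ℝ) : ContinuousOn (cutPw t Y) (Set.Ioi 0) := fun _ hy =>
  (hasDerivAt_cutPw t Y hy).continuousAt.continuousWithinAt

lemma intervalIntegrable_cutPw (t Y : ℝ) {P : ℕ} (hP : 1 ≤ P) :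
    IntervalIntegrable (cutPw t Y) volume 1 P := by
  have hP1 : (1:ℝ) ≤ P := by exact_mod_cast hP
  refine ((continuousOn_cutPw t Y).mono fun y hy => ?_).intervalIntegrable
  rw [Set.uIcc_of_le hP1] at hy
  exact lt_of_lt_of_le one_pos hy.1

lemma cutDefect_eq_add (t : ℝ) {N : ℝ} {P : ℕ} (hN : 2 ≤ N) (hP : 2 * N ≤ P) :
    cutDefect t N P = cutDefect t (N / 2) P -
      (∑ n ∈ Finset.Ioc 0 P, bumpOsc t N n - ∫ y, bumpOsc t N y) := by
  have hN0 : 0 < N := by linarith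
  have hP1 : (1:ℝ) ≤ P := by linarith
  have hP1' : 1 ≤ P := by exact_mod_cast hP1
  have h1 : ∑ n ∈ Finset.Ioc 0 P, bumpOsc t N n = ∑ n ∈ Finset.Ioc 0 P, cutPw t N n -
      ∑ n ∈ Finset.Ioc 0 P, cutPw t (N / 2) n := by
    rw [← Finset.sum_sub_distrib]
    exact Finset.sum_congr rfl fun n hn => bumpOsc_eq_cutPw_sub t hN0
      (by exact_mod_cast (Finset.mem_Ioc.1 hn).1)
  have h2 : ∫ y, bumpOsc t N y =
      (∫ y in (1:ℝ)..P, cutPw t N y) - ∫ y in (1:ℝ)..P, cutPw t (N / 2) y := by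
    rw [← intervalIntegral.integral_eq_integral_of_support_subset (a := 1) (b := P),
      ← intervalIntegral.integral_sub (intervalIntegrable_cutPw t N hP1')
        (intervalIntegrable_cutPw t (N / 2) hP1')]
    · refine intervalIntegral.integral_congr fun y hy => ?_
      rw [Set.uIcc_of_le hP1] at hy
      exact bumpOsc_eq_cutPw_sub t hN0 (lt_of_lt_of_le one_pos hy.1)
    · intro y hy
      rw [Function.mem_support] at hy
      constructor
      · by_contra hcon
        exact hy (bumpOsc_of_le hN0 (by linarith))
      · by_contra hcon
        exact hy (bumpOsc_of_ge hN0 (by linarith))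
  rw [cutDefect, cutDefect, h1, h2]
  ring

lemma norm_cutDefect_le_add_sum (t : ℝ) {N : ℝ} (hN : 1 ≤ N) (P J : ℕ) (hP : 2 * (N * 2 ^ J) ≤ P) :
    ‖cutDefect t (N * 2 ^ J) P‖ ≤ ‖cutDefect t N P‖ + ∑ j ∈ Finset.Icc 1 J,
      ‖∑ n ∈ Finset.Ioc 0 P, bumpOsc t (N * 2 ^ j) n - ∫ y, bumpOsc t (N * 2 ^ j) y‖ := by
  induction J with
  | zero => simp
  | succ J ih =>
    have h1 : (1:ℝ) ≤ 2 ^ J := one_le_pow₀ one_le_two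
    have h2 : N * 2 ^ (J + 1) / 2 = N * 2 ^ J := by rw [pow_succ]; ring
    have h3 : (2:ℝ) ^ (J + 1) = 2 * 2 ^ J := by rw [pow_succ]; ring
    rw [cutDefect_eq_add t (by rw [h3]; nlinarith) hP, h2,
      Finset.sum_Icc_succ_top (by omega)]
    have := ih (by rw [h3] at hP; nlinarith)
    refine (norm_sub_le _ _).trans ?_
    linarith

lemma exists_norm_integral_cutPw_le : ∃ C : ℝ, 1 ≤ C ∧ ∀ (t Y : ℝ) (P : ℕ), 1 ≤ t → 1 ≤ Y →
    2 * Y ≤ P → ‖∫ y in (1:ℝ)..P, cutPw t Y y‖ ≤ C * √Y / t := by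
  obtain ⟨C, hC, hCb⟩ := exists_deriv_cut_bound
  refine ⟨1 + 2 * C, by linarith, fun t Y P ht hY hP => ?_⟩
  have hY0 : 0 < Y := by linarith
  have hP1 : (1:ℝ) ≤ P := by linarith
  have hI : Set.uIcc (1:ℝ) P = Set.Icc (1:ℝ) P := Set.uIcc_of_le hP1
  have hsub : Set.Icc (1:ℝ) P ⊆ Set.Ioi 0 := fun y hy => lt_of_lt_of_le one_pos hy.1
  have hs : ‖1 - crit t‖ ≥ t := by
    rw [norm_one_sub_crit]
    have := Complex.abs_im_le_norm (crit t)
    rw [crit_im] at this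
    exact (le_abs_self t).trans this
  have hs0 : 1 - crit t ≠ 0 := fun h => by rw [h, norm_zero] at hs; linarith
  have hdv : ∀ y ∈ Set.uIcc (1:ℝ) P,
      HasDerivAt (fun y : ℝ => (y : ℂ) * pw t y / (1 - crit t)) (pw t y) y := by
    intro y hy
    have hy0 := hsub (hI ▸ hy)
    have hy0' : (y : ℂ) ≠ 0 := by exact_mod_cast (ne_of_gt hy0)
    refine ((((hasDerivAt_id y).ofReal_comp).mul (hasDerivAt_pw t hy0)).div_const _).congr_deriv ?_
    simp only [id_eq, Complex.ofReal_one]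
    field_simp
    ring
  have hcd : Continuous fun y : ℝ => ((deriv cut (y / Y) / Y : ℝ) : ℂ) := by
    have := continuous_deriv_cut
    fun_prop
  have hparts := intervalIntegral.integral_mul_deriv_eq_deriv_mul
    (fun y (_ : y ∈ Set.uIcc (1:ℝ) P) => hasDerivAt_cut_div Y y) hdv
    (hcd.intervalIntegrable _ _)
    (((continuousOn_pw t).mono (hI ▸ hsub)).intervalIntegrable)
  have hcP : cut (P / Y) = 0 := cut_zero (by rwa [le_div_iff₀ hY0])
  have hc1 : cut (1 / Y) = 1 := cut_one (by rwa [div_le_one hY0])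
  have hpw1 : pw t 1 = 1 := by simp [pw, osc]
  simp only [hcP, hc1, hpw1, Complex.ofReal_zero, zero_mul, Complex.ofReal_one, one_mul,
    zero_sub] at hparts
  set u : ℝ → ℂ := fun y => ((deriv cut (y / Y) / Y : ℝ) : ℂ) * ((y : ℂ) * pw t y / (1 - crit t))
    with hu
  have hub : ‖∫ y in (1:ℝ)..P, u y‖ ≤ 2 * C * √Y / t := by
    have e : ∫ y in (1:ℝ)..P, u y = ∫ y in Y..(2 * Y), u y := by
      rw [intervalIntegral.integral_of_le hP1, intervalIntegral.integral_of_le (by linarith)]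
      refine setIntegral_eq_of_subset_of_forall_sdiff_eq_zero measurableSet_Ioc
        (Set.Ioc_subset_Ioc hY hP) fun y hy => ?_
      have : deriv cut (y / Y) = 0 := by
        rcases le_or_gt y Y with h1 | h1
        · exact deriv_cut_of_le (by rwa [div_le_one hY0])
        · refine deriv_cut_of_ge ?_
          rw [le_div_iff₀ hY0]
          by_contra hcon
          exact hy.2 ⟨h1, (not_le.1 hcon).le⟩
      simp only [hu, this]; simp
    rw [e]
    have := intervalIntegral.norm_integral_le_of_norm_le_const (a := Y) (b := 2 * Y) (f := u)
      (C := C / Y * (2 * √Y / t)) (fun y hy => by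
        rw [Set.uIoc_of_le (by linarith)] at hy
        have hy0 : 0 < y := hY0.trans hy.1
        simp only [hu]
        rw [norm_mul, norm_div, norm_mul, norm_pw, Complex.norm_real, Complex.norm_real,
          Real.norm_of_nonneg hy0.le, Real.norm_eq_abs, abs_div, abs_of_pos hY0, ← div_eq_mul_inv,
          Real.div_sqrt]
        have h2 : √y ≤ 2 * √Y := by
          calc √y ≤ √(2 ^ 2 * Y) := Real.sqrt_le_sqrt (by linarith [hy.2])
            _ = 2 * √Y := by rw [Real.sqrt_mul (by norm_num), Real.sqrt_sq (by norm_num)]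
        gcongr
        exact hCb _)
    refine this.trans (le_of_eq ?_)
    rw [show 2 * Y - Y = Y by ring, abs_of_pos hY0]
    field_simp
  have : ∫ y in (1:ℝ)..P, cutPw t Y y = ∫ y in (1:ℝ)..P, ((cut (y / Y) : ℝ) : ℂ) * pw t y := rfl
  rw [this, hparts]
  refine (norm_sub_le _ _).trans ?_
  rw [norm_neg, norm_div, norm_one]
  have h1 : 1 / ‖1 - crit t‖ ≤ √Y / t := by
    have : 1 ≤ √Y := Real.one_le_sqrt.2 hY
    gcongr
  calc _ ≤ √Y / t + 2 * C * √Y / t := add_le_add h1 hub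
    _ = _ := by ring

lemma norm_sum_cutPw_le (t : ℝ) {Y : ℝ} {P B : ℕ} (hY : 0 < Y) (hP : 2 * Y ≤ P)
    (hB : 2 * Y ≤ B + 1) : ‖∑ n ∈ Finset.Ioc 0 P, cutPw t Y n‖ ≤
      ∑ m ∈ Finset.Ioc 0 B, (cut (m / Y) - cut ((m + 1 : ℕ) / Y)) * ‖zsum 0 m t‖ := by
  have habel := sum_Ioc_mul_eq_abel (fun n => ((cut (n / Y) : ℝ) : ℂ)) (fun n => pw t n) 0 P
    (Nat.zero_le P)
  have hz : ∀ n : ℕ, 2 * Y ≤ n → cut (n / Y) = 0 := fun n hn => cut_zero (by rwa [le_div_iff₀ hY])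
  have h0 : cut ((P + 1 : ℕ) / Y) = 0 := hz _ (by push_cast; linarith)
  simp only [h0, Complex.ofReal_zero, zero_mul, zero_add] at habel
  have : ∑ n ∈ Finset.Ioc 0 P, cutPw t Y n =
    ∑ n ∈ Finset.Ioc 0 P, ((cut (n / Y) : ℝ) : ℂ) * pw t n := rfl
  rw [this, habel]
  have hnn : ∀ m : ℕ, 0 ≤ cut (m / Y) - cut ((m + 1 : ℕ) / Y) := fun m =>
    sub_nonneg.2 (antitone_cut (by gcongr; omega))
  have hle : ‖∑ m ∈ Finset.Ioc 0 P, (((cut (m / Y) : ℝ) : ℂ) - ((cut ((m + 1 : ℕ) / Y) : ℝ) : ℂ)) *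
      ∑ n ∈ Finset.Ioc 0 m, pw t n‖ ≤
      ∑ m ∈ Finset.Ioc 0 P, (cut (m / Y) - cut ((m + 1 : ℕ) / Y)) * ‖zsum 0 m t‖ := by
    refine (norm_sum_le _ _).trans (Finset.sum_le_sum fun m _ => ?_)
    rw [norm_mul, ← Complex.ofReal_sub, Complex.norm_real, Real.norm_of_nonneg (hnn m)]
    rfl
  refine hle.trans ?_
  rw [← Finset.sum_filter_of_ne (p := fun m => m ≤ B)]
  · refine Finset.sum_le_sum_of_subset_of_nonneg (fun m hm => ?_) fun m _ _ =>
      mul_nonneg (hnn m) (norm_nonneg _)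
    rw [Finset.mem_filter, Finset.mem_Ioc] at hm
    exact Finset.mem_Ioc.2 ⟨hm.1.1, hm.2⟩
  intro m _ hne
  by_contra hcon
  have hBm : (B:ℝ) + 1 ≤ m := by exact_mod_cast not_le.1 hcon
  apply hne
  rw [hz m (by linarith), hz (m + 1) (by push_cast; linarith)]
  simp

lemma sum_one_div_le (B : ℕ) : ∑ m ∈ Finset.Ioc 0 B, 1 / (m : ℝ) ≤ 1 + Real.log B := by
  have h := harmonic_le_one_add_log B
  rw [harmonic_eq_sum_Icc] at h
  push_cast at h
  have e : Finset.Ioc 0 B = Finset.Icc 1 B := rfl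
  simpa only [e, one_div] using h

set_option maxHeartbeats 1000000 in
lemma exists_zz_weights : ∃ C : ℝ, 1 ≤ C ∧ ∀ T : ℝ, 4 ≤ T → ∃ w : ℕ → ℝ, (∀ m, 0 ≤ w m) ∧
    ∑ m ∈ Finset.Ioc 0 ⌊4 * √T⌋₊, w m ≤ C * (1 + Real.log T) ^ 2 ∧
    ∀ t : ℝ, T ≤ t → t ≤ 2 * T → ‖zz t‖ ≤ C * (1 + Real.log T) ^ 2 +
      ∑ m ∈ Finset.Ioc 0 ⌊4 * √T⌋₊, w m * ‖zsum 0 m t‖ := by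
  obtain ⟨C₁, hC₁, h₁⟩ := exists_norm_zz_le
  obtain ⟨C₂, hC₂, h₂⟩ := exists_norm_integral_cutPw_le
  obtain ⟨C₃, hC₃, h₃⟩ := exists_norm_sum_bumpOsc_sub_le
  refine ⟨2 + 3 * C₁ + C₂ + 12 * C₃, by linarith, fun T hT => ?_⟩
  have hT0 : 0 < T := by linarith
  set N := √T with hN
  have hNN : N * N = T := Real.mul_self_sqrt hT0.le
  have hN2 : 2 ≤ N := by rw [hN]; exact Real.le_sqrt_of_sq_le (by linarith)
  have hN0 : 0 < N := by linarith
  set L := Real.log T with hL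
  have hL1 : 1 ≤ L := by
    rw [hL, Real.le_log_iff_exp_le hT0]
    linarith [Real.exp_one_lt_d9]
  set J := ⌈3 * L⌉₊ with hJ
  have hJle : (J:ℝ) ≤ 1 + 3 * L := by have := Nat.ceil_lt_add_one (by linarith : 0 ≤ 3 * L); linarith
  have hJT : T ^ 2 ≤ 2 ^ J := by
    have h1 : (2:ℝ) ^ J = Real.exp (J * Real.log 2) := by
      rw [Real.exp_nat_mul, Real.exp_log two_pos]
    have h2 : T ^ 2 = Real.exp ((2:ℕ) * L) := by rw [Real.exp_nat_mul, hL, Real.exp_log hT0]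
    rw [h1, h2, Real.exp_le_exp]
    have h3 : 3 * L ≤ J := Nat.le_ceil _
    have := Real.log_two_gt_d9
    push_cast
    nlinarith
  set B := ⌊4 * N⌋₊ with hB
  set bj : ℕ → ℕ := fun j => ⌊4 * T / (N * 2 ^ j)⌋₊ with hbj
  have hpow : ∀ j : ℕ, (1:ℝ) ≤ 2 ^ j := fun j => one_le_pow₀ one_le_two
  have hbjB : ∀ j, bj j ≤ B := fun j => Nat.floor_le_floor (by
    rw [div_le_iff₀ (by positivity), ← hNN]
    nlinarith [hpow j, mul_pos hN0 hN0])
  have hcutnn : ∀ m : ℕ, 0 ≤ cut (m / N) - cut ((m + 1 : ℕ) / N) := fun m =>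
    sub_nonneg.2 (antitone_cut (by gcongr; omega))
  set v : ℕ → ℕ → ℝ := fun j m => (if m = bj j then 1 else 0) + if m ≤ bj j then 1 / (m:ℝ) else 0
    with hv
  have hvnn : ∀ j m, 0 ≤ v j m := fun j m => by
    simp only [hv]; split_ifs <;> positivity
  refine ⟨fun m => (cut (m / N) - cut ((m + 1 : ℕ) / N)) + ∑ j ∈ Finset.Icc 1 J, C₃ * v j m,
    fun m => add_nonneg (hcutnn m) (Finset.sum_nonneg fun j _ => mul_nonneg (by linarith)
      (hvnn j m)), ?_, ?_⟩
  · rw [Finset.sum_add_distrib, Finset.sum_comm]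
    have e1 : ∑ m ∈ Finset.Ioc 0 B, (cut (m / N) - cut ((m + 1 : ℕ) / N)) ≤ 1 := by
      have : ∀ b : ℕ, ∑ m ∈ Finset.Ioc 0 b, (cut (m / N) - cut ((m + 1 : ℕ) / N)) =
          cut ((1:ℕ) / N) - cut ((b + 1 : ℕ) / N) := by
        intro b
        induction b with
        | zero => simp
        | succ b ih => rw [Finset.sum_Ioc_succ_top (Nat.zero_le b), ih]; ring
      rw [this]
      linarith [cut_le_one ((1:ℕ) / N), cut_nonneg ((B + 1 : ℕ) / N)]
    have hlogB : Real.log B ≤ 2 + L := by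
      have hB4 : (B:ℝ) ≤ 4 * T := (Nat.floor_le (by positivity)).trans (by nlinarith)
      have h1 : Real.log B ≤ Real.log (4 * T) := by
        refine Real.log_le_log ?_ hB4
        have : 1 ≤ B := Nat.le_floor (by push_cast; linarith)
        exact_mod_cast this
      have h2 : Real.log (4 * T) = 2 * Real.log 2 + L := by
        rw [Real.log_mul (by norm_num) hT0.ne', show (4:ℝ) = 2 ^ 2 by norm_num, Real.log_pow]
        push_cast; ring
      have := Real.log_two_lt_d9
      linarith
    have e2 : ∀ j ∈ Finset.Icc 1 J, ∑ m ∈ Finset.Ioc 0 B, C₃ * v j m ≤ C₃ * (4 + L) := by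
      intro j _
      rw [← Finset.mul_sum]
      refine mul_le_mul_of_nonneg_left ?_ (by linarith)
      simp only [hv]
      rw [Finset.sum_add_distrib]
      have a1 : ∑ m ∈ Finset.Ioc 0 B, (if m = bj j then (1:ℝ) else 0) ≤ 1 := by
        rw [Finset.sum_ite_eq']; split_ifs <;> norm_num
      have a2 : ∑ m ∈ Finset.Ioc 0 B, (if m ≤ bj j then 1 / (m:ℝ) else 0) ≤ 1 + Real.log B := by
        refine le_trans (Finset.sum_le_sum fun m _ => ?_) (sum_one_div_le B)
        split_ifs
        · exact le_rfl
        · positivity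
      linarith
    have e3 := Finset.sum_le_sum e2
    rw [Finset.sum_const, Nat.card_Icc, nsmul_eq_mul, Nat.add_sub_cancel] at e3
    have e4 : (J:ℝ) * (C₃ * (4 + L)) ≤ (1 + 3 * L) * (C₃ * (4 + L)) := by gcongr
    have e5 : 0 ≤ C₃ * ((1 + L) * (1 + L)) := by positivity
    nlinarith [mul_nonneg (by linarith : 0 ≤ C₃) (by linarith : 0 ≤ L),
      mul_nonneg (by linarith : 0 ≤ C₁ + C₂) (by positivity : 0 ≤ (1 + L) ^ 2)]
  · intro t ht ht2
    have ht1 : 1 ≤ t := by linarith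
    set Y := N * 2 ^ J with hY
    have hNY : N ≤ Y := by nlinarith [hpow J]
    set P := ⌈2 * Y⌉₊ with hP
    have hYP : 2 * Y ≤ P := Nat.le_ceil _
    have hz := h₁ t Y P (by linarith) hYP
    have hd := norm_cutDefect_le_add_sum t (by linarith : 1 ≤ N) P J hYP
    have hbump : ∀ j ∈ Finset.Icc 1 J,
        ‖∑ n ∈ Finset.Ioc 0 P, bumpOsc t (N * 2 ^ j) n - ∫ y, bumpOsc t (N * 2 ^ j) y‖ ≤
          C₃ + ∑ m ∈ Finset.Ioc 0 B, C₃ * v j m * ‖zsum 0 m t‖ := by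
      intro j hj
      have hjJ := (Finset.mem_Icc.1 hj).2
      have hNj : 1 ≤ N * 2 ^ j := by nlinarith [hpow j]
      have hNj0 : 0 < N * 2 ^ j := by linarith
      have hfl : (bj j : ℝ) ≤ 4 * T / (N * 2 ^ j) := Nat.floor_le (by positivity)
      have hfl2 : 4 * T / (N * 2 ^ j) < bj j + 1 := Nat.lt_floor_add_one _
      rw [le_div_iff₀ hNj0] at hfl
      rw [div_lt_iff₀ hNj0] at hfl2
      have := h₃ t (N * 2 ^ j) P (bj j) ht1 hNj ?_ ?_ ?_
      · refine this.trans ?_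
        have a1 : √(N * 2 ^ j) / (N * 2 ^ j) ^ 2 ≤ 1 := by
          rw [div_le_one (by positivity)]
          exact Real.sqrt_le_iff.2 ⟨by positivity, by nlinarith [one_le_pow₀ hNj (n := 2)]⟩
        have a2 : ∑ m ∈ Finset.Ioc 0 B, C₃ * v j m * ‖zsum 0 m t‖ = C₃ * (‖zsum 0 (bj j) t‖ +
            ∑ m ∈ Finset.Ioc 0 (bj j), 1 / (m:ℝ) * ‖zsum 0 m t‖) := by
          simp only [mul_assoc]
          rw [← Finset.mul_sum]
          congr 1
          simp only [hv, add_mul, ite_mul, one_mul, zero_mul]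
          rw [Finset.sum_add_distrib, Finset.sum_ite_eq', ← Finset.sum_filter]
          congr 1
          · split_ifs with h
            · rfl
            · have : bj j = 0 := by
                by_contra hne
                exact h (Finset.mem_Ioc.2 ⟨Nat.pos_of_ne_zero hne, hbjB j⟩)
              rw [this, zsum]; simp
          · refine Finset.sum_congr ?_ fun _ _ => rfl
            ext m
            simp only [Finset.mem_filter, Finset.mem_Ioc]
            have := hbjB j
            omega
        rw [a2]
        nlinarith
      · refine le_trans ?_ hYP
        have : (2:ℝ) ^ j ≤ 2 ^ J := pow_le_pow_right₀ one_le_two hjJ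
        rw [hY]; gcongr
      · have := Real.pi_gt_three
        have h6 : 8 * t ≤ 2 * 3 * ((bj j + 1) * (N * 2 ^ j)) := by linarith
        refine h6.trans ?_
        gcongr
      · linarith
    have hbase : ‖cutDefect t N P‖ ≤ C₂ +
        ∑ m ∈ Finset.Ioc 0 B, (cut (m / N) - cut ((m + 1 : ℕ) / N)) * ‖zsum 0 m t‖ := by
      refine (norm_sub_le _ _).trans (add_le_add ?_ ?_)
      · refine (h₂ t N P ht1 (by linarith) (by linarith)).trans ?_
        rw [div_le_iff₀ (by linarith)]
        have : √N ≤ t := Real.sqrt_le_iff.2 ⟨by linarith, by nlinarith⟩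
        gcongr
      · refine norm_sum_cutPw_le t hN0 (by linarith) ?_
        have := Nat.lt_floor_add_one (4 * N)
        linarith
    have htail : C₁ * (1 + |t|) / √Y ≤ 3 * C₁ := by
      have hs : T ≤ √Y := Real.le_sqrt_of_sq_le (by nlinarith [hpow J])
      rw [div_le_iff₀ (by linarith), abs_of_nonneg (by linarith)]
      nlinarith
    have hsum := Finset.sum_le_sum hbump
    rw [Finset.sum_add_distrib, Finset.sum_const, Nat.card_Icc, nsmul_eq_mul,
      Nat.add_sub_cancel] at hsum
    have hsplit : ∑ m ∈ Finset.Ioc 0 B, ((cut (m / N) - cut ((m + 1 : ℕ) / N)) +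
        ∑ j ∈ Finset.Icc 1 J, C₃ * v j m) * ‖zsum 0 m t‖ =
        ∑ m ∈ Finset.Ioc 0 B, (cut (m / N) - cut ((m + 1 : ℕ) / N)) * ‖zsum 0 m t‖ +
        ∑ j ∈ Finset.Icc 1 J, ∑ m ∈ Finset.Ioc 0 B, C₃ * v j m * ‖zsum 0 m t‖ := by
      simp only [add_mul, Finset.sum_add_distrib, Finset.sum_mul]
      rw [Finset.sum_comm]
    rw [hsplit]
    have hfin : 2 + C₂ + J * C₃ + 3 * C₁ ≤ (2 + 3 * C₁ + C₂ + 12 * C₃) * (1 + L) ^ 2 := by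
      have h1 : (J:ℝ) * C₃ ≤ (1 + 3 * L) * C₃ := by gcongr
      have h2 : 1 + 3 * L ≤ 12 * (1 + L) ^ 2 := by nlinarith
      have h3 : (1 + 3 * L) * C₃ ≤ 12 * (1 + L) ^ 2 * C₃ := by gcongr
      have h4 : 1 ≤ (1 + L) ^ 2 := by nlinarith
      have h5 := mul_le_mul_of_nonneg_left h4 (by linarith : 0 ≤ 2 + 3 * C₁ + C₂)
      linarith
    rw [cutDefect] at hd
    linarith

lemma one_add_log_sq_le {η : ℝ} (hη : 0 < η) {T : ℝ} (hT : 1 ≤ T) :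
    (1 + Real.log T) ^ 2 ≤ (1 + 2 / η) ^ 2 * T ^ η := by
  have h1 := Real.log_le_rpow_div (by linarith : 0 ≤ T) (by positivity : 0 < η / 2)
  have h2 : 1 ≤ T ^ (η / 2) := Real.one_le_rpow hT (by positivity)
  have h3 : T ^ η = (T ^ (η / 2)) ^ 2 := by
    rw [← Real.rpow_natCast, ← Real.rpow_mul (by linarith)]; congr 1; push_cast; ring
  have h4 : T ^ (η / 2) / (η / 2) = 2 / η * T ^ (η / 2) := by field_simp
  rw [h3, ← mul_pow]
  have := Real.log_nonneg hT
  refine pow_le_pow_left₀ (by linarith) ?_ 2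
  linarith

lemma exists_norm_zz_le_rpow {η : ℝ} (hη : 0 < η) (hη1 : η ≤ 1 / 2) : ∃ K : ℝ, 1 ≤ K ∧
    ∀ T t : ℝ, 1 ≤ T → T ≤ t → t ≤ 2 * T → ‖zz t‖ ≤ K * T ^ (1 / 6 + η) := by
  obtain ⟨C, hC, hw⟩ := exists_zz_weights
  obtain ⟨K, hK, hz⟩ := norm_zsum_zero_le (by positivity : 0 < η / 2) (by norm_num : (1:ℝ) ≤ 4)
  set A := (1 + 2 / (η / 2)) ^ 2 with hA
  have hA1 : 1 ≤ A := one_le_pow₀ (by have : 0 ≤ 2 / (η / 2) := by positivity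
                                      linarith)
  refine ⟨19 + C * A + C * A * (2 * K), ?_, fun T t hT ht ht2 => ?_⟩
  · have : 0 ≤ C * A * (2 * K) := by positivity
    nlinarith
  have hT0 : 0 < T := by linarith
  have h1 : 1 ≤ T ^ (1 / 6 + η) := Real.one_le_rpow hT (by positivity)
  have hn1 : 0 ≤ C * A * (2 * K) := by positivity
  have hn2 : 0 ≤ C * A := by positivity
  rcases le_or_gt 4 T with h4 | h4
  · obtain ⟨w, hw0, hws, hwb⟩ := hw T h4
    have hlog := one_add_log_sq_le (by positivity : 0 < η / 2) hT
    rw [← hA] at hlog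
    have hp : ∀ m ∈ Finset.Ioc 0 ⌊4 * √T⌋₊, ‖zsum 0 m t‖ ≤ 2 * K * T ^ (1 / 6 + η / 2) := by
      intro m hm
      have hm' : (m:ℝ) ≤ 4 * √T := (Nat.le_floor_iff (by positivity)).1 (Finset.mem_Ioc.1 hm).2
      refine (hz t m (by linarith) (hm'.trans (by gcongr))).trans ?_
      have : t ^ (1 / 6 + η / 2) ≤ 2 * T ^ (1 / 6 + η / 2) := by
        have ht0 : 0 ≤ t := by linarith
        calc t ^ (1 / 6 + η / 2) ≤ (2 * T) ^ (1 / 6 + η / 2) := by gcongr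
          _ = 2 ^ (1 / 6 + η / 2) * T ^ (1 / 6 + η / 2) := Real.mul_rpow two_pos.le hT0.le
          _ ≤ 2 * T ^ (1 / 6 + η / 2) := by
            gcongr
            calc (2:ℝ) ^ (1 / 6 + η / 2) ≤ 2 ^ (1:ℝ) :=
                  Real.rpow_le_rpow_of_exponent_le one_le_two (by linarith)
              _ = 2 := Real.rpow_one 2
      nlinarith
    have hs : ∑ m ∈ Finset.Ioc 0 ⌊4 * √T⌋₊, w m * ‖zsum 0 m t‖ ≤
        (C * (A * T ^ (η / 2))) * (2 * K * T ^ (1 / 6 + η / 2)) := by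
      refine (Finset.sum_le_sum fun m hm => mul_le_mul_of_nonneg_left (hp m hm) (hw0 m)).trans ?_
      rw [← Finset.sum_mul]
      have := hws.trans (mul_le_mul_of_nonneg_left hlog (by linarith))
      gcongr
    have e : T ^ (η / 2) * T ^ (1 / 6 + η / 2) = T ^ (1 / 6 + η) := by
      rw [← Real.rpow_add hT0]; congr 1; ring
    have e2 : T ^ (η / 2) ≤ T ^ (1 / 6 + η) := Real.rpow_le_rpow_of_exponent_le hT (by linarith)
    have := hwb t ht ht2
    have h5 := mul_le_mul_of_nonneg_left hlog (by linarith : 0 ≤ C)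
    have h6 := mul_le_mul_of_nonneg_left e2 hn2
    have e3 : (C * (A * T ^ (η / 2))) * (2 * K * T ^ (1 / 6 + η / 2)) =
      C * A * (2 * K) * T ^ (1 / 6 + η) := by rw [← e]; ring
    nlinarith
  · refine (norm_zz_le_linear t).trans ?_
    rw [abs_of_nonneg (by linarith)]
    nlinarith

lemma pow_four_sum_le {ι : Type*} (s : Finset ι) (w p : ι → ℝ) (hw : ∀ i ∈ s, 0 ≤ w i) :
    (∑ i ∈ s, w i * p i) ^ 4 ≤ (∑ i ∈ s, w i) ^ 3 * ∑ i ∈ s, w i * p i ^ 4 := by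
  have h : ∀ q : ι → ℝ, (∑ i ∈ s, w i * q i) ^ 2 ≤ (∑ i ∈ s, w i) * ∑ i ∈ s, w i * q i ^ 2 :=
    fun q => Finset.sum_sq_le_sum_mul_sum_of_sq_le_mul s hw
      (fun i hi => mul_nonneg (hw i hi) (sq_nonneg _)) fun i _ => (by ring : _ = _).le
  have hW : 0 ≤ ∑ i ∈ s, w i := Finset.sum_nonneg hw
  have h2 := h fun i => p i ^ 2
  simp only [← pow_mul] at h2
  calc (∑ i ∈ s, w i * p i) ^ 4 = ((∑ i ∈ s, w i * p i) ^ 2) ^ 2 := by ring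
    _ ≤ ((∑ i ∈ s, w i) * ∑ i ∈ s, w i * p i ^ 2) ^ 2 :=
        pow_le_pow_left₀ (sq_nonneg _) (h p) 2
    _ = (∑ i ∈ s, w i) ^ 2 * (∑ i ∈ s, w i * p i ^ 2) ^ 2 := by ring
    _ ≤ (∑ i ∈ s, w i) ^ 2 * ((∑ i ∈ s, w i) * ∑ i ∈ s, w i * p i ^ 4) := by gcongr
    _ = _ := by ring

lemma continuous_zsum (a b : ℕ) : Continuous (zsum a b) := by
  unfold zsum
  exact continuous_finsetSum _ fun n _ => continuous_const.mul (continuous_osc _)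

lemma exists_integral_zz_pow_four_le {η : ℝ} (hη : 0 < η) (hη1 : η ≤ 1) : ∃ K : ℝ, 1 ≤ K ∧
    ∀ T : ℝ, 1 ≤ T → ∫ t in T..(2 * T), ‖zz t‖ ^ 4 ≤ K * T ^ (1 + η) := by
  obtain ⟨C, hC, hw⟩ := exists_zz_weights
  obtain ⟨K, hK, hz⟩ := fourth_moment (by positivity : 0 < η / 4) (by norm_num : (1:ℝ) ≤ 4)
  set A := (1 + 2 / (η / 8)) ^ 2 with hA
  have hA1 : 1 ≤ A := one_le_pow₀ (by have : 0 ≤ 2 / (η / 8) := by positivity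
                                      linarith)
  set D := C * A with hD
  have hD1 : 1 ≤ D := by nlinarith
  refine ⟨19 ^ 4 * 4 + 8 * (D ^ 4 + D ^ 4 * (4 * K)), ?_, fun T hT => ?_⟩
  · have : 0 ≤ 8 * (D ^ 4 + D ^ 4 * (4 * K)) := by positivity
    linarith
  have hT0 : 0 < T := by linarith
  have hT2 : T ≤ 2 * T := by linarith
  have h1 : 1 ≤ T ^ (1 + η) := Real.one_le_rpow hT (by positivity)
  have hn : 0 ≤ 8 * (D ^ 4 + D ^ 4 * (4 * K)) := by positivity
  have hci : ∀ a b : ℝ, IntervalIntegrable (fun t => ‖zz t‖ ^ 4) volume a b := fun a b =>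
    (continuous_zz.norm.pow 4).intervalIntegrable a b
  rcases le_or_gt 4 T with h4 | h4
  · obtain ⟨w, hw0, hws, hwb⟩ := hw T h4
    have hlog := one_add_log_sq_le (by positivity : 0 < η / 8) hT
    rw [← hA] at hlog
    set s := Finset.Ioc 0 ⌊4 * √T⌋₊ with hs
    set Q := T ^ (η / 8) with hQ
    have hQ1 : 1 ≤ Q := Real.one_le_rpow hT (by positivity)
    have hCD : C * (1 + Real.log T) ^ 2 ≤ D * Q := by
      rw [hD, mul_assoc]; exact mul_le_mul_of_nonneg_left hlog (by linarith)
    have hW := hws.trans hCD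
    have hW0 : 0 ≤ ∑ m ∈ s, w m := Finset.sum_nonneg fun m _ => hw0 m
    have hQ4 : Q ^ 4 = T ^ (η / 2) := by
      rw [hQ, ← Real.rpow_natCast, ← Real.rpow_mul hT0.le]; congr 1; push_cast; ring
    have hpt : ∀ t ∈ Set.Icc T (2 * T), ‖zz t‖ ^ 4 ≤
        8 * ((D * Q) ^ 4 + (D * Q) ^ 3 * ∑ m ∈ s, w m * ‖zsum 0 m t‖ ^ 4) := by
      intro t ht
      have hb := hwb t ht.1 ht.2
      have hS := pow_four_sum_le s w (fun m => ‖zsum 0 m t‖) fun m _ => hw0 m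
      have hS0 : 0 ≤ ∑ m ∈ s, w m * ‖zsum 0 m t‖ ^ 4 :=
        Finset.sum_nonneg fun m _ => mul_nonneg (hw0 m) (by positivity)
      have hS1 : 0 ≤ ∑ m ∈ s, w m * ‖zsum 0 m t‖ :=
        Finset.sum_nonneg fun m _ => mul_nonneg (hw0 m) (norm_nonneg _)
      have h8 : ∀ a b : ℝ, (a + b) ^ 4 ≤ 8 * (a ^ 4 + b ^ 4) := fun a b => by
        nlinarith [sq_nonneg (a - b), sq_nonneg (a + b), sq_nonneg (a ^ 2 - b ^ 2),
          mul_nonneg (sq_nonneg (a - b)) (sq_nonneg (a - b)),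
          mul_nonneg (sq_nonneg (a - b)) (sq_nonneg (a + b))]
      calc ‖zz t‖ ^ 4 ≤ (D * Q + ∑ m ∈ s, w m * ‖zsum 0 m t‖) ^ 4 := by
            gcongr; linarith
        _ ≤ 8 * ((D * Q) ^ 4 + (∑ m ∈ s, w m * ‖zsum 0 m t‖) ^ 4) := h8 _ _
        _ ≤ _ := by
            have : (∑ m ∈ s, w m) ^ 3 ≤ (D * Q) ^ 3 := by gcongr
            have := mul_le_mul_of_nonneg_right this hS0
            linarith
    have hcz : ∀ m, Continuous fun t => ‖zsum 0 m t‖ ^ 4 := fun m => (continuous_zsum 0 m).norm.pow 4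
    have hcs : Continuous fun t => ∑ m ∈ s, w m * ‖zsum 0 m t‖ ^ 4 :=
      continuous_finsetSum _ fun m _ => continuous_const.mul (hcz m)
    have hint : ∀ m ∈ s, ∫ t in T..(2 * T), ‖zsum 0 m t‖ ^ 4 ≤ 4 * K * T ^ (1 + η / 2) := by
      intro m hm
      have hm' : (m:ℝ) ≤ 4 * √T := (Nat.le_floor_iff (by positivity)).1 (Finset.mem_Ioc.1 hm).2
      have h6 := hz (2 * T) m (by linarith) (hm'.trans (by gcongr))
      have h7 : ∫ t in T..(2 * T), ‖zsum 0 m t‖ ^ 4 ≤ ∫ t in (-(2 * T))..(2 * T), ‖zsum 0 m t‖ ^ 4 :=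
        intervalIntegral.integral_mono_interval (by linarith) hT2 le_rfl
          (Filter.Eventually.of_forall fun t => by positivity)
          ((hcz m).intervalIntegrable _ _)
      refine h7.trans (h6.trans ?_)
      have e : (2 * T) ^ (1 + (η / 4 + η / 4)) ≤ 4 * T ^ (1 + η / 2) := by
        rw [show 1 + (η / 4 + η / 4) = 1 + η / 2 by ring, Real.mul_rpow two_pos.le hT0.le]
        gcongr
        calc (2:ℝ) ^ (1 + η / 2) ≤ 2 ^ (2:ℝ) :=
              Real.rpow_le_rpow_of_exponent_le one_le_two (by linarith)
          _ = 4 := by norm_num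
      nlinarith
    calc ∫ t in T..(2 * T), ‖zz t‖ ^ 4
        ≤ ∫ t in T..(2 * T), 8 * ((D * Q) ^ 4 + (D * Q) ^ 3 * ∑ m ∈ s, w m * ‖zsum 0 m t‖ ^ 4) :=
          intervalIntegral.integral_mono_on hT2 (hci _ _)
            ((continuous_const.mul (continuous_const.add
              (continuous_const.mul hcs))).intervalIntegrable _ _) hpt
      _ = 8 * (T * (D * Q) ^ 4 + (D * Q) ^ 3 * ∑ m ∈ s, w m * ∫ t in T..(2 * T), ‖zsum 0 m t‖ ^ 4) := by
          have hi2 : IntervalIntegrable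
              (fun t => (D * Q) ^ 3 * ∑ m ∈ s, w m * ‖zsum 0 m t‖ ^ 4) volume T (2 * T) :=
            (continuous_const.mul hcs).intervalIntegrable _ _
          have hi3 : ∀ m ∈ s, IntervalIntegrable
              (fun t => w m * ‖zsum 0 m t‖ ^ 4) volume T (2 * T) := fun m _ =>
            (continuous_const.mul (hcz m)).intervalIntegrable _ _
          rw [intervalIntegral.integral_const_mul, intervalIntegral.integral_add
            (continuous_const.intervalIntegrable _ _) hi2,
            intervalIntegral.integral_const, intervalIntegral.integral_const_mul,
            intervalIntegral.integral_finsetSum hi3]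
          simp only [intervalIntegral.integral_const_mul, smul_eq_mul]
          ring
      _ ≤ 8 * (T * (D * Q) ^ 4 + (D * Q) ^ 3 * ((D * Q) * (4 * K * T ^ (1 + η / 2)))) := by
          have : ∑ m ∈ s, w m * ∫ t in T..(2 * T), ‖zsum 0 m t‖ ^ 4 ≤
              (D * Q) * (4 * K * T ^ (1 + η / 2)) := by
            refine (Finset.sum_le_sum fun m hm =>
              mul_le_mul_of_nonneg_left (hint m hm) (hw0 m)).trans ?_
            rw [← Finset.sum_mul]
            gcongr
          gcongr
      _ = 8 * (D ^ 4 * (T * Q ^ 4) + D ^ 4 * (4 * K) * (Q ^ 4 * T ^ (1 + η / 2))) := by ring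
      _ ≤ 8 * (D ^ 4 * T ^ (1 + η) + D ^ 4 * (4 * K) * T ^ (1 + η)) := by
          have a1 : T * Q ^ 4 ≤ T ^ (1 + η) := by
            rw [hQ4]
            nth_rewrite 1 [← Real.rpow_one T]
            rw [← Real.rpow_add hT0]
            exact Real.rpow_le_rpow_of_exponent_le hT (by linarith)
          have a2 : Q ^ 4 * T ^ (1 + η / 2) = T ^ (1 + η) := by
            rw [hQ4, ← Real.rpow_add hT0]; congr 1; ring
          rw [a2]
          gcongr
      _ ≤ _ := by nlinarith
  · have hb : ∀ t ∈ Set.uIoc T (2 * T), ‖‖zz t‖ ^ 4‖ ≤ 19 ^ 4 := by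
      intro t ht
      rw [Set.uIoc_of_le hT2] at ht
      rw [norm_pow, norm_norm]
      gcongr
      refine (norm_zz_le_linear t).trans ?_
      rw [abs_of_nonneg (by linarith [ht.1])]
      linarith [ht.2]
    have := intervalIntegral.norm_integral_le_of_norm_le_const hb
    rw [show 2 * T - T = T by ring, abs_of_pos hT0] at this
    refine (le_abs_self _).trans (this.trans ?_)
    nlinarith

/-- The Dirichlet polynomial `∑_{D < d ≤ 2D} a_d d^{-1-2it}`. -/
noncomputable def dpoly (D : ℕ) (a : ℕ → ℝ) (t : ℝ) : ℂ :=
  ∑ d ∈ Finset.Ioc D (2 * D), ((a d / d : ℝ) : ℂ) * osc (2 * t) d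

lemma continuous_dpoly (D : ℕ) (a : ℕ → ℝ) : Continuous (dpoly D a) := by
  unfold dpoly
  exact continuous_finsetSum _ fun n _ => continuous_const.mul
    ((continuous_osc _).comp (continuous_const.mul continuous_id))

lemma norm_sum_osc_le {D : ℕ} (hD : 1 ≤ D) (τ : ℝ) :
    ‖∑ d ∈ Finset.Ioc D (2 * D), osc (2 * τ) d‖ ≤ 48 * D / (1 + |τ|) + 60 * √|τ| := by
  have hpi := Real.pi_gt_three
  have hpi4 := Real.pi_le_four
  have key : ‖∑ d ∈ Finset.Ioc D (2 * D), osc (2 * τ) d‖ =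
      ‖∑ d ∈ Finset.Ioc D (2 * D), ex (|τ| / Real.pi * Real.log d)‖ := by
    simp only [osc_eq_ex]
    rcases le_or_gt 0 τ with h | h
    · rw [norm_sum_ex_neg, abs_of_nonneg h]
      congr 2; ext d; congr 2; field_simp
    · rw [abs_of_neg h]
      congr 2; ext d; congr 1; field_simp
  rw [key]
  refine (norm_sum_ex_log_le D hD (by positivity)).trans ?_
  have h1 : 12 * (D:ℝ) / (1 + |τ| / Real.pi) ≤ 48 * D / (1 + |τ|) := by
    rw [div_le_div_iff₀ (by positivity) (by positivity)]
    have : |τ| / 4 ≤ |τ| / Real.pi := by gcongr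
    have h0 := abs_nonneg τ
    have : 1 + |τ| ≤ 4 * (1 + |τ| / Real.pi) := by linarith
    calc 12 * (D:ℝ) * (1 + |τ|) ≤ 12 * D * (4 * (1 + |τ| / Real.pi)) := by gcongr
      _ = _ := by ring
  have h2 : √(|τ| / Real.pi) ≤ √|τ| := by
    apply Real.sqrt_le_sqrt
    exact div_le_self (abs_nonneg _) (by linarith)
  linarith

lemma setIntegral_inv_one_add_abs_le {p l t : ℝ} (hl : 0 ≤ l) (ht : t ∈ Set.Icc p (p + l))
    {A : Set ℝ} (hA : A ⊆ Set.Icc p (p + l)) :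
    ∫ s in A, (1 + |t - s|)⁻¹ ≤ 2 * Real.log (1 + l) := by
  have hc : Continuous fun s : ℝ => (1 + |t - s|)⁻¹ :=
    (continuous_const.add (continuous_const.sub continuous_id).abs).inv₀ fun s =>
      (add_pos_of_pos_of_nonneg one_pos (abs_nonneg _)).ne'
  have h1 : ∫ s in A, (1 + |t - s|)⁻¹ ≤ ∫ s in Set.Icc p (p + l), (1 + |t - s|)⁻¹ :=
    setIntegral_mono_set (hc.continuousOn.integrableOn_Icc)
      (Filter.Eventually.of_forall fun s => by positivity) (LE.le.eventuallyLE hA)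
  refine h1.trans ?_
  rw [integral_Icc_eq_integral_Ioc, ← intervalIntegral.integral_of_le (by linarith),
    ← intervalIntegral.integral_add_adjacent_intervals (b := t) (hc.intervalIntegrable _ _)
      (hc.intervalIntegrable _ _)]
  have e1 : ∫ s in p..t, (1 + |t - s|)⁻¹ = Real.log (1 + (t - p)) := by
    have : ∫ s in p..t, (1 + |t - s|)⁻¹ = ∫ s in p..t, ((1 + t) - s)⁻¹ := by
      refine intervalIntegral.integral_congr fun s hs => ?_
      rw [Set.uIcc_of_le ht.1] at hs
      rw [abs_of_nonneg (by linarith [hs.2])]; ring_nf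
    rw [this, intervalIntegral.integral_comp_sub_left (fun x => x⁻¹) (1 + t),
      integral_inv_of_pos (by linarith) (by linarith [ht.1])]
    congr 1; rw [add_sub_cancel_right]; ring
  have e2 : ∫ s in t..(p + l), (1 + |t - s|)⁻¹ = Real.log (1 + (p + l - t)) := by
    have : ∫ s in t..(p + l), (1 + |t - s|)⁻¹ = ∫ s in t..(p + l), (s - (t - 1))⁻¹ := by
      refine intervalIntegral.integral_congr fun s hs => ?_
      rw [Set.uIcc_of_le ht.2] at hs
      rw [abs_of_nonpos (by linarith [hs.1])]; ring_nf
    rw [this, intervalIntegral.integral_comp_sub_right (fun x => x⁻¹) (t - 1),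
      integral_inv_of_pos (by linarith) (by linarith [ht.2])]
    congr 1; rw [sub_sub_cancel, div_one]; ring
  rw [e1, e2]
  have := Real.log_le_log (by linarith [ht.1]) (show 1 + (t - p) ≤ 1 + l by linarith [ht.2])
  have := Real.log_le_log (by linarith [ht.2]) (show 1 + (p + l - t) ≤ 1 + l by linarith [ht.1])
  linarith

lemma norm_setIntegral_mul_dpoly_sq_le {D : ℕ} (hD : 1 ≤ D) {a : ℕ → ℝ} (ha : ∀ d, |a d| ≤ 1)
    {p l : ℝ} (hl : 0 ≤ l) {A : Set ℝ} (hAm : MeasurableSet A) (hA : A ⊆ Set.Icc p (p + l))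
    {G : ℝ → ℂ} (hG : Continuous G) :
    ‖∫ t in A, G t * dpoly D a t‖ ^ 2 ≤ 96 * Real.log (1 + l) * (∫ t in A, ‖G t‖ ^ 2)
      + 60 * √l / D * (∫ t in A, ‖G t‖) ^ 2 := by
  have hD0 : (0:ℝ) < D := by exact_mod_cast hD
  set μ : Measure ℝ := volume.restrict A with hμ
  have hfin : IsFiniteMeasure μ := ⟨by
    rw [hμ, Measure.restrict_apply_univ]
    exact (measure_mono hA).trans_lt (by simp)⟩
  have hcA : ∀ {E : Type} [NormedAddCommGroup E] {f : ℝ → E}, Continuous f → Integrable f μ :=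
    fun hf => (hf.continuousOn.integrableOn_Icc (a := p) (b := p + l)).mono_set hA
  have hprodset : ((μ.prod μ) = (volume : Measure (ℝ × ℝ)).restrict (A ×ˢ A)) := by
    rw [hμ, Measure.prod_restrict]; rfl
  have hcP : ∀ {E : Type} [NormedAddCommGroup E] {f : ℝ × ℝ → E}, Continuous f →
      Integrable f (μ.prod μ) := fun hf => by
    rw [hprodset]
    exact (hf.continuousOn.integrableOn_compact
      ((isCompact_Icc (a := p) (b := p + l)).prod isCompact_Icc)).mono_set (Set.prod_mono hA hA)
  have hosc : ∀ d : ℕ, Continuous fun t : ℝ => osc (2 * t) d := fun d =>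
    (continuous_osc _).comp (continuous_const.mul continuous_id)
  set b : ℕ → ℂ := fun d => ∫ t in A, G t * osc (2 * t) d with hb
  have h1 : ∫ t in A, G t * dpoly D a t =
      ∑ d ∈ Finset.Ioc D (2 * D), ((a d / d : ℝ) : ℂ) * b d := by
    simp only [dpoly, Finset.mul_sum, hb]
    rw [integral_finsetSum]
    · refine Finset.sum_congr rfl fun d _ => ?_
      rw [← integral_const_mul]
      congr 1; ext t; ring
    · intro d _
      exact hcA (hG.mul (continuous_const.mul (hosc d)))
  have h2 : ‖∫ t in A, G t * dpoly D a t‖ ^ 2 ≤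
      1 / D * ∑ d ∈ Finset.Ioc D (2 * D), ‖b d‖ ^ 2 := by
    have hle : ‖∫ t in A, G t * dpoly D a t‖ ≤
        ∑ d ∈ Finset.Ioc D (2 * D), (1 / (D:ℝ)) * ‖b d‖ := by
      rw [h1]
      refine norm_sum_le_of_le _ fun d hd => ?_
      have hd' : (D:ℝ) ≤ d := by exact_mod_cast (Finset.mem_Ioc.1 hd).1.le
      rw [norm_mul, Complex.norm_real, Real.norm_eq_abs, abs_div, Nat.abs_cast]
      have := ha d
      gcongr
    have hcs := Finset.sum_mul_sq_le_sq_mul_sq (Finset.Ioc D (2 * D)) (fun _ => 1 / (D:ℝ))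
      fun d => ‖b d‖
    refine (pow_le_pow_left₀ (norm_nonneg _) hle 2).trans (hcs.trans (le_of_eq ?_))
    rw [Finset.sum_const, Nat.card_Ioc, show 2 * D - D = D by omega, nsmul_eq_mul]
    congr 1; field_simp
  have h3 : ∑ d ∈ Finset.Ioc D (2 * D), ‖b d‖ ^ 2 ≤
      ∫ z, ‖G z.1‖ * ‖G z.2‖ * ‖∑ d ∈ Finset.Ioc D (2 * D), osc (2 * (z.1 - z.2)) d‖
        ∂(μ.prod μ) := by
    have e : ((∑ d ∈ Finset.Ioc D (2 * D), ‖b d‖ ^ 2 : ℝ) : ℂ) =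
        ∫ z, G z.1 * (starRingEnd ℂ) (G z.2) *
          ∑ d ∈ Finset.Ioc D (2 * D), osc (2 * (z.1 - z.2)) d ∂(μ.prod μ) := by
      simp only [Finset.mul_sum]
      rw [integral_finsetSum]
      · push_cast
        refine Finset.sum_congr rfl fun d hd => ?_
        rw [← Complex.mul_conj', hb]
        simp only
        rw [← integral_conj, ← integral_prod_mul]
        refine integral_congr_ae (Filter.Eventually.of_forall fun z => ?_)
        simp only [map_mul, conj_osc]
        rw [show 2 * (z.1 - z.2) = 2 * z.1 + -(2 * z.2) by ring, osc_add]
        ring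
      · intro d _
        refine hcP ?_
        refine ((hG.comp continuous_fst).mul (Complex.continuous_conj.comp
          (hG.comp continuous_snd))).mul ((hosc d).comp (continuous_fst.sub continuous_snd))
    have e2 : ∑ d ∈ Finset.Ioc D (2 * D), ‖b d‖ ^ 2 =
        ‖((∑ d ∈ Finset.Ioc D (2 * D), ‖b d‖ ^ 2 : ℝ) : ℂ)‖ := by
      rw [Complex.norm_real, Real.norm_of_nonneg (Finset.sum_nonneg fun _ _ => by positivity)]
    rw [e2, e]
    refine (norm_integral_le_integral_norm _).trans (le_of_eq ?_)
    simp only [norm_mul, RCLike.norm_conj]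
  have hk : Continuous fun z : ℝ × ℝ => (1 + |z.1 - z.2|)⁻¹ :=
    (continuous_const.add (continuous_fst.sub continuous_snd).abs).inv₀ fun s =>
      (add_pos_of_pos_of_nonneg one_pos (abs_nonneg _)).ne'
  have hG1 : Continuous fun z : ℝ × ℝ => ‖G z.1‖ := (hG.comp continuous_fst).norm
  have hG2 : Continuous fun z : ℝ × ℝ => ‖G z.2‖ := (hG.comp continuous_snd).norm
  set F1 : ℝ × ℝ → ℝ := fun z => ‖G z.1‖ ^ 2 * (1 + |z.1 - z.2|)⁻¹ with hF1
  set F2 : ℝ × ℝ → ℝ := fun z => ‖G z.2‖ ^ 2 * (1 + |z.1 - z.2|)⁻¹ with hF2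
  set F3 : ℝ × ℝ → ℝ := fun z => ‖G z.1‖ * ‖G z.2‖ with hF3
  have cF1 : Continuous F1 := (hG1.pow 2).mul hk
  have cF2 : Continuous F2 := (hG2.pow 2).mul hk
  have cF3 : Continuous F3 := hG1.mul hG2
  have h4 : ∫ z, ‖G z.1‖ * ‖G z.2‖ * ‖∑ d ∈ Finset.Ioc D (2 * D), osc (2 * (z.1 - z.2)) d‖
        ∂(μ.prod μ) ≤ ∫ z, ((24 * D) * (F1 z + F2 z) + 60 * √l * F3 z) ∂(μ.prod μ) := by
    have hS : Continuous fun z : ℝ × ℝ =>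
        ‖∑ d ∈ Finset.Ioc D (2 * D), osc (2 * (z.1 - z.2)) d‖ :=
      (continuous_finsetSum _ fun d _ => (hosc d).comp (continuous_fst.sub continuous_snd)).norm
    refine integral_mono_ae (hcP ((hG1.mul hG2).mul hS))
      (hcP ((continuous_const.mul (cF1.add cF2)).add (continuous_const.mul cF3))) ?_
    rw [hprodset]
    refine (ae_restrict_iff' (hAm.prod hAm)).2 (Filter.Eventually.of_forall fun z hz => ?_)
    have hz1 := hA hz.1
    have hz2 := hA hz.2
    have hd : |z.1 - z.2| ≤ l := by
      rw [abs_le]; constructor <;> linarith [hz1.1, hz1.2, hz2.1, hz2.2]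
    have hn := norm_sum_osc_le hD (z.1 - z.2)
    have hn2 : √|z.1 - z.2| ≤ √l := Real.sqrt_le_sqrt hd
    have hg : 2 * (‖G z.1‖ * ‖G z.2‖) ≤ ‖G z.1‖ ^ 2 + ‖G z.2‖ ^ 2 := by
      nlinarith [sq_nonneg (‖G z.1‖ - ‖G z.2‖)]
    simp only [hF1, hF2, hF3]
    calc ‖G z.1‖ * ‖G z.2‖ * ‖∑ d ∈ Finset.Ioc D (2 * D), osc (2 * (z.1 - z.2)) d‖
        ≤ ‖G z.1‖ * ‖G z.2‖ * (48 * D / (1 + |z.1 - z.2|) + 60 * √l) := by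
          gcongr; linarith
      _ = 24 * D * (1 + |z.1 - z.2|)⁻¹ * (2 * (‖G z.1‖ * ‖G z.2‖))
          + 60 * √l * (‖G z.1‖ * ‖G z.2‖) := by ring
      _ ≤ 24 * D * (1 + |z.1 - z.2|)⁻¹ * (‖G z.1‖ ^ 2 + ‖G z.2‖ ^ 2)
          + 60 * √l * (‖G z.1‖ * ‖G z.2‖) := by gcongr
      _ = _ := by ring
  have h5 : ∫ z, ((24 * D) * (F1 z + F2 z) + 60 * √l * F3 z) ∂(μ.prod μ) =
      (24 * D) * (∫ z, F1 z ∂(μ.prod μ) + ∫ z, F2 z ∂(μ.prod μ)) +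
        60 * √l * ∫ z, F3 z ∂(μ.prod μ) := by
    have i1 : Integrable (fun z => (24 * D) * (F1 z + F2 z)) (μ.prod μ) :=
      hcP (continuous_const.mul (cF1.add cF2))
    have i2 : Integrable (fun z => 60 * √l * F3 z) (μ.prod μ) := hcP (continuous_const.mul cF3)
    rw [integral_add i1 i2, integral_const_mul, integral_const_mul,
      integral_add (hcP cF1) (hcP cF2)]
  have h6 : ∫ z, F1 z ∂(μ.prod μ) ≤ 2 * Real.log (1 + l) * ∫ t in A, ‖G t‖ ^ 2 := by
    rw [integral_prod _ (hcP cF1), ← integral_const_mul]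
    have hi := (hcP cF1).integral_prod_left
    refine setIntegral_mono_on hi (hcA (continuous_const.mul (hG.norm.pow 2))) hAm fun t ht => ?_
    simp only [hF1]
    rw [integral_const_mul, mul_comm]
    gcongr
    exact setIntegral_inv_one_add_abs_le hl (hA ht) hA
  have h7 : ∫ z, F2 z ∂(μ.prod μ) = ∫ z, F1 z ∂(μ.prod μ) := by
    rw [← integral_prod_swap]
    simp only [hF1, hF2, Prod.fst_swap, Prod.snd_swap]
    congr 1; ext z; rw [abs_sub_comm]
  have h8 : ∫ z, F3 z ∂(μ.prod μ) = (∫ t in A, ‖G t‖) ^ 2 := by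
    rw [sq, ← integral_prod_mul]
  calc ‖∫ t in A, G t * dpoly D a t‖ ^ 2
      ≤ 1 / D * ((24 * D) * (∫ z, F1 z ∂(μ.prod μ) + ∫ z, F2 z ∂(μ.prod μ)) +
        60 * √l * ∫ z, F3 z ∂(μ.prod μ)) := by
        refine h2.trans ?_
        gcongr
        exact h3.trans (h4.trans_eq h5)
    _ ≤ 1 / D * ((24 * D) * (2 * Real.log (1 + l) * (∫ t in A, ‖G t‖ ^ 2) +
        2 * Real.log (1 + l) * (∫ t in A, ‖G t‖ ^ 2)) +
        60 * √l * (∫ t in A, ‖G t‖) ^ 2) := by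
        rw [h7, h8]; gcongr
    _ = _ := by field_simp; ring

lemma integrableOn_of_continuous_of_subset {f : ℝ → ℝ} (hf : Continuous f) {A : Set ℝ} {p q : ℝ}
    (hA : A ⊆ Set.Icc p q) : IntegrableOn f A :=
  hf.continuousOn.integrableOn_Icc.mono_set hA

lemma level_set_sq_le {D : ℕ} (hD : 1 ≤ D) {a : ℕ → ℝ} (ha : ∀ d, |a d| ≤ 1)
    {p l V : ℝ} (hl : 0 ≤ l) (hV : 0 < V) (hlV : 120 * √l ≤ D * V ^ 2) {A : Set ℝ}
    (hAm : MeasurableSet A) (hA : A ⊆ Set.Icc p (p + l)) (hVA : ∀ t ∈ A, V ≤ ‖dpoly D a t‖) :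
    (∫ t in A, ‖zz t‖ ^ 2 * ‖dpoly D a t‖ ^ 2) ^ 2 ≤
      192 * Real.log (1 + l) * ∫ t in A, ‖zz t‖ ^ 4 * ‖dpoly D a t‖ ^ 2 := by
  have hD0 : (0:ℝ) < D := by exact_mod_cast hD
  have hcM := continuous_dpoly D a
  have hcZ := continuous_zz
  set I := ∫ t in A, ‖zz t‖ ^ 2 * ‖dpoly D a t‖ ^ 2 with hI
  have hI0 : 0 ≤ I := integral_nonneg fun t => by positivity
  set G : ℝ → ℂ := fun t => ((‖zz t‖ ^ 2 : ℝ) : ℂ) * (starRingEnd ℂ) (dpoly D a t) with hG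
  have hGc : Continuous G := (Complex.continuous_ofReal.comp (hcZ.norm.pow 2)).mul
    (Complex.continuous_conj.comp hcM)
  have hGn : ∀ t, ‖G t‖ = ‖zz t‖ ^ 2 * ‖dpoly D a t‖ := fun t => by
    rw [hG]; simp only
    rw [norm_mul, RCLike.norm_conj, Complex.norm_real, Real.norm_of_nonneg (by positivity)]
  have h := norm_setIntegral_mul_dpoly_sq_le hD ha hl hAm hA hGc
  have e1 : ‖∫ t in A, G t * dpoly D a t‖ = I := by
    have : ∫ t in A, G t * dpoly D a t = ((I : ℝ) : ℂ) := by
      rw [hI, ← integral_complex_ofReal]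
      congr 1; ext t
      rw [hG]; simp only
      rw [mul_assoc, Complex.conj_mul']; push_cast; ring
    rw [this, Complex.norm_real, Real.norm_of_nonneg hI0]
  have e2 : ∫ t in A, ‖G t‖ ^ 2 = ∫ t in A, ‖zz t‖ ^ 4 * ‖dpoly D a t‖ ^ 2 := by
    congr 1; ext t; rw [hGn]; ring
  have e3 : ∫ t in A, ‖G t‖ ≤ I / V := by
    rw [le_div_iff₀ hV, ← integral_mul_const]
    refine setIntegral_mono_on (integrableOn_of_continuous_of_subset
      (hGc.norm.mul continuous_const) hA)
      (integrableOn_of_continuous_of_subset ((hcZ.norm.pow 2).mul (hcM.norm.pow 2)) hA) hAm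
      fun t ht => ?_
    rw [hGn, mul_assoc, sq ‖dpoly D a t‖]
    have := hVA t ht
    gcongr
  rw [e1, e2] at h
  have e4 : 60 * √l / D * (∫ t in A, ‖G t‖) ^ 2 ≤ I ^ 2 / 2 := by
    have h0 : 0 ≤ ∫ t in A, ‖G t‖ := integral_nonneg fun t => norm_nonneg _
    calc 60 * √l / D * (∫ t in A, ‖G t‖) ^ 2 ≤ (D * V ^ 2 / 2) / D * (I / V) ^ 2 := by
          gcongr; linarith
      _ = I ^ 2 / 2 := by field_simp
  linarith

lemma level_set_le_of_sup {D : ℕ} (hD : 1 ≤ D) {a : ℕ → ℝ} (ha : ∀ d, |a d| ≤ 1)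
    {p l V B : ℝ} (hl : 0 ≤ l) (hV : 0 < V) (hlV : 120 * √l ≤ D * V ^ 2) {A : Set ℝ}
    (hAm : MeasurableSet A) (hA : A ⊆ Set.Icc p (p + l)) (hVA : ∀ t ∈ A, V ≤ ‖dpoly D a t‖)
    (hB : ∀ t ∈ A, ‖zz t‖ ^ 2 ≤ B) (hB0 : 0 ≤ B) :
    ∫ t in A, ‖zz t‖ ^ 2 * ‖dpoly D a t‖ ^ 2 ≤ 192 * Real.log (1 + l) * B := by
  have h := level_set_sq_le hD ha hl hV hlV hAm hA hVA
  have hcM := continuous_dpoly D a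
  have hcZ := continuous_zz
  set I := ∫ t in A, ‖zz t‖ ^ 2 * ‖dpoly D a t‖ ^ 2 with hI
  have hI0 : 0 ≤ I := integral_nonneg fun t => by positivity
  have hlog : 0 ≤ Real.log (1 + l) := Real.log_nonneg (by linarith)
  have h1 : ∫ t in A, ‖zz t‖ ^ 4 * ‖dpoly D a t‖ ^ 2 ≤ B * I := by
    rw [hI, ← integral_const_mul]
    refine setIntegral_mono_on (integrableOn_of_continuous_of_subset
      ((hcZ.norm.pow 4).mul (hcM.norm.pow 2)) hA)
      (integrableOn_of_continuous_of_subset (continuous_const.mul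
        ((hcZ.norm.pow 2).mul (hcM.norm.pow 2))) hA) hAm fun t ht => ?_
    rw [← mul_assoc, show ‖zz t‖ ^ 4 = ‖zz t‖ ^ 2 * ‖zz t‖ ^ 2 by ring]
    have := hB t ht
    gcongr
  rcases hI0.eq_or_lt with h0 | h0
  · rw [← h0]; positivity
  · have : I * I ≤ 192 * Real.log (1 + l) * B * I := by
      calc I * I = I ^ 2 := by ring
        _ ≤ _ := h
        _ ≤ 192 * Real.log (1 + l) * (B * I) := by gcongr
        _ = _ := by ring
    exact le_of_mul_le_mul_right this h0

lemma level_set_sq_le_of_short {D : ℕ} (hD : 1 ≤ D) {a : ℕ → ℝ} (ha : ∀ d, |a d| ≤ 1)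
    {T V : ℝ} (hT : 0 < T) (hV : 0 < V) (hTV : D * V ^ 2 ≤ 120 * √T) {A : Set ℝ}
    (hAm : MeasurableSet A) (hVA : ∀ t ∈ A, V ≤ ‖dpoly D a t‖)
    (hVA2 : ∀ t ∈ A, ‖dpoly D a t‖ ≤ 2 * V) :
    (∫ t in Set.Ioc T (2 * T) ∩ A, ‖zz t‖ ^ 2 * ‖dpoly D a t‖ ^ 2) ^ 2 ≤
      28800 * 768 * Real.log (1 + T) * T / (D * V) ^ 2 * ∫ t in T..(2 * T), ‖zz t‖ ^ 4 := by
  have hD0 : (0:ℝ) < D := by exact_mod_cast hD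
  have hcM := continuous_dpoly D a
  have hcZ := continuous_zz
  set f : ℝ → ℝ := fun t => ‖zz t‖ ^ 2 * ‖dpoly D a t‖ ^ 2 with hf
  have hfc : Continuous f := (hcZ.norm.pow 2).mul (hcM.norm.pow 2)
  have hTs : 0 < √T := Real.sqrt_pos.2 hT
  have hTsq : √T ^ 2 = T := Real.sq_sqrt hT.le
  set R : ℝ := 14400 * T / (D * V ^ 2) ^ 2 with hR
  have hR1 : 1 ≤ R := by
    rw [hR, le_div_iff₀ (by positivity), one_mul]
    calc (D * V ^ 2) ^ 2 ≤ (120 * √T) ^ 2 := by gcongr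
      _ = 14400 * T := by rw [mul_pow, hTsq]; norm_num
  set N := ⌈R⌉₊ with hN
  have hNR : R ≤ N := Nat.le_ceil R
  have hN0 : (0:ℝ) < N := by linarith
  have hN2 : (N:ℝ) ≤ 2 * R := by
    have := (Nat.ceil_lt_add_one (by linarith : 0 ≤ R)).le
    rw [← hN] at this
    linarith
  set l := T / N with hl
  have hl0 : 0 ≤ l := by positivity
  have hlT : l ≤ T := div_le_self hT.le (by linarith)
  have hlV : 120 * √l ≤ D * V ^ 2 := by
    have h1 : √l ≤ D * V ^ 2 / 120 := by
      rw [Real.sqrt_le_left (by positivity), hl, div_le_iff₀ hN0]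
      calc T = (D * V ^ 2 / 120) ^ 2 * R := by rw [hR]; field_simp; ring
        _ ≤ _ := by gcongr
    linarith
  set g := A.indicator f with hg
  have hgi : ∀ u v, IntervalIntegrable g volume u v := fun u v => by
    have := hfc.intervalIntegrable u v (μ := volume)
    exact ⟨this.1.indicator hAm, this.2.indicator hAm⟩
  set c : ℕ → ℝ := fun k => T + k * l with hc
  have hcmono : ∀ k, c k ≤ c (k + 1) := fun k => by
    simp only [hc]; push_cast; nlinarith
  have hgI : ∀ u v, u ≤ v → ∫ t in u..v, g t = ∫ t in Set.Ioc u v ∩ A, f t := fun u v huv => by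
    rw [intervalIntegral.integral_of_le huv, hg, setIntegral_indicator hAm]
  have hc0 : c 0 = T := by simp [hc]
  have hcN : c N = 2 * T := by simp only [hc, hl]; field_simp; ring
  have hsum : ∫ t in Set.Ioc T (2 * T) ∩ A, f t = ∑ k ∈ Finset.range N, ∫ t in c k..c (k + 1), g t := by
    rw [intervalIntegral.sum_integral_adjacent_intervals fun k _ => hgi _ _, hc0, hcN,
      hgI _ _ (by linarith)]
  have hsumZ : ∑ k ∈ Finset.range N, ∫ t in c k..c (k + 1), ‖zz t‖ ^ 4 =
      ∫ t in T..(2 * T), ‖zz t‖ ^ 4 := by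
    have hi : ∀ k < N, IntervalIntegrable (fun t => ‖zz t‖ ^ 4) volume (c k) (c (k + 1)) :=
      fun k _ => (hcZ.norm.pow 4).intervalIntegrable _ _
    rw [intervalIntegral.sum_integral_adjacent_intervals hi, hc0, hcN]
  have hlog : Real.log (1 + l) ≤ Real.log (1 + T) := Real.log_le_log (by linarith) (by linarith)
  have hlog0 : 0 ≤ Real.log (1 + l) := Real.log_nonneg (by linarith)
  have hZ0 : ∀ k, 0 ≤ ∫ t in c k..c (k + 1), ‖zz t‖ ^ 4 := fun k =>
    intervalIntegral.integral_nonneg (hcmono k) fun t _ => by positivity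
  have hblock : ∀ k, (∫ t in c k..c (k + 1), g t) ^ 2 ≤
      768 * Real.log (1 + T) * V ^ 2 * ∫ t in c k..c (k + 1), ‖zz t‖ ^ 4 := by
    intro k
    have hck : c (k + 1) = c k + l := by simp only [hc]; push_cast; ring
    have hsub : Set.Ioc (c k) (c (k + 1)) ∩ A ⊆ Set.Icc (c k) (c k + l) := by
      rw [hck]; exact Set.inter_subset_left.trans Set.Ioc_subset_Icc_self
    have hm : MeasurableSet (Set.Ioc (c k) (c (k + 1)) ∩ A) := measurableSet_Ioc.inter hAm
    rw [hgI _ _ (hcmono k)]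
    have h := level_set_sq_le hD ha hl0 hV hlV hm hsub fun t ht => hVA t ht.2
    refine h.trans ?_
    have h1 : ∫ t in Set.Ioc (c k) (c (k + 1)) ∩ A, ‖zz t‖ ^ 4 * ‖dpoly D a t‖ ^ 2 ≤
        4 * V ^ 2 * ∫ t in c k..c (k + 1), ‖zz t‖ ^ 4 := by
      calc ∫ t in Set.Ioc (c k) (c (k + 1)) ∩ A, ‖zz t‖ ^ 4 * ‖dpoly D a t‖ ^ 2
          ≤ ∫ t in Set.Ioc (c k) (c (k + 1)) ∩ A, 4 * V ^ 2 * ‖zz t‖ ^ 4 := by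
            refine setIntegral_mono_on (integrableOn_of_continuous_of_subset
              ((hcZ.norm.pow 4).mul (hcM.norm.pow 2)) hsub)
              (integrableOn_of_continuous_of_subset (continuous_const.mul (hcZ.norm.pow 4)) hsub)
              hm fun t ht => ?_
            have := hVA2 t ht.2
            calc ‖zz t‖ ^ 4 * ‖dpoly D a t‖ ^ 2 ≤ ‖zz t‖ ^ 4 * (2 * V) ^ 2 := by gcongr
              _ = _ := by ring
        _ = 4 * V ^ 2 * ∫ t in Set.Ioc (c k) (c (k + 1)) ∩ A, ‖zz t‖ ^ 4 := integral_const_mul _ _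
        _ ≤ _ := by
            gcongr
            rw [intervalIntegral.integral_of_le (hcmono k)]
            exact setIntegral_mono_set (((hcZ.norm.pow 4).integrableOn_Icc).mono_set
              Set.Ioc_subset_Icc_self) (Filter.Eventually.of_forall fun t => by positivity)
              (LE.le.eventuallyLE Set.inter_subset_left)
    calc 192 * Real.log (1 + l) * ∫ t in Set.Ioc (c k) (c (k + 1)) ∩ A,
          ‖zz t‖ ^ 4 * ‖dpoly D a t‖ ^ 2
        ≤ 192 * Real.log (1 + T) * (4 * V ^ 2 * ∫ t in c k..c (k + 1), ‖zz t‖ ^ 4) := by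
          have : 0 ≤ ∫ t in Set.Ioc (c k) (c (k + 1)) ∩ A, ‖zz t‖ ^ 4 * ‖dpoly D a t‖ ^ 2 :=
            integral_nonneg fun t => by positivity
          have := hlog0.trans hlog
          gcongr
      _ = _ := by ring
  rw [hsum]
  have hZ : 0 ≤ ∫ t in T..(2 * T), ‖zz t‖ ^ 4 :=
    intervalIntegral.integral_nonneg (by linarith) fun t _ => by positivity
  calc (∑ k ∈ Finset.range N, ∫ t in c k..c (k + 1), g t) ^ 2
      ≤ N * ∑ k ∈ Finset.range N, (∫ t in c k..c (k + 1), g t) ^ 2 := by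
        have := sq_sum_le_card_mul_sum_sq (s := Finset.range N)
          (f := fun k => ∫ t in c k..c (k + 1), g t)
        simpa using this
    _ ≤ N * ∑ k ∈ Finset.range N, 768 * Real.log (1 + T) * V ^ 2 *
          ∫ t in c k..c (k + 1), ‖zz t‖ ^ 4 := by
        gcongr with k _; exact hblock k
    _ = N * (768 * Real.log (1 + T) * V ^ 2 * ∫ t in T..(2 * T), ‖zz t‖ ^ 4) := by
        rw [← Finset.mul_sum, hsumZ]
    _ ≤ (2 * R) * (768 * Real.log (1 + T) * V ^ 2 * ∫ t in T..(2 * T), ‖zz t‖ ^ 4) := by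
        have : 0 ≤ Real.log (1 + T) := hlog0.trans hlog
        gcongr
    _ = _ := by rw [hR]; field_simp; ring

lemma norm_dpoly_le_one {D : ℕ} (hD : 1 ≤ D) {a : ℕ → ℝ} (ha : ∀ d, |a d| ≤ 1) (t : ℝ) :
    ‖dpoly D a t‖ ≤ 1 := by
  have hD0 : (0:ℝ) < D := by exact_mod_cast hD
  have : ‖dpoly D a t‖ ≤ ∑ d ∈ Finset.Ioc D (2 * D), 1 / (D:ℝ) := by
    refine norm_sum_le_of_le _ fun d hd => ?_
    have hd' : (D:ℝ) ≤ d := by exact_mod_cast (Finset.mem_Ioc.1 hd).1.le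
    rw [norm_mul, norm_osc, mul_one, Complex.norm_real, Real.norm_eq_abs, abs_div, Nat.abs_cast]
    have := ha d
    gcongr
  refine this.trans (le_of_eq ?_)
  rw [Finset.sum_const, Nat.card_Ioc, show 2 * D - D = D by omega, nsmul_eq_mul]
  field_simp

lemma integral_dpoly_sq_le {D : ℕ} (hD : 1 ≤ D) {a : ℕ → ℝ} (ha : ∀ d, |a d| ≤ 1) {T : ℝ}
    (hT : 0 < T) : ∫ t in T..(2 * T), ‖dpoly D a t‖ ^ 2 ≤ 100 * (T + D) / D := by
  have hD0 : (0:ℝ) < D := by exact_mod_cast hD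
  set b : ℕ → ℂ := fun m => if D < m then ((a m / m : ℝ) : ℂ) else 0 with hb
  set f : ℝ → ℝ := fun u => ‖∑ m ∈ Finset.Icc 1 (2 * D), b m * osc u m‖ ^ 2 with hf
  have hsub : Finset.Ioc D (2 * D) = (Finset.Icc 1 (2 * D)).filter (D < ·) := by
    ext m; simp only [Finset.mem_Ioc, Finset.mem_filter, Finset.mem_Icc]; omega
  have h1 : ∀ t, ‖dpoly D a t‖ ^ 2 = f (2 * t) := by
    intro t
    simp only [hf, dpoly, hb, hsub, Finset.sum_filter, ite_mul, zero_mul]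
  have hfc : Continuous f := ((continuous_finsetSum _ fun m _ =>
    continuous_const.mul (continuous_osc _)).norm).pow 2
  have h2 : ∑ m ∈ Finset.Icc 1 (2 * D), ‖b m‖ ^ 2 ≤ 1 / D := by
    have : ∑ m ∈ Finset.Icc 1 (2 * D), ‖b m‖ ^ 2 =
        ∑ m ∈ Finset.Ioc D (2 * D), ‖((a m / m : ℝ) : ℂ)‖ ^ 2 := by
      rw [hsub, Finset.sum_filter]
      refine Finset.sum_congr rfl fun m _ => ?_
      simp only [hb]
      split_ifs <;> simp
    rw [this]
    calc ∑ m ∈ Finset.Ioc D (2 * D), ‖((a m / m : ℝ) : ℂ)‖ ^ 2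
        ≤ ∑ m ∈ Finset.Ioc D (2 * D), (1 / (D:ℝ)) ^ 2 := by
          refine Finset.sum_le_sum fun d hd => ?_
          have hd' : (D:ℝ) ≤ d := by exact_mod_cast (Finset.mem_Ioc.1 hd).1.le
          rw [Complex.norm_real, Real.norm_eq_abs, abs_div, Nat.abs_cast]
          have := ha d
          gcongr
      _ = 1 / D := by
          rw [Finset.sum_const, Nat.card_Ioc, show 2 * D - D = D by omega, nsmul_eq_mul]
          field_simp
  have h3 := mean_value (by positivity : 0 < 4 * T) (2 * D) b
  simp only [h1]
  rw [intervalIntegral.integral_comp_mul_left f two_ne_zero, smul_eq_mul]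
  have h4 : ∫ u in (2 * T)..(2 * (2 * T)), f u ≤ ∫ u in (-(4 * T))..(4 * T), f u :=
    intervalIntegral.integral_mono_interval (by linarith) (by linarith) (by linarith)
      (Filter.Eventually.of_forall fun t => by positivity) (hfc.intervalIntegrable _ _)
  have h5 : 50 * (4 * T + ((2 * D : ℕ) : ℝ)) * ∑ m ∈ Finset.Icc 1 (2 * D), ‖b m‖ ^ 2 ≤
      200 * (T + D) * (1 / D) := by
    have : 50 * (4 * T + ((2 * D : ℕ) : ℝ)) ≤ 200 * (T + D) := by push_cast; linarith
    have h0 : 0 ≤ ∑ m ∈ Finset.Icc 1 (2 * D), ‖b m‖ ^ 2 := Finset.sum_nonneg fun _ _ => by positivity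
    gcongr
  have h6 := h4.trans (h3.trans h5)
  calc (2:ℝ)⁻¹ * ∫ u in (2 * T)..(2 * (2 * T)), f u ≤ 2⁻¹ * (200 * (T + D) * (1 / D)) := by gcongr
    _ = _ := by field_simp; norm_num

/-- A bounded nonnegative function either is small or lies in one of finitely many dyadic ranges. -/
lemma exists_dyadic_level {v : ℝ} (hv1 : v ≤ 1) {J : ℕ} (hv : ((2:ℝ) ^ J)⁻¹ < v) :
    ∃ i < J, ((2:ℝ) ^ (i + 1))⁻¹ < v ∧ v ≤ ((2:ℝ) ^ i)⁻¹ := by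
  induction J with
  | zero => simp at hv; linarith
  | succ J ih =>
    rcases lt_or_ge ((2:ℝ) ^ J)⁻¹ v with h | h
    · obtain ⟨i, hi, h'⟩ := ih h
      exact ⟨i, hi.trans J.lt_succ_self, h'⟩
    · exact ⟨J, J.lt_succ_self, hv, h⟩

lemma setIntegral_small_level_le {D : ℕ} (hD : 1 ≤ D) {a : ℕ → ℝ} (ha : ∀ d, |a d| ≤ 1) {T δ : ℝ}
    (hT : 0 < T) (hDT : (D:ℝ) ≤ T) (hδ : 0 < δ) (hδD : δ ^ 4 * D = 1) {A : Set ℝ}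
    (hAm : MeasurableSet A) (hA : ∀ t ∈ A, ‖dpoly D a t‖ ≤ δ) :
    ∫ t in Set.Ioc T (2 * T) ∩ A, ‖zz t‖ ^ 2 * ‖dpoly D a t‖ ^ 2 ≤
      δ ^ 3 * (∫ t in T..(2 * T), ‖zz t‖ ^ 4) + 200 * T * δ ^ 3 := by
  have hD0 : (0:ℝ) < D := by exact_mod_cast hD
  have hcM := continuous_dpoly D a
  have hcZ := continuous_zz
  have hT2 : T ≤ 2 * T := by linarith
  have hsub : Set.Ioc T (2 * T) ∩ A ⊆ Set.Icc T (2 * T) :=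
    Set.inter_subset_left.trans Set.Ioc_subset_Icc_self
  have hc1 : Continuous fun t => δ ^ 3 * ‖zz t‖ ^ 4 := continuous_const.mul (hcZ.norm.pow 4)
  have hc2 : Continuous fun t => δ⁻¹ * ‖dpoly D a t‖ ^ 2 := continuous_const.mul (hcM.norm.pow 2)
  have hc3 : Continuous fun t => δ ^ 3 * ‖zz t‖ ^ 4 + δ⁻¹ * ‖dpoly D a t‖ ^ 2 := hc1.add hc2
  calc ∫ t in Set.Ioc T (2 * T) ∩ A, ‖zz t‖ ^ 2 * ‖dpoly D a t‖ ^ 2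
      ≤ ∫ t in Set.Ioc T (2 * T) ∩ A, (δ ^ 3 * ‖zz t‖ ^ 4 + δ⁻¹ * ‖dpoly D a t‖ ^ 2) := by
        refine setIntegral_mono_on (integrableOn_of_continuous_of_subset
          ((hcZ.norm.pow 2).mul (hcM.norm.pow 2)) hsub)
          (integrableOn_of_continuous_of_subset hc3 hsub) (measurableSet_Ioc.inter hAm)
          fun t ht => ?_
        have hm := hA t ht.2
        have hm2 : ‖dpoly D a t‖ ^ 2 ≤ δ ^ 2 := by gcongr
        have h1 : δ ^ 3 * (‖zz t‖ ^ 2 * ‖dpoly D a t‖ ^ 2) ≤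
            δ ^ 3 * (δ ^ 3 * ‖zz t‖ ^ 4 + δ⁻¹ * ‖dpoly D a t‖ ^ 2) := by
          have e : δ ^ 3 * (δ ^ 3 * ‖zz t‖ ^ 4 + δ⁻¹ * ‖dpoly D a t‖ ^ 2) =
            (δ ^ 3 * ‖zz t‖ ^ 2) ^ 2 + δ ^ 2 * ‖dpoly D a t‖ ^ 2 := by field_simp
          rw [e]
          have : (‖dpoly D a t‖ ^ 2) ^ 2 ≤ δ ^ 2 * ‖dpoly D a t‖ ^ 2 := by
            rw [sq (‖dpoly D a t‖ ^ 2)]; gcongr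
          nlinarith [sq_nonneg (δ ^ 3 * ‖zz t‖ ^ 2 - ‖dpoly D a t‖ ^ 2),
            sq_nonneg (δ ^ 3 * ‖zz t‖ ^ 2), sq_nonneg (‖dpoly D a t‖ ^ 2)]
        exact le_of_mul_le_mul_left h1 (by positivity)
    _ ≤ ∫ t in Set.Ioc T (2 * T), (δ ^ 3 * ‖zz t‖ ^ 4 + δ⁻¹ * ‖dpoly D a t‖ ^ 2) :=
        setIntegral_mono_set (integrableOn_of_continuous_of_subset hc3 Set.Ioc_subset_Icc_self)
          (Filter.Eventually.of_forall fun t => by positivity)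
          (LE.le.eventuallyLE Set.inter_subset_left)
    _ = δ ^ 3 * (∫ t in T..(2 * T), ‖zz t‖ ^ 4) +
          δ⁻¹ * ∫ t in T..(2 * T), ‖dpoly D a t‖ ^ 2 := by
        rw [← intervalIntegral.integral_of_le hT2, intervalIntegral.integral_add
          (hc1.intervalIntegrable _ _) (hc2.intervalIntegrable _ _),
          intervalIntegral.integral_const_mul, intervalIntegral.integral_const_mul]
    _ ≤ δ ^ 3 * (∫ t in T..(2 * T), ‖zz t‖ ^ 4) + δ⁻¹ * (200 * T / D) := by
        have : ∫ t in T..(2 * T), ‖dpoly D a t‖ ^ 2 ≤ 200 * T / D := by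
          refine (integral_dpoly_sq_le hD ha hT).trans ?_
          gcongr ?_ / _; linarith
        gcongr
    _ = _ := by
        have : (D:ℝ) = (δ ^ 4)⁻¹ := by field_simp; linarith
        rw [this]; field_simp

lemma integral_le_sum_levels {f v : ℝ → ℝ} (hf : Continuous f) (hf0 : ∀ t, 0 ≤ f t)
    (hv : Continuous v) (hv1 : ∀ t, v t ≤ 1) {δ : ℝ} {J : ℕ} (hJ : ((2:ℝ) ^ J)⁻¹ ≤ δ) {T : ℝ}
    (hT : 0 < T) :
    ∫ t in T..(2 * T), f t ≤ (∫ t in Set.Ioc T (2 * T) ∩ {t | v t ≤ δ}, f t) +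
      ∑ i ∈ Finset.range J, ∫ t in Set.Ioc T (2 * T) ∩
        {t | ((2:ℝ) ^ (i + 1))⁻¹ ≤ v t ∧ v t ≤ ((2:ℝ) ^ i)⁻¹}, f t := by
  set S0 : Set ℝ := {t | v t ≤ δ} with hS0
  set S : ℕ → Set ℝ := fun i => {t | ((2:ℝ) ^ (i + 1))⁻¹ ≤ v t ∧ v t ≤ ((2:ℝ) ^ i)⁻¹} with hS
  have m0 : MeasurableSet S0 := (isClosed_le hv continuous_const).measurableSet
  have mS : ∀ i, MeasurableSet (S i) := fun i =>
    ((isClosed_le continuous_const hv).inter (isClosed_le hv continuous_const)).measurableSet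
  have hfi : IntegrableOn f (Set.Ioc T (2 * T)) :=
    integrableOn_of_continuous_of_subset hf Set.Ioc_subset_Icc_self
  have hi0 : Integrable (fun t => S0.indicator f t) (volume.restrict (Set.Ioc T (2 * T))) :=
    hfi.indicator m0
  have hiS : ∀ i ∈ Finset.range J, Integrable (fun t => (S i).indicator f t)
      (volume.restrict (Set.Ioc T (2 * T))) := fun i _ => hfi.indicator (mS i)
  have hiSum : Integrable (fun t => ∑ i ∈ Finset.range J, (S i).indicator f t)
      (volume.restrict (Set.Ioc T (2 * T))) := integrable_finsetSum _ hiS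
  rw [intervalIntegral.integral_of_le (by linarith)]
  calc ∫ t in Set.Ioc T (2 * T), f t
      ≤ ∫ t in Set.Ioc T (2 * T), (S0.indicator f t + ∑ i ∈ Finset.range J, (S i).indicator f t) := by
        refine integral_mono hfi (hi0.add hiSum) fun t => ?_
        have hn0 : 0 ≤ S0.indicator f t := Set.indicator_nonneg (fun t _ => hf0 t) t
        have hnS : ∀ i ∈ Finset.range J, 0 ≤ (S i).indicator f t :=
          fun i _ => Set.indicator_nonneg (fun t _ => hf0 t) t
        have hnSum := Finset.sum_nonneg hnS
        simp only
        rcases le_or_gt (v t) δ with h | h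
        · have : S0.indicator f t = f t := Set.indicator_of_mem (s := S0) h f
          linarith
        · obtain ⟨i, hi, h1, h2⟩ := exists_dyadic_level (hv1 t) (hJ.trans_lt h)
          have h3 : (S i).indicator f t = f t := Set.indicator_of_mem (s := S i) ⟨h1.le, h2⟩ f
          have h4 := Finset.single_le_sum hnS (Finset.mem_range.2 hi)
          linarith
    _ = _ := by
        rw [integral_add hi0 hiSum, integral_finsetSum _ hiS]
        congr 1
        · exact setIntegral_indicator m0
        · exact Finset.sum_congr rfl fun i _ => setIntegral_indicator (mS i)

lemma level_bound_arith {δ T Y Q L A K1 K2 B : ℝ} (hδ : 0 < δ) (hT : 0 < T) (hY : 0 < Y)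
    (hQ : 1 ≤ Q) (hA : 0 ≤ A) (hK2 : 1 ≤ K2) (hL : L ^ 2 ≤ A * Q ^ 2)
    (hB : B = K1 ^ 2 * (Y * Q ^ 2)) :
    (δ ^ 3 * (K2 * (T * Q ^ 2)) + 200 * T * δ ^ 3 * 1) +
      L ^ 2 * (192 * B + 10 ^ 4 * K2 * (T * Q * δ ^ 3)) ≤
    (200 * K1 ^ 2 + (K2 + 200) + A * (192 * K1 ^ 2 + 10 ^ 4 * K2)) * Q ^ 4 * (T * δ ^ 3 + Y) := by
  have q1 : 1 ≤ Q ^ 4 := one_le_pow₀ hQ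
  have q2 : Q ^ 2 ≤ Q ^ 4 := pow_le_pow_right₀ hQ (by norm_num)
  have q3 : Q ≤ Q ^ 2 := le_self_pow₀ hQ (by norm_num)
  have p0 : 0 ≤ 192 * B + 10 ^ 4 * K2 * (T * Q * δ ^ 3) := by rw [hB]; positivity
  have r1 : δ ^ 3 * (K2 * (T * Q ^ 2)) ≤ δ ^ 3 * (K2 * (T * Q ^ 4)) := by gcongr
  have r2 : 200 * T * δ ^ 3 * 1 ≤ 200 * T * δ ^ 3 * Q ^ 4 := by gcongr
  have r3 : L ^ 2 * (192 * B + 10 ^ 4 * K2 * (T * Q * δ ^ 3)) ≤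
      A * Q ^ 2 * (192 * (K1 ^ 2 * (Y * Q ^ 2)) + 10 ^ 4 * K2 * (T * Q ^ 2 * δ ^ 3)) := by
    rw [hB] at p0 ⊢
    refine mul_le_mul hL ?_ p0 (by positivity)
    gcongr
  have p1 : 0 ≤ (200 * K1 ^ 2 + A * (192 * K1 ^ 2)) * (T * δ ^ 3) * Q ^ 4 := by positivity
  have p2 : 0 ≤ (200 * K1 ^ 2 + (K2 + 200) + A * (10 ^ 4 * K2)) * Y * Q ^ 4 := by positivity
  linarith

set_option maxHeartbeats 1000000 in
theorem exists_integral_zz_dpoly_le {η : ℝ} (hη : 0 < η) (hη1 : η ≤ 1) : ∃ K : ℝ, 1 ≤ K ∧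
    ∀ T : ℝ, 1 ≤ T → ∀ D : ℕ, 1 ≤ D → ∀ a : ℕ → ℝ, (∀ d, |a d| ≤ 1) →
      ∫ t in T..(2 * T), ‖zz t‖ ^ 2 * ‖dpoly D a t‖ ^ 2 ≤
        K * T ^ η * (T * (D:ℝ) ^ (-(3/4) : ℝ) + T ^ (1/3 : ℝ)) := by
  obtain ⟨K1, hK1, hsup⟩ := exists_norm_zz_le_rpow (η := η / 4) (by positivity) (by linarith)
  obtain ⟨K2, hK2, h4⟩ := exists_integral_zz_pow_four_le (η := η / 2) (by positivity) (by linarith)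
  set A := (1 + 2 / (η / 2)) ^ 2 with hA
  have hA0 : 0 ≤ A := by positivity
  refine ⟨200 * K1 ^ 2 + (K2 + 200) + A * (192 * K1 ^ 2 + 10 ^ 4 * K2), ?_,
    fun T hT D hD a ha => ?_⟩
  · have : 0 ≤ A * (192 * K1 ^ 2 + 10 ^ 4 * K2) := by positivity
    nlinarith
  have hT0 : 0 < T := by linarith
  have hT2 : T ≤ 2 * T := by linarith
  have hD0 : (0:ℝ) < D := by exact_mod_cast hD
  have hD1 : (1:ℝ) ≤ D := by exact_mod_cast hD
  have hcM := continuous_dpoly D a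
  have hcZ := continuous_zz
  set B := K1 ^ 2 * T ^ (1 / 3 + η / 2) with hB
  have hB0 : 0 ≤ B := by positivity
  have hBs : ∀ t, T ≤ t → t ≤ 2 * T → ‖zz t‖ ^ 2 ≤ B := fun t h1 h2 => by
    have := hsup T t hT h1 h2
    calc ‖zz t‖ ^ 2 ≤ (K1 * T ^ (1 / 6 + η / 4)) ^ 2 := by gcongr
      _ = B := by
        rw [hB, mul_pow]; congr 1
        rw [← Real.rpow_natCast, ← Real.rpow_mul hT0.le]; congr 1; push_cast; ring
  have hBη : B ≤ K1 ^ 2 * (T ^ η * T ^ (1/3 : ℝ)) := by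
    rw [hB, ← Real.rpow_add hT0]
    exact mul_le_mul_of_nonneg_left (Real.rpow_le_rpow_of_exponent_le hT (by linarith))
      (by positivity)
  have hTη : 1 ≤ T ^ η := Real.one_le_rpow hT hη.le
  set δ : ℝ := (D:ℝ) ^ (-(1/4) : ℝ) with hδ
  have hδ0 : 0 < δ := by positivity
  have hδ3 : δ ^ 3 = (D:ℝ) ^ (-(3/4) : ℝ) := by
    rw [hδ, ← Real.rpow_natCast, ← Real.rpow_mul hD0.le]; congr 1; push_cast; ring
  have hδ4 : δ ^ 4 * D = 1 := by
    rw [hδ, ← Real.rpow_natCast, ← Real.rpow_mul hD0.le]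
    rw [show (-(1/4) : ℝ) * ((4:ℕ):ℝ) = -1 by norm_num, Real.rpow_neg_one]
    field_simp
  rw [← hδ3]
  set Y := T ^ (1/3 : ℝ) with hY
  have hY0 : 0 < Y := by positivity
  rcases lt_or_ge T D with hDT | hDT
  · calc ∫ t in T..(2 * T), ‖zz t‖ ^ 2 * ‖dpoly D a t‖ ^ 2
        ≤ ∫ t in T..(2 * T), B * ‖dpoly D a t‖ ^ 2 := by
          refine intervalIntegral.integral_mono_on hT2
            (((hcZ.norm.pow 2).mul (hcM.norm.pow 2)).intervalIntegrable _ _)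
            ((continuous_const.mul (hcM.norm.pow 2)).intervalIntegrable _ _) fun t ht => ?_
          have := hBs t ht.1 ht.2
          gcongr
      _ = B * ∫ t in T..(2 * T), ‖dpoly D a t‖ ^ 2 := intervalIntegral.integral_const_mul _ _
      _ ≤ B * 200 := by
          gcongr
          refine (integral_dpoly_sq_le hD ha hT0).trans ?_
          rw [div_le_iff₀ hD0]; linarith
      _ ≤ K1 ^ 2 * (T ^ η * Y) * 200 := by gcongr
      _ = 200 * K1 ^ 2 * T ^ η * Y := by ring
      _ ≤ (200 * K1 ^ 2 + (K2 + 200) + A * (192 * K1 ^ 2 + 10 ^ 4 * K2)) * T ^ η *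
            (T * δ ^ 3 + Y) := by
          have : 0 ≤ (K2 + 200) + A * (192 * K1 ^ 2 + 10 ^ 4 * K2) := by positivity
          have h3 : 0 ≤ T * δ ^ 3 := by positivity
          gcongr
          · linarith
          · linarith
  set L := 1 + Real.log T with hL
  have hlogT : 0 ≤ Real.log T := Real.log_nonneg hT
  have hL1 : 1 ≤ L := by linarith
  have hLsq : L ^ 2 ≤ A * T ^ (η / 2) := one_add_log_sq_le (by positivity) hT
  have hlog1 : Real.log (1 + T) ≤ L := by
    calc Real.log (1 + T) ≤ Real.log (2 * T) := Real.log_le_log (by linarith) (by linarith)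
      _ = Real.log 2 + Real.log T := Real.log_mul two_ne_zero hT0.ne'
      _ ≤ L := by have := Real.log_two_lt_d9; linarith
  set J := Nat.clog 16 D with hJ
  have hJ1 : ((2:ℝ) ^ J)⁻¹ ≤ δ := by
    have h1 : (D:ℝ) ≤ 16 ^ J := by exact_mod_cast Nat.le_pow_clog (by norm_num) D
    have h2 : (((2:ℝ) ^ J)⁻¹) ^ 4 ≤ δ ^ 4 := by
      have e1 : (((2:ℝ) ^ J)⁻¹) ^ 4 = ((16:ℝ) ^ J)⁻¹ := by
        rw [inv_pow, ← pow_mul, mul_comm, pow_mul]; norm_num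
      have e2 : δ ^ 4 = (D:ℝ)⁻¹ := by field_simp; linarith
      rw [e1, e2]; gcongr
    exact le_of_pow_le_pow_left₀ (by norm_num) hδ0.le h2
  have hlt : ∀ i < J, (16:ℝ) ^ i < D := fun i hi => by
    exact_mod_cast (Nat.lt_clog_iff_pow_lt (by norm_num)).1 hi
  have hJL : (J:ℝ) ≤ L := by
    rcases Nat.eq_zero_or_pos J with h | h
    · rw [h]; push_cast; linarith
    · have h1 := hlt (J - 1) (by omega)
      have h2 := Real.log_lt_log (by positivity) (h1.trans_le hDT)
      rw [Real.log_pow] at h2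
      have h3 : 1 ≤ Real.log 16 := by
        rw [Real.le_log_iff_exp_le (by norm_num)]
        linarith [Real.exp_one_lt_d9]
      have h4 : ((J - 1 : ℕ) : ℝ) = J - 1 := by push_cast [h]; ring
      rw [h4] at h2
      have h5 : (0:ℝ) ≤ J - 1 := by rw [← h4]; positivity
      nlinarith
  set f : ℝ → ℝ := fun t => ‖zz t‖ ^ 2 * ‖dpoly D a t‖ ^ 2 with hf
  have hfc : Continuous f := (hcZ.norm.pow 2).mul (hcM.norm.pow 2)
  have hsplit := integral_le_sum_levels hfc (fun t => by positivity) hcM.norm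
    (norm_dpoly_le_one hD ha) hJ1 hT0
  have hz4 := h4 T hT
  have hz40 : 0 ≤ ∫ t in T..(2 * T), ‖zz t‖ ^ 4 :=
    intervalIntegral.integral_nonneg hT2 fun t _ => by positivity
  set Q := T ^ (η / 4) with hQ
  have hQ1 : 1 ≤ Q := Real.one_le_rpow hT (by positivity)
  have hQ2 : T ^ (η / 2) = Q ^ 2 := by
    rw [hQ, ← Real.rpow_natCast, ← Real.rpow_mul hT0.le]; congr 1; push_cast; ring
  have hQ4 : T ^ η = Q ^ 4 := by
    rw [hQ, ← Real.rpow_natCast, ← Real.rpow_mul hT0.le]; congr 1; push_cast; ring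
  rw [Real.rpow_add hT0, Real.rpow_one, hQ2] at hz4
  have hBQ : B = K1 ^ 2 * (Y * Q ^ 2) := by rw [hB, Real.rpow_add hT0, hQ2]
  have hsmall := setIntegral_small_level_le hD ha hT0 hDT hδ0 hδ4
    (isClosed_le hcM.norm continuous_const).measurableSet (A := {t | ‖dpoly D a t‖ ≤ δ})
    fun t ht => ht
  have hlevel : ∀ i ∈ Finset.range J, ∫ t in Set.Ioc T (2 * T) ∩
      {t | ((2:ℝ) ^ (i + 1))⁻¹ ≤ ‖dpoly D a t‖ ∧ ‖dpoly D a t‖ ≤ ((2:ℝ) ^ i)⁻¹}, f t ≤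
      L * (192 * B + 10 ^ 4 * K2 * (T * Q * δ ^ 3)) := by
    intro i hi
    have hi' := hlt i (Finset.mem_range.1 hi)
    set S := {t | ((2:ℝ) ^ (i + 1))⁻¹ ≤ ‖dpoly D a t‖ ∧ ‖dpoly D a t‖ ≤ ((2:ℝ) ^ i)⁻¹} with hS
    have mS : MeasurableSet S := ((isClosed_le continuous_const hcM.norm).inter
      (isClosed_le hcM.norm continuous_const)).measurableSet
    set V : ℝ := ((2:ℝ) ^ (i + 1))⁻¹ with hV
    have hV0 : 0 < V := by positivity
    have hV2 : ((2:ℝ) ^ i)⁻¹ = 2 * V := by rw [hV, pow_succ]; field_simp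
    have hVδ : δ ≤ 2 * V := by
      rw [← hV2]
      have h2 : δ ^ 4 ≤ (((2:ℝ) ^ i)⁻¹) ^ 4 := by
        have e1 : (((2:ℝ) ^ i)⁻¹) ^ 4 = ((16:ℝ) ^ i)⁻¹ := by
          rw [inv_pow, ← pow_mul, mul_comm, pow_mul]; norm_num
        have e2 : δ ^ 4 = (D:ℝ)⁻¹ := by field_simp; linarith
        rw [e1, e2]; gcongr
      exact le_of_pow_le_pow_left₀ (by norm_num) (by positivity) h2
    have hn1 : 0 ≤ 10 ^ 4 * K2 * (T * Q * δ ^ 3) := by positivity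
    rcases le_or_gt (120 * √T) (D * V ^ 2) with h | h
    · have hsub : Set.Ioc T (2 * T) ∩ S ⊆ Set.Icc T (T + T) := by
        rw [← two_mul]; exact Set.inter_subset_left.trans Set.Ioc_subset_Icc_self
      have := level_set_le_of_sup hD ha hT0.le hV0 h (measurableSet_Ioc.inter mS) hsub
        (fun t ht => ht.2.1) (fun t ht => hBs t ht.1.1.le ht.1.2) hB0
      refine this.trans ?_
      calc 192 * Real.log (1 + T) * B ≤ 192 * L * B := by gcongr
        _ = L * (192 * B + 0) := by ring
        _ ≤ _ := by gcongr
    · have := level_set_sq_le_of_short hD ha hT0 hV0 h.le mS (fun t ht => ht.1)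
        (fun t ht => ht.2.trans_eq hV2)
      have h0 : 0 ≤ L * (10 ^ 4 * K2 * (T * Q * δ ^ 3)) := by positivity
      have h1 : ∫ t in Set.Ioc T (2 * T) ∩ S, f t ≤ L * (10 ^ 4 * K2 * (T * Q * δ ^ 3)) := by
        refine le_of_sq_le_sq ?_ h0
        refine this.trans ?_
        have hDV : (4 * δ ^ 6)⁻¹ ≤ (D * V) ^ 2 := by
          have : (D:ℝ) = (δ ^ 4)⁻¹ := by field_simp; linarith
          calc (4 * δ ^ 6)⁻¹ = ((δ ^ 4)⁻¹ * (δ / 2)) ^ 2 := by field_simp; norm_num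
            _ ≤ (D * V) ^ 2 := by
              rw [this]; gcongr; linarith
        have hlog0 : 0 ≤ Real.log (1 + T) := Real.log_nonneg (by linarith)
        calc 28800 * 768 * Real.log (1 + T) * T / (D * V) ^ 2 * ∫ t in T..(2 * T), ‖zz t‖ ^ 4
            ≤ 28800 * 768 * L * T / (4 * δ ^ 6)⁻¹ * (K2 * (T * Q ^ 2)) := by gcongr
          _ = 88473600 * (L * K2) * (T * Q * δ ^ 3) ^ 2 := by field_simp; ring
          _ ≤ 10 ^ 8 * (L * K2) ^ 2 * (T * Q * δ ^ 3) ^ 2 := by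
              have : L * K2 ≤ (L * K2) ^ 2 := le_self_pow₀ (by nlinarith) two_ne_zero
              have h00 : 0 ≤ (L * K2) ^ 2 := by positivity
              gcongr ?_ * _
              linarith
          _ = _ := by ring
      refine h1.trans ?_
      gcongr
      linarith
  calc ∫ t in T..(2 * T), f t
      ≤ (δ ^ 3 * (∫ t in T..(2 * T), ‖zz t‖ ^ 4) + 200 * T * δ ^ 3) +
        ∑ i ∈ Finset.range J, L * (192 * B + 10 ^ 4 * K2 * (T * Q * δ ^ 3)) :=
        hsplit.trans (add_le_add hsmall (Finset.sum_le_sum hlevel))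
    _ = (δ ^ 3 * (∫ t in T..(2 * T), ‖zz t‖ ^ 4) + 200 * T * δ ^ 3) +
        J * (L * (192 * B + 10 ^ 4 * K2 * (T * Q * δ ^ 3))) := by
        rw [Finset.sum_const, Finset.card_range, nsmul_eq_mul]
    _ ≤ (δ ^ 3 * (K2 * (T * Q ^ 2)) + 200 * T * δ ^ 3) +
        L * (L * (192 * B + 10 ^ 4 * K2 * (T * Q * δ ^ 3))) := by gcongr
    _ = (δ ^ 3 * (K2 * (T * Q ^ 2)) + 200 * T * δ ^ 3 * 1) +
        L ^ 2 * (192 * B + 10 ^ 4 * K2 * (T * Q * δ ^ 3)) := by ring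
    _ ≤ _ := by
        rw [hQ4]
        exact level_bound_arith hδ0 hT0 hY0 hQ1 hA0 hK2 (hLsq.trans_eq (by rw [hQ2])) hBQ

section Fourier

open FourierTransform

open scoped SchwartzMap ContDiff in
lemma toLp_fourier_ae_eq {f : ℝ → ℂ} (hf : Integrable f) (hf2 : MemLp f 2 volume) :
    ((𝓕 (hf2.toLp f) : Lp ℂ 2 (volume : Measure ℝ)) : ℝ → ℂ) =ᵐ[volume] 𝓕 f := by
  set h : Lp ℂ 2 (volume : Measure ℝ) := 𝓕 (hf2.toLp f) with hh
  have hcont : Continuous (𝓕 f) :=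
    VectorFourier.fourierIntegral_continuous Real.continuous_fourierChar
      (by exact continuous_inner) hf
  refine ae_eq_of_integral_contDiff_smul_eq
    ((Lp.memLp h).locallyIntegrable (by norm_num)) hcont.locallyIntegrable fun g hg hgc => ?_
  have hg' : ContDiff ℝ ∞ (fun x => (g x : ℂ)) := Complex.ofRealCLM.contDiff.comp hg
  have hgc' : HasCompactSupport (fun x => (g x : ℂ)) := hgc.comp_left (g := fun x : ℝ => (x:ℂ)) (by simp)
  set G : 𝓢(ℝ, ℂ) := hgc'.toSchwartzMap hg' with hG
  have hGx : ∀ x, G x = (g x : ℂ) := fun x => rfl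
  have h1 := congrArg (fun F => F G) (Lp.fourier_toTemperedDistribution_eq (hf2.toLp f))
  simp only [TemperedDistribution.fourier_apply, Lp.toTemperedDistribution_apply] at h1
  have h2 : ∫ x, G x • h x = ∫ x, (𝓕 G) x • f x := by
    rw [← h1]
    refine integral_congr_ae ?_
    filter_upwards [hf2.coeFn_toLp] with x hx
    rw [hx]
  have h3 : ∫ x, (𝓕 G) x • f x = ∫ x, G x • 𝓕 f x := by
    rw [SchwartzMap.fourier_coe]
    have := VectorFourier.integral_fourierIntegral_smul_eq_flip (L := innerₗ ℝ)
      Real.continuous_fourierChar continuous_inner (SchwartzMap.integrable (μ := volume) G) hf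
    simpa using! this
  have h4 : ∀ k : ℝ → ℂ, ∫ x, g x • k x = ∫ x, G x • k x := fun k => by
    refine integral_congr_ae (ae_of_all _ fun x => ?_)
    simp only [hGx, Complex.real_smul, smul_eq_mul]
  rw [h4, h4, h2, h3]

/-- Plancherel's theorem for integrable square-integrable functions. -/
lemma lintegral_fourier_sq {f : ℝ → ℂ} (hf : Integrable f) (hf2 : MemLp f 2 volume) :
    ∫⁻ x, ‖𝓕 f x‖ₑ ^ 2 = ∫⁻ x, ‖f x‖ₑ ^ 2 := by
  have key : ∀ k : ℝ → ℂ, (∫⁻ x, ‖k x‖ₑ ^ 2) = eLpNorm k 2 volume ^ 2 := fun k => by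
    rw [eLpNorm_eq_lintegral_rpow_enorm_toReal (by norm_num) (by norm_num), ← ENNReal.rpow_natCast,
      ← ENNReal.rpow_mul]
    norm_num
  rw [key, key, ← eLpNorm_congr_ae (toLp_fourier_ae_eq hf hf2)]
  congr 1
  have := Lp.norm_fourier_eq (hf2.toLp f)
  rw [← ENNReal.toReal_eq_toReal_iff' (Lp.eLpNorm_ne_top _) hf2.2.ne, ← Lp.norm_def, this,
    Lp.norm_toLp]

lemma fourier_eq_integral_ex_mul (f : ℝ → ℂ) (ξ : ℝ) : 𝓕 f ξ = ∫ u, ex (-(u * ξ)) * f u := by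
  rw [fourier_eq_integral_ex]
  refine integral_congr_ae (ae_of_all _ fun u => ?_)
  simp only
  rw [mul_comm, neg_mul, mul_comm ξ]

lemma fourier_comp_add (f : ℝ → ℂ) (c ξ : ℝ) :
    𝓕 (fun u => f (u + c)) ξ = ex (c * ξ) * 𝓕 f ξ := by
  rw [fourier_eq_integral_ex_mul, fourier_eq_integral_ex_mul, ← integral_const_mul,
    ← integral_add_right_eq_self (fun u => ex (c * ξ) * (ex (-(u * ξ)) * f u)) c]
  refine integral_congr_ae (ae_of_all _ fun u => ?_)
  simp only
  rw [← mul_assoc, ← ex_add]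
  congr 2
  ring

lemma integrable_ex_mul {f : ℝ → ℂ} (hf : Integrable f) (ξ : ℝ) :
    Integrable fun u => ex (-(u * ξ)) * f u :=
  hf.bdd_mul (c := 1) (by unfold ex; fun_prop) (ae_of_all _ fun u => (norm_ex _).le)

/-- The function `e ^ (-u/2) {e ^ u}`. -/
noncomputable def expFract (u : ℝ) : ℂ :=
  ((Real.exp (-(u / 2)) * Int.fract (Real.exp u) : ℝ) : ℂ)

lemma exp_smul_fract_pw (t u : ℝ) :
    |Real.exp u| • (((Int.fract (Real.exp u) / Real.exp u : ℝ) : ℂ) * pw t (Real.exp u)) =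
      ex (-(u * (t / (2 * Real.pi)))) * expFract u := by
  have h1 : (√(Real.exp u))⁻¹ = Real.exp (-(u / 2)) := by
    rw [← Real.exp_half, Real.exp_neg]
  have h2 : (Real.exp u : ℂ) ≠ 0 := by exact_mod_cast (Real.exp_pos u).ne'
  rw [abs_of_pos (Real.exp_pos u), pw, h1, osc_eq_ex, Real.log_exp, expFract, Complex.real_smul,
    mul_comm u]
  push_cast [-Complex.ofReal_exp]
  field_simp

lemma integrable_expFract : Integrable expFract := by
  have h := (integrableOn_image_iff_integrableOn_abs_deriv_smul MeasurableSet.univ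
    (fun x _ => (Real.hasDerivAt_exp x).hasDerivWithinAt) Real.exp_injective.injOn
    (fun y => ((Int.fract y / y : ℝ) : ℂ) * pw 0 y)).1
    (by rw [Set.image_univ, Real.range_exp]; exact integrableOn_fract_pw 0)
  rw [integrableOn_univ] at h
  refine h.congr (ae_of_all _ fun u => ?_)
  simp only
  rw [exp_smul_fract_pw, zero_div, mul_zero, neg_zero, ex_zero, one_mul]

lemma fourier_expFract (ξ : ℝ) : 𝓕 expFract ξ = fractInt (2 * Real.pi * ξ) := by
  have h := integral_image_eq_integral_abs_deriv_smul MeasurableSet.univ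
    (fun x _ => (Real.hasDerivAt_exp x).hasDerivWithinAt) Real.exp_injective.injOn
    (fun y => ((Int.fract y / y : ℝ) : ℂ) * pw (2 * Real.pi * ξ) y)
  rw [Set.image_univ, Real.range_exp] at h
  rw [fractInt, h, setIntegral_univ, fourier_eq_integral_ex_mul]
  refine integral_congr_ae (ae_of_all _ fun u => ?_)
  simp only
  rw [exp_smul_fract_pw]
  congr 4
  field_simp

lemma norm_expFract_le (u : ℝ) : ‖expFract u‖ ≤ 1 := by
  rw [expFract, Complex.norm_real, Real.norm_of_nonneg (mul_nonneg (Real.exp_pos _).le (Int.fract_nonneg _))]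
  rcases le_total 0 u with hu | hu
  · exact mul_le_one₀ (Real.exp_le_one_iff.2 (by linarith)) (Int.fract_nonneg _) (Int.fract_lt_one _).le
  · have h1 : Int.fract (Real.exp u) ≤ Real.exp u := by
      have : (0:ℝ) ≤ ⌊Real.exp u⌋ := by exact_mod_cast Int.floor_nonneg.2 (Real.exp_pos u).le
      rw [Int.fract]; linarith
    calc Real.exp (-(u / 2)) * Int.fract (Real.exp u) ≤ Real.exp (-(u / 2)) * Real.exp u := by gcongr
      _ = Real.exp (u / 2) := by rw [← Real.exp_add]; congr 1; ring
      _ ≤ 1 := Real.exp_le_one_iff.2 (by linarith)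

lemma measurable_expFract : Measurable expFract := by
  unfold expFract
  exact Complex.measurable_ofReal.comp ((by fun_prop : Measurable fun u : ℝ => Real.exp (-(u / 2))).mul
    (measurable_fract.comp Real.measurable_exp))

lemma memLp_expFract : MemLp expFract 2 volume := by
  rw [memLp_two_iff_integrable_sq_norm measurable_expFract.aestronglyMeasurable]
  refine integrable_expFract.norm.mono' (measurable_expFract.norm.pow_const 2).aestronglyMeasurable
    (ae_of_all _ fun u => ?_)
  rw [Real.norm_of_nonneg (by positivity)]
  nlinarith [norm_expFract_le u, norm_nonneg (expFract u)]

/-- The weighted sum of fractional parts `∑ a_d {x / d²}` over a dyadic block. -/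
noncomputable def fractSum (D : ℕ) (a : ℕ → ℝ) (x : ℝ) : ℝ :=
  ∑ d ∈ Finset.Ioc D (2 * D), a d * Int.fract (x / (d:ℝ) ^ 2)

/-- The increment `e ^ (-u/2) (E(e ^ (u + θ)) - E(e ^ u))` of the sum of fractional parts. -/
noncomputable def expIncr (D : ℕ) (a : ℕ → ℝ) (θ u : ℝ) : ℂ :=
  ((Real.exp (-(u / 2)) * (fractSum D a (Real.exp (u + θ)) - fractSum D a (Real.exp u)) : ℝ) : ℂ)

lemma expIncr_eq (D : ℕ) (a : ℕ → ℝ) (θ : ℝ) : expIncr D a θ = fun u =>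
    ∑ d ∈ Finset.Ioc D (2 * D), ((a d / d : ℝ) : ℂ) *
      (((Real.exp (θ / 2) : ℝ) : ℂ) * expFract (u + (θ - 2 * Real.log d))
        - expFract (u + -(2 * Real.log d))) := by
  funext u
  rw [expIncr, fractSum, fractSum, ← Finset.sum_sub_distrib, Finset.mul_sum, Complex.ofReal_sum]
  refine Finset.sum_congr rfl fun d hd => ?_
  have hd0 : (0:ℝ) < d := by exact_mod_cast (Nat.zero_le D).trans_lt (Finset.mem_Ioc.1 hd).1
  have hl : ∀ v : ℝ, Real.exp (v - 2 * Real.log d) = Real.exp v / (d:ℝ) ^ 2 := fun v => by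
    rw [Real.exp_sub, two_mul, Real.exp_add, Real.exp_log hd0, sq]
  have h1 : Real.exp (-((u + (θ - 2 * Real.log d)) / 2)) = Real.exp (-(u / 2)) / Real.exp (θ / 2) * d := by
    rw [show -((u + (θ - 2 * Real.log d)) / 2) = -(u / 2) - θ / 2 + Real.log d by ring,
      Real.exp_add, Real.exp_log hd0, Real.exp_sub]
  have h2 : Real.exp (-((u + -(2 * Real.log d)) / 2)) = Real.exp (-(u / 2)) * d := by
    rw [show -((u + -(2 * Real.log d)) / 2) = -(u / 2) + Real.log d by ring,
      Real.exp_add, Real.exp_log hd0]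
  rw [expFract, expFract, h1, h2, ← add_sub_assoc, hl, ← sub_eq_add_neg, hl]
  rw [← Complex.ofReal_mul, ← Complex.ofReal_sub, ← Complex.ofReal_mul]
  congr 1
  have := Real.exp_pos (θ / 2)
  field_simp

lemma integrable_expIncr (D : ℕ) (a : ℕ → ℝ) (θ : ℝ) : Integrable (expIncr D a θ) := by
  rw [expIncr_eq]
  exact integrable_finsetSum _ fun d _ => (((integrable_expFract.comp_add_right _).const_mul _).sub
    (integrable_expFract.comp_add_right _)).const_mul _

lemma memLp_expIncr (D : ℕ) (a : ℕ → ℝ) (θ : ℝ) : MemLp (expIncr D a θ) 2 volume := by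
  have hshift : ∀ c : ℝ, MemLp (fun u => expFract (u + c)) 2 volume := fun c =>
    memLp_expFract.comp_measurePreserving (measurePreserving_add_right volume c)
  rw [expIncr_eq]
  exact memLp_finsetSum _ fun d _ => (((hshift _).const_mul _).sub (hshift _)).const_mul _

lemma fourier_expIncr (D : ℕ) (a : ℕ → ℝ) (θ ξ : ℝ) :
    𝓕 (expIncr D a θ) ξ = (Complex.exp (θ * crit (2 * Real.pi * ξ)) - 1) *
      dpoly D a (2 * Real.pi * ξ) * fractInt (2 * Real.pi * ξ) := by
  have hi : ∀ c : ℝ, Integrable fun u => ex (-(u * ξ)) * expFract (u + c) := fun c =>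
    integrable_ex_mul (integrable_expFract.comp_add_right c) ξ
  have hs : ∀ c : ℝ, ∫ u, ex (-(u * ξ)) * expFract (u + c) = ex (c * ξ) * fractInt (2 * Real.pi * ξ) :=
    fun c => by rw [← fourier_expFract, ← fourier_comp_add, fourier_eq_integral_ex_mul]
  rw [fourier_eq_integral_ex_mul, expIncr_eq]
  have hpt : ∀ u : ℝ, ex (-(u * ξ)) * (∑ d ∈ Finset.Ioc D (2 * D), ((a d / d : ℝ) : ℂ) *
      (((Real.exp (θ / 2) : ℝ) : ℂ) * expFract (u + (θ - 2 * Real.log d))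
        - expFract (u + -(2 * Real.log d)))) = ∑ d ∈ Finset.Ioc D (2 * D), ((a d / d : ℝ) : ℂ) *
      (((Real.exp (θ / 2) : ℝ) : ℂ) * (ex (-(u * ξ)) * expFract (u + (θ - 2 * Real.log d)))
        - ex (-(u * ξ)) * expFract (u + -(2 * Real.log d))) := fun u => by
    rw [Finset.mul_sum]
    exact Finset.sum_congr rfl fun d _ => by ring
  simp only [hpt]
  have hterm : ∀ d ∈ Finset.Ioc D (2 * D), Integrable fun u : ℝ => ((a d / d : ℝ) : ℂ) *
      (((Real.exp (θ / 2) : ℝ) : ℂ) * (ex (-(u * ξ)) * expFract (u + (θ - 2 * Real.log d)))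
        - ex (-(u * ξ)) * expFract (u + -(2 * Real.log d))) := fun d _ =>
    (((hi _).const_mul _).sub (hi _)).const_mul _
  rw [integral_finsetSum _ hterm, dpoly,
    Finset.mul_sum, Finset.sum_mul]
  refine Finset.sum_congr rfl fun d hd => ?_
  rw [integral_const_mul, integral_sub ((hi _).const_mul _) (hi _), integral_const_mul, hs, hs]
  have h1 : ex (-(2 * Real.log d) * ξ) = osc (2 * (2 * Real.pi * ξ)) d := by
    rw [osc_eq_ex]; congr 1; field_simp
  have h2 : ((Real.exp (θ / 2) : ℝ) : ℂ) * ex ((θ - 2 * Real.log d) * ξ) =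
      Complex.exp (θ * crit (2 * Real.pi * ξ)) * osc (2 * (2 * Real.pi * ξ)) d := by
    rw [← h1, show (θ - 2 * Real.log d) * ξ = θ * ξ + -(2 * Real.log d) * ξ by ring, ex_add,
      ← mul_assoc]
    congr 1
    rw [ex, Complex.ofReal_exp, ← Complex.exp_add, crit]
    congr 1; push_cast; ring
  rw [← mul_assoc, h2, h1]
  ring

/-- Plancherel's theorem applied to the increments of the sum of fractional parts. -/
lemma lintegral_expIncr_sq (D : ℕ) (a : ℕ → ℝ) (θ : ℝ) :
    ∫⁻ u, ‖expIncr D a θ u‖ₑ ^ 2 =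
      ∫⁻ ξ, ‖(Complex.exp (θ * crit (2 * Real.pi * ξ)) - 1) *
      dpoly D a (2 * Real.pi * ξ) * fractInt (2 * Real.pi * ξ)‖ₑ ^ 2 := by
  rw [← lintegral_fourier_sq (integrable_expIncr D a θ) (memLp_expIncr D a θ)]
  simp only [fourier_expIncr]

lemma norm_exp_mul_crit_sub_one_le {θ : ℝ} (hθ : 0 < θ) (hθ8 : θ ≤ 8) (t : ℝ) :
    ‖Complex.exp (θ * crit t) - 1‖ ≤ 56 * (‖crit t‖ * min θ (‖crit t‖)⁻¹) := by
  have hc : 0 < ‖crit t‖ := norm_pos_iff.2 (crit_ne_zero t)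
  have hn : ‖(θ : ℂ) * crit t‖ = ‖crit t‖ * θ := by
    rw [norm_mul, Complex.norm_real, Real.norm_of_nonneg hθ.le, mul_comm]
  have h1 : ‖Complex.exp (θ * crit t) - 1‖ ≤ 56 := by
    have he : Real.exp 4 ≤ 55 := by
      have h := Real.exp_one_lt_d9
      calc Real.exp 4 = Real.exp 1 ^ 4 := by rw [← Real.exp_nat_mul]; norm_num
        _ ≤ (2.72 : ℝ) ^ 4 := by gcongr; linarith
        _ ≤ 55 := by norm_num
    calc ‖Complex.exp (θ * crit t) - 1‖ ≤ ‖Complex.exp (θ * crit t)‖ + ‖(1:ℂ)‖ := norm_sub_le _ _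
      _ = Real.exp (θ / 2) + 1 := by
          rw [Complex.norm_exp, norm_one, Complex.re_ofReal_mul, crit_re]; congr 2; ring
      _ ≤ Real.exp 4 + 1 := by gcongr; linarith
      _ ≤ 56 := by linarith
  rcases le_total (‖crit t‖ * θ) 1 with h | h
  · rw [min_eq_left (by rw [← one_div, le_div_iff₀ hc]; linarith)]
    refine (Complex.norm_exp_sub_one_le (hn ▸ h)).trans ?_
    rw [hn]
    nlinarith [mul_pos hc hθ]
  · rw [min_eq_right (by rw [← one_div, div_le_iff₀ hc]; linarith), mul_inv_cancel₀ hc.ne']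
    linarith

/-- The weight in the Plancherel integral for an increment of length `θ`. -/
noncomputable def incrWeight (D : ℕ) (a : ℕ → ℝ) (θ t : ℝ) : ℝ :=
  min θ (‖crit t‖)⁻¹ ^ 2 * (‖zz t‖ ^ 2 * ‖dpoly D a t‖ ^ 2)

lemma incrWeight_nonneg (D : ℕ) (a : ℕ → ℝ) (θ t : ℝ) : 0 ≤ incrWeight D a θ t := by
  unfold incrWeight; positivity

lemma continuous_incrWeight (D : ℕ) (a : ℕ → ℝ) (θ : ℝ) : Continuous (incrWeight D a θ) := by
  have hc : Continuous crit := by unfold crit; fun_prop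
  unfold incrWeight
  refine ((continuous_const.min (hc.norm.inv₀ fun t => ?_)).pow 2).mul
    ((continuous_zz.norm.pow 2).mul ((continuous_dpoly D a).norm.pow 2))
  exact norm_ne_zero_iff.2 (crit_ne_zero t)

lemma incrWeight_neg (D : ℕ) (a : ℕ → ℝ) (θ t : ℝ) : incrWeight D a θ (-t) = incrWeight D a θ t := by
  have h1 : ‖crit (-t)‖ = ‖crit t‖ := by
    rw [← RCLike.norm_conj (crit t)]; congr 1; apply Complex.ext <;> simp [crit]
  have h2 : ‖dpoly D a (-t)‖ = ‖dpoly D a t‖ := by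
    rw [← RCLike.norm_conj (dpoly D a t)]
    congr 1
    rw [dpoly, dpoly, map_sum]
    refine Finset.sum_congr rfl fun d _ => ?_
    rw [map_mul, Complex.conj_ofReal, conj_osc, mul_neg]
  rw [incrWeight, incrWeight, h1, h2, norm_zz_neg]

lemma enorm_fourier_sq_le {θ : ℝ} (hθ : 0 < θ) (hθ8 : θ ≤ 8) (D : ℕ) (a : ℕ → ℝ) (t : ℝ) :
    ‖(Complex.exp (θ * crit t) - 1) * dpoly D a t * fractInt t‖ₑ ^ 2 ≤
      ENNReal.ofReal (56 ^ 2) * ENNReal.ofReal (incrWeight D a θ t) := by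
  have hc : 0 < ‖crit t‖ := norm_pos_iff.2 (crit_ne_zero t)
  rw [← ofReal_norm, ← ENNReal.ofReal_pow (norm_nonneg _), ← ENNReal.ofReal_mul (by norm_num)]
  refine ENNReal.ofReal_le_ofReal ?_
  have hz : ‖zz t‖ = ‖crit t‖ * ‖fractInt t‖ := by rw [zz, norm_mul]
  rw [norm_mul, norm_mul, incrWeight, hz, ← mul_pow, ← mul_pow, ← mul_pow]
  refine pow_le_pow_left₀ (by positivity) ?_ 2
  calc ‖Complex.exp (θ * crit t) - 1‖ * ‖dpoly D a t‖ * ‖fractInt t‖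
      ≤ 56 * (‖crit t‖ * min θ (‖crit t‖)⁻¹) * ‖dpoly D a t‖ * ‖fractInt t‖ := by
        gcongr; exact norm_exp_mul_crit_sub_one_le hθ hθ8 t
    _ = _ := by ring

lemma lintegral_comp_mul_le {c : ℝ} (hc : 1 ≤ c) {f : ℝ → ENNReal} (hf : Measurable f) :
    ∫⁻ x, f (c * x) ≤ ∫⁻ x, f x := by
  have h0 : c ≠ 0 := by linarith
  rw [← lintegral_map hf (measurable_const_mul c), Real.map_volume_mul_left h0, lintegral_smul_measure]
  refine mul_le_of_le_one_left' ?_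
  rw [ENNReal.ofReal_le_one, abs_of_nonneg (by positivity)]
  exact inv_le_one_of_one_le₀ hc

lemma lintegral_le_two_mul_of_even {f : ℝ → ENNReal} (hf : ∀ x, f (-x) = f x) :
    ∫⁻ x, f x ≤ 2 * ∫⁻ x in Set.Ici 0, f x := by
  have h1 : ∫⁻ x in Set.Iic 0, f x = ∫⁻ x in Set.Ici 0, f x := by
    rw [← lintegral_indicator measurableSet_Iic, ← lintegral_indicator measurableSet_Ici,
      ← lintegral_neg_eq_self]
    refine lintegral_congr fun x => ?_
    simp only [Set.indicator, Set.mem_Iic, Set.mem_Ici, hf, neg_nonpos]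
  rw [two_mul, ← setLIntegral_univ, ← Set.Iic_union_Ici (a := (0:ℝ))]
  exact (lintegral_union_le _ _ _).trans_eq (by rw [h1])

lemma setLIntegral_Icc_ofReal_eq {f : ℝ → ℝ} (hf : Continuous f) (h0 : ∀ x, 0 ≤ f x) {p q : ℝ}
    (hpq : p ≤ q) : ∫⁻ x in Set.Icc p q, ENNReal.ofReal (f x) = ENNReal.ofReal (∫ x in p..q, f x) := by
  rw [intervalIntegral.integral_of_le hpq, ← integral_Icc_eq_integral_Ioc,
    ofReal_integral_eq_lintegral_ofReal (hf.integrableOn_Icc) (ae_of_all _ h0)]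

lemma sq_min_le_rpow {θ u p : ℝ} (hθ : 0 < θ) (hu : 0 < u) (hp : 0 ≤ p) (hp2 : p ≤ 2) :
    min θ u ^ 2 ≤ θ ^ (2 - p) * u ^ p := by
  have hm : 0 < min θ u := lt_min hθ hu
  calc min θ u ^ 2 = min θ u ^ (2 - p) * min θ u ^ p := by
        rw [← Real.rpow_add hm, ← Real.rpow_natCast]; norm_num
    _ ≤ _ := by
        gcongr
        · exact min_le_left _ _
        · exact min_le_right _ _

lemma exists_lintegral_expIncr_sq_le {η : ℝ} (hη : 0 < η) (hη1 : η ≤ 1 / 3) :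
    ∃ K : ℝ, 1 ≤ K ∧ ∀ θ : ℝ, 0 < θ → θ ≤ 8 → ∀ D : ℕ, 1 ≤ D → ∀ a : ℕ → ℝ, (∀ d, |a d| ≤ 1) →
      ∫⁻ u, ‖expIncr D a θ u‖ₑ ^ 2 ≤
        ENNReal.ofReal (K * (θ ^ (1 - 2 * η) * (D:ℝ) ^ (-(3 / 4) : ℝ) + θ ^ (5 / 3 - 2 * η))) := by
  obtain ⟨K, hK, hKb⟩ := exists_integral_zz_dpoly_le hη (by linarith)
  set r : ℝ := 2 ^ (-η) with hr
  have hr0 : 0 < r := by positivity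
  have hr1 : r < 1 := Real.rpow_lt_one_of_one_lt_of_neg one_lt_two (by linarith)
  have hS : Summable fun k : ℕ => r ^ k := summable_geometric_of_lt_one hr0.le hr1
  set S : ℝ := ∑' k : ℕ, r ^ k with hSd
  have hS0 : 0 ≤ S := tsum_nonneg fun k => by positivity
  refine ⟨56 ^ 2 * (2 * (200 + K * S)), by nlinarith [mul_nonneg (zero_le_one.trans hK) hS0],
    fun θ hθ hθ8 D hD a ha => ?_⟩
  have hD0 : (0:ℝ) < D := by exact_mod_cast hD
  set B : ℝ := θ ^ (1 - 2 * η) * (D:ℝ) ^ (-(3 / 4) : ℝ) + θ ^ (5 / 3 - 2 * η) with hB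
  have hB0 : 0 ≤ B := by positivity
  have hGc := continuous_incrWeight D a θ
  have hG0 := incrWeight_nonneg D a θ
  -- the low frequencies
  have hlow : ∫⁻ t in Set.Icc 0 1, ENNReal.ofReal (incrWeight D a θ t) ≤ ENNReal.ofReal (200 * B) := by
    rw [setLIntegral_Icc_ofReal_eq hGc hG0 zero_le_one]
    refine ENNReal.ofReal_le_ofReal ?_
    have hpt : ∀ t ∈ Set.Icc (0:ℝ) 1, incrWeight D a θ t ≤ 25 * θ ^ 2 := fun t ht => by
      have h1 : ‖zz t‖ ≤ 5 := (norm_zz_le_linear t).trans (by rw [abs_of_nonneg ht.1]; linarith [ht.2])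
      have h2 := norm_dpoly_le_one hD ha t
      have h3 : min θ (‖crit t‖)⁻¹ ≤ θ := min_le_left _ _
      have h4 : 0 ≤ min θ (‖crit t‖)⁻¹ := le_min hθ.le (by positivity)
      calc incrWeight D a θ t ≤ θ ^ 2 * (5 ^ 2 * 1 ^ 2) := by unfold incrWeight; gcongr
        _ = 25 * θ ^ 2 := by ring
    have h5 : ∫ t in (0:ℝ)..1, incrWeight D a θ t ≤ ∫ t in (0:ℝ)..1, 25 * θ ^ 2 :=
      intervalIntegral.integral_mono_on zero_le_one (hGc.intervalIntegrable _ _)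
        intervalIntegrable_const hpt
    have h6 : θ ^ 2 ≤ 8 * θ ^ (5 / 3 - 2 * η) := by
      have : θ ^ 2 = θ ^ (5 / 3 - 2 * η) * θ ^ (1 / 3 + 2 * η) := by
        rw [← Real.rpow_add hθ, ← Real.rpow_natCast]; congr 1; push_cast; ring
      rw [this, mul_comm]
      gcongr
      calc θ ^ (1 / 3 + 2 * η) ≤ 8 ^ (1 / 3 + 2 * η) := by gcongr
        _ ≤ 8 ^ (1:ℝ) := Real.rpow_le_rpow_of_exponent_le (by norm_num) (by linarith)
        _ = 8 := Real.rpow_one _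
    have h7 : 0 ≤ θ ^ (1 - 2 * η) * (D:ℝ) ^ (-(3 / 4) : ℝ) := by positivity
    rw [intervalIntegral.integral_const, smul_eq_mul] at h5
    rw [hB]; linarith
  -- dyadic blocks
  have hblock : ∀ k : ℕ, ∫⁻ t in Set.Icc ((2:ℝ) ^ k) (2 * 2 ^ k), ENNReal.ofReal (incrWeight D a θ t) ≤
      ENNReal.ofReal (K * B * r ^ k) := fun k => by
    set T : ℝ := 2 ^ k with hT
    have hT1 : 1 ≤ T := one_le_pow₀ one_le_two
    have hT0 : 0 < T := by positivity
    rw [setLIntegral_Icc_ofReal_eq hGc hG0 (by linarith)]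
    refine ENNReal.ofReal_le_ofReal ?_
    set m : ℝ := min θ T⁻¹ ^ 2 with hm
    have hm0 : 0 ≤ m := sq_nonneg _
    have hpt : ∀ t ∈ Set.Icc T (2 * T), incrWeight D a θ t ≤ m * (‖zz t‖ ^ 2 * ‖dpoly D a t‖ ^ 2) :=
      fun t ht => by
        have hc : T ≤ ‖crit t‖ := by
          calc T ≤ |(crit t).im| := by rw [crit_im]; exact ht.1.trans (le_abs_self t)
            _ ≤ _ := Complex.abs_im_le_norm _
        have h4 : 0 ≤ min θ (‖crit t‖)⁻¹ := le_min hθ.le (by positivity)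
        unfold incrWeight
        rw [hm]
        gcongr
    have hcont : Continuous fun t => ‖zz t‖ ^ 2 * ‖dpoly D a t‖ ^ 2 :=
      (continuous_zz.norm.pow 2).mul ((continuous_dpoly D a).norm.pow 2)
    have h1 : ∫ t in T..(2 * T), incrWeight D a θ t ≤
        ∫ t in T..(2 * T), m * (‖zz t‖ ^ 2 * ‖dpoly D a t‖ ^ 2) :=
      intervalIntegral.integral_mono_on (by linarith) (hGc.intervalIntegrable _ _)
        ((hcont.const_mul m).intervalIntegrable _ _) hpt
    rw [intervalIntegral.integral_const_mul] at h1
    have h2 := mul_le_mul_of_nonneg_left (hKb T hT1 D hD a ha) hm0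
    refine h1.trans (h2.trans ?_)
    have hrk : r ^ k = T ^ (-η) := by
      rw [hr, hT, ← Real.rpow_natCast, ← Real.rpow_natCast, ← Real.rpow_mul (by norm_num),
        ← Real.rpow_mul (by norm_num), mul_comm]
    have e1 : m * (T ^ η * T) ≤ θ ^ (1 - 2 * η) * T ^ (-η) := by
      have := sq_min_le_rpow hθ (inv_pos.2 hT0) (p := 1 + 2 * η) (by linarith) (by linarith)
      calc m * (T ^ η * T) ≤ θ ^ (2 - (1 + 2 * η)) * T⁻¹ ^ (1 + 2 * η) * (T ^ η * T) := by gcongr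
        _ = θ ^ (1 - 2 * η) * (T ^ (-(1 + 2 * η)) * (T ^ η * T ^ (1:ℝ))) := by
            rw [Real.inv_rpow hT0.le, Real.rpow_neg hT0.le, Real.rpow_one]; ring_nf
        _ = _ := by rw [← Real.rpow_add hT0, ← Real.rpow_add hT0]; ring_nf
    have e2 : m * (T ^ η * T ^ (1 / 3 : ℝ)) ≤ θ ^ (5 / 3 - 2 * η) * T ^ (-η) := by
      have := sq_min_le_rpow hθ (inv_pos.2 hT0) (p := 1 / 3 + 2 * η) (by linarith) (by linarith)
      calc m * (T ^ η * T ^ (1 / 3 : ℝ))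
          ≤ θ ^ (2 - (1 / 3 + 2 * η)) * T⁻¹ ^ (1 / 3 + 2 * η) * (T ^ η * T ^ (1 / 3 : ℝ)) := by gcongr
        _ = θ ^ (5 / 3 - 2 * η) * (T ^ (-(1 / 3 + 2 * η)) * (T ^ η * T ^ (1 / 3 : ℝ))) := by
            rw [Real.inv_rpow hT0.le, Real.rpow_neg hT0.le]; ring_nf
        _ = _ := by rw [← Real.rpow_add hT0, ← Real.rpow_add hT0]; ring_nf
    have hDp : 0 ≤ (D:ℝ) ^ (-(3 / 4) : ℝ) := by positivity
    rw [hrk]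
    calc m * (K * T ^ η * (T * (D:ℝ) ^ (-(3 / 4) : ℝ) + T ^ (1 / 3 : ℝ)))
        = K * (m * (T ^ η * T) * (D:ℝ) ^ (-(3 / 4) : ℝ) + m * (T ^ η * T ^ (1 / 3 : ℝ))) := by ring
      _ ≤ K * (θ ^ (1 - 2 * η) * T ^ (-η) * (D:ℝ) ^ (-(3 / 4) : ℝ) + θ ^ (5 / 3 - 2 * η) * T ^ (-η)) := by
          gcongr
      _ = K * B * T ^ (-η) := by rw [hB]; ring
  have hcover : Set.Ici (0:ℝ) ⊆ Set.Icc 0 1 ∪ ⋃ k : ℕ, Set.Icc ((2:ℝ) ^ k) (2 * 2 ^ k) := fun t ht => by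
    rcases le_total t 1 with h | h
    · exact Or.inl ⟨ht, h⟩
    · obtain ⟨n, h1, h2⟩ := exists_nat_pow_near h one_lt_two
      exact Or.inr (Set.mem_iUnion.2 ⟨n, h1, by rw [← pow_succ']; exact h2.le⟩)
  have hhalf : ∫⁻ t in Set.Ici 0, ENNReal.ofReal (incrWeight D a θ t) ≤
      ENNReal.ofReal ((200 + K * S) * B) := by
    refine (lintegral_mono_set hcover).trans ((lintegral_union_le _ _ _).trans ?_)
    have h1 := (lintegral_iUnion_le (μ := volume) (fun k : ℕ => Set.Icc ((2:ℝ) ^ k) (2 * 2 ^ k))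
      (fun t => ENNReal.ofReal (incrWeight D a θ t))).trans (ENNReal.tsum_le_tsum hblock)
    rw [← ENNReal.ofReal_tsum_of_nonneg (fun k => by positivity) (hS.mul_left _), tsum_mul_left] at h1
    refine (add_le_add hlow h1).trans ?_
    rw [← ENNReal.ofReal_add (by positivity) (by positivity)]
    exact ENNReal.ofReal_le_ofReal (by rw [← hSd]; linarith)
  have hmeas : Measurable fun t => ENNReal.ofReal (incrWeight D a θ t) := hGc.measurable.ennreal_ofReal
  rw [lintegral_expIncr_sq]
  calc _ ≤ ∫⁻ ξ, ENNReal.ofReal (56 ^ 2) * ENNReal.ofReal (incrWeight D a θ (2 * Real.pi * ξ)) :=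
        lintegral_mono fun ξ => enorm_fourier_sq_le hθ hθ8 D a _
    _ = ENNReal.ofReal (56 ^ 2) * ∫⁻ ξ, ENNReal.ofReal (incrWeight D a θ (2 * Real.pi * ξ)) := by
        rw [lintegral_const_mul' _ _ ENNReal.ofReal_ne_top]
    _ ≤ ENNReal.ofReal (56 ^ 2) * ∫⁻ t, ENNReal.ofReal (incrWeight D a θ t) := by
        exact mul_le_mul' le_rfl (lintegral_comp_mul_le (by linarith [Real.pi_gt_three]) hmeas)
    _ ≤ ENNReal.ofReal (56 ^ 2) * (2 * ∫⁻ t in Set.Ici 0, ENNReal.ofReal (incrWeight D a θ t)) := by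
        gcongr
        exact lintegral_le_two_mul_of_even fun t => by rw [incrWeight_neg]
    _ ≤ ENNReal.ofReal (56 ^ 2) * (ENNReal.ofReal 2 * ENNReal.ofReal ((200 + K * S) * B)) := by
        gcongr
        simp
    _ = _ := by
        rw [← ENNReal.ofReal_mul (by norm_num), ← ENNReal.ofReal_mul (by norm_num)]
        congr 1; ring

end Fourier

lemma measurable_fractSum (D : ℕ) (a : ℕ → ℝ) : Measurable (fractSum D a) := by
  unfold fractSum
  exact Finset.measurable_sum _ fun d _ =>
    (measurable_fract.comp (measurable_id.div_const _)).const_mul _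

lemma enorm_add_sq_le (p q : ℝ) : ‖p + q‖ₑ ^ 2 ≤ 2 * ‖p‖ₑ ^ 2 + 2 * ‖q‖ₑ ^ 2 := by
  have h : ∀ r : ℝ, ‖r‖ₑ ^ 2 = ENNReal.ofReal (r ^ 2) := fun r => by
    rw [← ofReal_norm, ← ENNReal.ofReal_pow (norm_nonneg _), Real.norm_eq_abs, sq_abs]
  have h2 : (2 : ENNReal) = ENNReal.ofReal 2 := by simp
  rw [h, h, h, h2, ← ENNReal.ofReal_mul zero_le_two, ← ENNReal.ofReal_mul zero_le_two,
    ← ENNReal.ofReal_add (by positivity) (by positivity)]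
  exact ENNReal.ofReal_le_ofReal (by nlinarith [sq_nonneg (p - q)])

lemma setLIntegral_comp_add_le {S T : Set ℝ} (hS : MeasurableSet S) (hT : MeasurableSet T) (c : ℝ)
    (h : ∀ x ∈ S, x + c ∈ T) (f : ℝ → ENNReal) :
    ∫⁻ x in S, f (x + c) ≤ ∫⁻ x in T, f x := by
  rw [← lintegral_indicator hS, ← lintegral_indicator hT, ← lintegral_add_right_eq_self (T.indicator f) c]
  refine lintegral_mono fun x => ?_
  by_cases hx : x ∈ S
  · rw [Set.indicator_of_mem hx, Set.indicator_of_mem (s := T) (h x hx)]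
  · rw [Set.indicator_of_notMem hx]; exact zero_le

lemma setLIntegral_fractSum_exp_le {X : ℝ} (hX : 0 < X) (D : ℕ) (a : ℕ → ℝ) (θ : ℝ) :
    ∫⁻ x in Set.Ioc X (3 * X), ‖fractSum D a (x * Real.exp θ) - fractSum D a x‖ₑ ^ 2 ≤
      ENNReal.ofReal (9 * X ^ 2) * ∫⁻ u, ‖expIncr D a θ u‖ₑ ^ 2 := by
  set S : Set ℝ := Real.exp ⁻¹' Set.Ioc X (3 * X) with hS
  have hSm : MeasurableSet S := Real.measurable_exp measurableSet_Ioc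
  have himg : Real.exp '' S = Set.Ioc X (3 * X) := by
    rw [hS, Set.image_preimage_eq_inter_range, Real.range_exp, Set.inter_eq_left]
    exact fun x hx => hX.trans hx.1
  rw [← himg, lintegral_image_eq_lintegral_abs_deriv_mul hSm
    (fun x _ => (Real.hasDerivAt_exp x).hasDerivWithinAt) Real.exp_injective.injOn,
    ← lintegral_const_mul' _ _ ENNReal.ofReal_ne_top]
  refine (setLIntegral_mono' hSm fun u hu => ?_).trans (setLIntegral_le_lintegral S _)
  have he := Real.exp_pos u
  rw [abs_of_pos he, expIncr, ← Real.exp_add, ← ofReal_norm, ← ofReal_norm,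
    ← ENNReal.ofReal_pow (norm_nonneg _), ← ENNReal.ofReal_pow (norm_nonneg _),
    ← ENNReal.ofReal_mul he.le, ← ENNReal.ofReal_mul (by positivity), Complex.norm_real,
    Real.norm_eq_abs, Real.norm_eq_abs, sq_abs, sq_abs, mul_pow]
  refine ENNReal.ofReal_le_ofReal ?_
  have h1 : Real.exp u ≤ 9 * X ^ 2 * Real.exp (-(u / 2)) ^ 2 := by
    have h2 : Real.exp (-(u / 2)) ^ 2 * Real.exp u = 1 := by
      rw [← Real.exp_nat_mul, ← Real.exp_add, Real.exp_eq_one_iff]; push_cast; ring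
    have h3 : Real.exp u ^ 2 ≤ (3 * X) ^ 2 := pow_le_pow_left₀ he.le hu.2 2
    nlinarith [sq_nonneg (Real.exp (-(u / 2)))]
  nlinarith [mul_le_mul_of_nonneg_right h1
    (sq_nonneg (fractSum D a (Real.exp (u + θ)) - fractSum D a (Real.exp u)))]

/-- The Saffari–Vaughan device: additive increments are controlled by an average of
multiplicative increments. -/
lemma setLIntegral_add_sub_sq_le {Φ : ℝ → ℝ} (hΦ : Measurable Φ) {X H : ℝ} (hX : 0 < X) (hH : 0 < H)
    {B : ENNReal}
    (hB : ∀ θ ∈ Set.Ioc (2 * H / X) (8 * H / X),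
      ∫⁻ x in Set.Ioc X (3 * X), ‖Φ (x * Real.exp θ) - Φ x‖ₑ ^ 2 ≤ B) (hHX : H ≤ X) :
    ∫⁻ x in Set.Ioc X (2 * X), ‖Φ (x + H) - Φ x‖ₑ ^ 2 ≤ 5 * B := by
  set A : ℝ := 4 * H / X with hA
  have hA0 : 0 < A := by positivity
  have hA1 : 2 * H / X = A / 2 := by rw [hA]; ring
  have hA2 : 8 * H / X = 2 * A := by rw [hA]; ring
  rw [hA1, hA2] at hB
  set Δ : ℝ → ℝ → ENNReal := fun x θ => ‖Φ (x * Real.exp θ) - Φ x‖ₑ ^ 2 with hΔ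
  have hΔm : Measurable (Function.uncurry Δ) := by
    rw [hΔ]
    exact (((hΦ.comp (measurable_fst.mul (Real.measurable_exp.comp measurable_snd))).sub
      (hΦ.comp measurable_fst)).enorm).pow_const 2
  replace hB : ∀ θ ∈ Set.Ioc (A / 2) (2 * A), ∫⁻ x in Set.Ioc X (3 * X), Δ x θ ≤ B := hB
  clear_value Δ
  set I : Set ℝ := Set.Ioc X (2 * X) with hI
  set J : Set ℝ := Set.Ioc A (2 * A) with hJ
  set J' : Set ℝ := Set.Ioc (A / 2) (2 * A) with hJ'
  have hpt : ∀ x ∈ I, ∀ θ, ‖Φ (x + H) - Φ x‖ₑ ^ 2 ≤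
      2 * Δ x θ + 2 * Δ (x + H) (θ + -Real.log (1 + H / x)) := fun x hx θ => by
    have hx0 : 0 < x := hX.trans hx.1
    have h1 : (x + H) * Real.exp (θ + -Real.log (1 + H / x)) = x * Real.exp θ := by
      rw [Real.exp_add, Real.exp_neg, Real.exp_log (by positivity)]
      field_simp
    have h2 : Φ (x + H) - Φ x = (Φ (x * Real.exp θ) - Φ x) + -(Φ (x * Real.exp θ) - Φ (x + H)) := by ring
    rw [h2]
    refine (enorm_add_sq_le _ _).trans_eq ?_
    simp only [hΔ, h1, enorm_neg]
  have hvol : ∀ p q : ℝ, volume (Set.Ioc p q) = ENNReal.ofReal (q - p) := fun p q => Real.volume_Ioc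
  have hfirst : ∫⁻ x in I, ∫⁻ θ in J, Δ x θ ≤ ENNReal.ofReal A * B := by
    rw [lintegral_lintegral_swap hΔm.aemeasurable]
    calc ∫⁻ θ in J, ∫⁻ x in I, Δ x θ ≤ ∫⁻ θ in J, B := by
          refine setLIntegral_mono' measurableSet_Ioc fun θ hθ => ?_
          exact (lintegral_mono_set (Set.Ioc_subset_Ioc_right (by linarith))).trans
            (hB θ ⟨by linarith [hθ.1], hθ.2⟩)
      _ = _ := by
          rw [setLIntegral_const, hJ, hvol, mul_comm]; congr 2; ring
  have hsecond : ∫⁻ x in I, ∫⁻ θ in J, Δ (x + H) (θ + -Real.log (1 + H / x)) ≤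
      ENNReal.ofReal (3 / 2 * A) * B := by
    have hm2 : Measurable (Function.uncurry fun x θ => Δ (x + H) θ) :=
      hΔm.comp ((measurable_fst.add_const H).prodMk measurable_snd)
    calc ∫⁻ x in I, ∫⁻ θ in J, Δ (x + H) (θ + -Real.log (1 + H / x))
        ≤ ∫⁻ x in I, ∫⁻ θ in J', Δ (x + H) θ := by
          refine setLIntegral_mono' measurableSet_Ioc fun x hx => ?_
          refine setLIntegral_comp_add_le measurableSet_Ioc measurableSet_Ioc _ (fun θ hθ => ?_) _
          have hx0 : 0 < x := hX.trans hx.1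
          have h1 : Real.log (1 + H / x) ≤ H / x := by
            have := Real.log_le_sub_one_of_pos (show 0 < 1 + H / x by positivity)
            linarith
          have h2 : H / x ≤ H / X := by gcongr; exact hx.1.le
          have h3 : H / X = A / 4 := by rw [hA]; ring
          have h4 : 0 ≤ Real.log (1 + H / x) := Real.log_nonneg (by linarith [div_pos hH hx0])
          exact ⟨by linarith [hθ.1], by linarith [hθ.2]⟩
      _ = ∫⁻ θ in J', ∫⁻ x in I, Δ (x + H) θ := lintegral_lintegral_swap hm2.aemeasurable
      _ ≤ ∫⁻ θ in J', B := by
          refine setLIntegral_mono' measurableSet_Ioc fun θ hθ => ?_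
          exact (setLIntegral_comp_add_le measurableSet_Ioc measurableSet_Ioc H
            (fun x hx => ⟨by linarith [hx.1], by linarith [hx.2]⟩) (fun x => Δ x θ)).trans (hB θ hθ)
      _ = _ := by
          rw [setLIntegral_const, hJ', hvol, mul_comm]; congr 2; ring
  have hmain : ENNReal.ofReal A * ∫⁻ x in I, ‖Φ (x + H) - Φ x‖ₑ ^ 2 ≤ ENNReal.ofReal A * (5 * B) := by
    have hm1 : Measurable fun x => ∫⁻ θ in J, Δ x θ := hΔm.lintegral_prod_right
    calc ENNReal.ofReal A * ∫⁻ x in I, ‖Φ (x + H) - Φ x‖ₑ ^ 2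
        = ∫⁻ x in I, ∫⁻ θ in J, ‖Φ (x + H) - Φ x‖ₑ ^ 2 := by
          rw [← lintegral_const_mul' _ _ ENNReal.ofReal_ne_top]
          refine lintegral_congr fun x => ?_
          rw [setLIntegral_const, hJ, hvol, mul_comm]; congr 2; ring
      _ ≤ ∫⁻ x in I, ((2 * ∫⁻ θ in J, Δ x θ) +
            2 * ∫⁻ θ in J, Δ (x + H) (θ + -Real.log (1 + H / x))) := by
          refine setLIntegral_mono' measurableSet_Ioc fun x hx => ?_
          refine (lintegral_mono fun θ => hpt x hx θ).trans_eq ?_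
          rw [lintegral_add_left, lintegral_const_mul' _ _ (by norm_num),
            lintegral_const_mul' _ _ (by norm_num)]
          exact (hΔm.comp (measurable_const.prodMk measurable_id)).const_mul 2
      _ = 2 * (∫⁻ x in I, ∫⁻ θ in J, Δ x θ) +
            2 * ∫⁻ x in I, ∫⁻ θ in J, Δ (x + H) (θ + -Real.log (1 + H / x)) := by
          rw [lintegral_add_left (hm1.const_mul 2), lintegral_const_mul' _ _ (by norm_num),
            lintegral_const_mul' _ _ (by norm_num)]
      _ ≤ 2 * (ENNReal.ofReal A * B) + 2 * (ENNReal.ofReal (3 / 2 * A) * B) := by gcongr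
      _ = ENNReal.ofReal A * (5 * B) := by
          have h3 : (2:ENNReal) * ENNReal.ofReal (3 / 2 * A) = 3 * ENNReal.ofReal A := by
            have e2 : (2 : ENNReal) = ENNReal.ofReal 2 := by simp
            have e3 : (3 : ENNReal) = ENNReal.ofReal 3 := by simp
            rw [e2, e3, ← ENNReal.ofReal_mul (by norm_num), ← ENNReal.ofReal_mul (by norm_num)]
            congr 1; ring
          rw [← mul_assoc 2 (ENNReal.ofReal (3 / 2 * A)), h3]; ring
  exact (ENNReal.mul_le_mul_iff_right (by simpa using hA0) ENNReal.ofReal_ne_top).1 hmain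

lemma exists_setLIntegral_fractSum_sq_le {η : ℝ} (hη : 0 < η) (hη1 : η ≤ 1 / 3) :
    ∃ K : ℝ, 1 ≤ K ∧ ∀ X H : ℝ, 1 ≤ H → H ≤ X → ∀ D : ℕ, 1 ≤ D → ∀ a : ℕ → ℝ, (∀ d, |a d| ≤ 1) →
      ∫⁻ x in Set.Ioc X (2 * X), ‖fractSum D a (x + H) - fractSum D a x‖ₑ ^ 2 ≤
        ENNReal.ofReal (K * X * X ^ (2 * η) *
          (H * (D:ℝ) ^ (-(3 / 4) : ℝ) + H ^ (5 / 3 : ℝ) * X ^ (-(2 / 3) : ℝ))) := by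
  obtain ⟨K, hK, hKb⟩ := exists_lintegral_expIncr_sq_le hη hη1
  refine ⟨45 * (32 * K), by linarith, fun X H hH hHX D hD a ha => ?_⟩
  have hH0 : 0 < H := by linarith
  have hX0 : 0 < X := by linarith
  set q : ℝ := H / X with hq
  have hq0 : 0 < q := by positivity
  have hq1 : q ≤ 1 := (div_le_one hX0).2 hHX
  have hqX : q ^ (-(2 * η)) ≤ X ^ (2 * η) := by
    rw [Real.rpow_neg hq0.le, ← Real.inv_rpow hq0.le, hq, inv_div]
    gcongr
    exact div_le_self hX0.le hH
  have hDp : 0 ≤ (D:ℝ) ^ (-(3 / 4) : ℝ) := by positivity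
  have h8 : ∀ p : ℝ, 0 ≤ p → p ≤ 5 / 3 → (8 * q) ^ (p - 2 * η) ≤ 32 * q ^ p * X ^ (2 * η) := by
    intro p hp0 hp
    have h1 : (8 * q) ^ (p - 2 * η) = 8 ^ (p - 2 * η) * (q ^ p * q ^ (-(2 * η))) := by
      rw [Real.mul_rpow (by norm_num) hq0.le, ← Real.rpow_add hq0, sub_eq_add_neg]
    have h2 : (8:ℝ) ^ (p - 2 * η) ≤ 32 := by
      calc (8:ℝ) ^ (p - 2 * η) ≤ 8 ^ (5 / 3 : ℝ) :=
            Real.rpow_le_rpow_of_exponent_le (by norm_num) (by linarith)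
        _ = 32 := by
            rw [show (8:ℝ) = 2 ^ (3:ℝ) by norm_num, ← Real.rpow_mul (by norm_num)]; norm_num
    rw [h1]
    calc _ ≤ 32 * (q ^ p * X ^ (2 * η)) := by gcongr
      _ = _ := by ring
  set B : ℝ := 9 * X ^ 2 * (K * (32 * q ^ (1:ℝ) * X ^ (2 * η) * (D:ℝ) ^ (-(3 / 4) : ℝ)
    + 32 * q ^ (5 / 3 : ℝ) * X ^ (2 * η))) with hB
  have h := setLIntegral_add_sub_sq_le (measurable_fractSum D a) hX0 hH0 (B := ENNReal.ofReal B)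
    (fun θ hθ => by
      have hθ0 : 0 < θ := lt_of_le_of_lt (by positivity) hθ.1
      have hθq : θ ≤ 8 * q := by rw [hq, ← mul_div_assoc]; exact hθ.2
      refine (setLIntegral_fractSum_exp_le hX0 D a θ).trans ?_
      rw [hB, ENNReal.ofReal_mul (p := 9 * X ^ 2) (by positivity)]
      refine mul_le_mul' le_rfl ((hKb θ hθ0 (by linarith) D hD a ha).trans
        (ENNReal.ofReal_le_ofReal ?_))
      gcongr
      · exact (Real.rpow_le_rpow hθ0.le hθq (by linarith)).trans (h8 1 zero_le_one (by norm_num))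
      · exact (Real.rpow_le_rpow hθ0.le hθq (by linarith)).trans (h8 _ (by norm_num) le_rfl)) hHX
  refine h.trans ?_
  rw [show (5 : ENNReal) = ENNReal.ofReal 5 by simp, ← ENNReal.ofReal_mul (by norm_num)]
  refine ENNReal.ofReal_le_ofReal (le_of_eq ?_)
  have e1 : X ^ 2 * q ^ (1:ℝ) = X * H := by rw [Real.rpow_one, hq]; field_simp
  have e2 : X ^ 2 * q ^ (5 / 3 : ℝ) = X * (H ^ (5 / 3 : ℝ) * X ^ (-(2 / 3) : ℝ)) := by
    rw [hq, Real.div_rpow hH0.le hX0.le, div_eq_mul_inv, ← Real.rpow_neg hX0.le,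
      ← Real.rpow_natCast]
    have : X ^ ((2:ℕ):ℝ) * X ^ (-(5 / 3) : ℝ) = X ^ (1:ℝ) * X ^ (-(2 / 3) : ℝ) := by
      rw [← Real.rpow_add hX0, ← Real.rpow_add hX0]; norm_num
    rw [Real.rpow_one] at this
    calc _ = H ^ (5 / 3 : ℝ) * (X ^ ((2:ℕ):ℝ) * X ^ (-(5 / 3) : ℝ)) := by ring
      _ = _ := by rw [this]; ring
  calc 5 * B = 45 * (32 * K) * X ^ (2 * η) * ((X ^ 2 * q ^ (1:ℝ)) * (D:ℝ) ^ (-(3 / 4) : ℝ)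
        + X ^ 2 * q ^ (5 / 3 : ℝ)) := by rw [hB]; ring
    _ = _ := by rw [e1, e2]; ring

/-- The Möbius function restricted to `z < d²` and `d ≤ N`. -/
noncomputable def truncMoebius (z : ℝ) (N d : ℕ) : ℝ :=
  if z < (d:ℝ) ^ 2 ∧ d ≤ N then (ArithmeticFunction.moebius d : ℝ) else 0

lemma abs_moebius_le_one (d : ℕ) : |(ArithmeticFunction.moebius d : ℝ)| ≤ 1 := by
  exact_mod_cast ArithmeticFunction.abs_moebius_le_one

lemma abs_truncMoebius_le_one (z : ℝ) (N d : ℕ) : |truncMoebius z N d| ≤ 1 := by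
  rw [truncMoebius]
  split_ifs
  · exact abs_moebius_le_one d
  · simp

lemma sum_dyadic_blocks (f : ℕ → ℝ) (D J : ℕ) :
    ∑ j ∈ Finset.range J, ∑ d ∈ Finset.Ioc (2 ^ j * D) (2 * (2 ^ j * D)), f d =
      ∑ d ∈ Finset.Ioc D (2 ^ J * D), f d := by
  induction J with
  | zero => simp
  | succ J ih =>
    rw [Finset.sum_range_succ, ih, ← mul_assoc 2, ← pow_succ']
    exact Finset.sum_Ioc_consecutive f (Nat.le_mul_of_pos_left D (by positivity))
      (Nat.mul_le_mul_right D (Nat.pow_le_pow_right (by norm_num) (Nat.le_succ J)))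

lemma sum_truncMoebius_eq {z : ℝ} (hz : 1 ≤ z) {N J : ℕ} (hJ : N ≤ 2 ^ J) (g : ℕ → ℝ) :
    ∑ d ∈ Finset.Ioc ⌊√z⌋₊ (2 ^ J * ⌊√z⌋₊), truncMoebius z N d * g d =
      ∑ d ∈ (Finset.Icc 1 N).filter (fun d : ℕ => z < (d:ℝ) ^ 2),
        (ArithmeticFunction.moebius d : ℝ) * g d := by
  have hs : 1 ≤ ⌊√z⌋₊ := by
    rw [Nat.one_le_floor_iff]; exact Real.one_le_sqrt.2 hz
  rw [Finset.sum_filter]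
  have hsub : ∀ d : ℕ, z < (d:ℝ) ^ 2 → ⌊√z⌋₊ < d := fun d hd => by
    rw [Nat.floor_lt (Real.sqrt_nonneg z), Real.sqrt_lt' (by
      rcases Nat.eq_zero_or_pos d with h | h
      · rw [h] at hd; norm_num at hd; linarith
      · exact_mod_cast h)]
    exact hd
  have h1 : ∀ d, truncMoebius z N d * g d =
      if z < (d:ℝ) ^ 2 ∧ d ≤ N then (ArithmeticFunction.moebius d : ℝ) * g d else 0 := fun d => by
    rw [truncMoebius, ite_mul, zero_mul]
  simp only [h1]
  rw [← Finset.sum_filter, ← Finset.sum_filter]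
  refine Finset.sum_congr ?_ fun _ _ => rfl
  ext d
  simp only [Finset.mem_filter, Finset.mem_Ioc, Finset.mem_Icc]
  constructor
  · rintro ⟨⟨h, _⟩, h2, h3⟩
    exact ⟨⟨by omega, h3⟩, h2⟩
  · rintro ⟨⟨h, h2⟩, h3⟩
    exact ⟨⟨hsub d h3, h2.trans (hJ.trans (Nat.le_mul_of_pos_right _ hs))⟩, h3, h2⟩

lemma card_floor_eq {x H : ℝ} (hx : 0 ≤ x) (hH : 0 ≤ H) {d : ℕ} :
    ((Finset.Ioc ⌊x / (d:ℝ) ^ 2⌋₊ ⌊(x + H) / (d:ℝ) ^ 2⌋₊).card : ℝ) =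
      H / (d:ℝ) ^ 2 - (Int.fract ((x + H) / (d:ℝ) ^ 2) - Int.fract (x / (d:ℝ) ^ 2)) := by
  have hle : ⌊x / (d:ℝ) ^ 2⌋₊ ≤ ⌊(x + H) / (d:ℝ) ^ 2⌋₊ := Nat.floor_mono (by gcongr; linarith)
  rw [Nat.card_Ioc, Nat.cast_sub hle, natCast_floor_eq_intCast_floor (by positivity),
    natCast_floor_eq_intCast_floor (by positivity), Int.fract, Int.fract, add_div]
  ring

lemma pairShortGT_eq {x H z : ℝ} (hx : 0 ≤ x) (hH : 0 ≤ H) {N : ℕ} (hN : ⌊√(x + H)⌋₊ ≤ N) :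
    pairShortGT x H z = ∑ d ∈ (Finset.Icc 1 N).filter (fun d : ℕ => z < (d:ℝ) ^ 2),
      (ArithmeticFunction.moebius d : ℝ) * (H / (d:ℝ) ^ 2
        - (Int.fract ((x + H) / (d:ℝ) ^ 2) - Int.fract (x / (d:ℝ) ^ 2))) := by
  rw [pairShortGT]
  have h1 : ∀ d : ℕ, ∑ _n ∈ Finset.Ioc ⌊x / (d : ℝ) ^ 2⌋₊ ⌊(x + H) / (d : ℝ) ^ 2⌋₊,
      (ArithmeticFunction.moebius d : ℝ) = (ArithmeticFunction.moebius d : ℝ) * (H / (d:ℝ) ^ 2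
        - (Int.fract ((x + H) / (d:ℝ) ^ 2) - Int.fract (x / (d:ℝ) ^ 2))) := fun d => by
    rw [Finset.sum_const, nsmul_eq_mul, card_floor_eq hx hH, mul_comm]
  rw [← Finset.sum_congr rfl fun d _ => h1 d]
  refine Finset.sum_subset (Finset.filter_subset_filter _ (Finset.Icc_subset_Icc_right hN))
    fun d hd hd2 => ?_
  simp only [Finset.mem_filter, Finset.mem_Icc, not_and_or] at hd hd2
  have h2 : ⌊√(x + H)⌋₊ < d := by
    rcases hd2 with (h | h) | h
    · exact absurd hd.1.1 h
    · omega
    · exact absurd hd.2 h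
  rw [Nat.floor_lt (Real.sqrt_nonneg _)] at h2
  have hd0 : (0:ℝ) < d := (Real.sqrt_nonneg _).trans_lt h2
  rw [Real.sqrt_lt' hd0] at h2
  have h3 : ⌊(x + H) / (d:ℝ) ^ 2⌋₊ = 0 := by
    rw [Nat.floor_eq_zero, div_lt_one (by positivity)]; exact h2
  rw [h3, Finset.Ioc_eq_empty (by omega), Finset.sum_empty]

lemma abs_sum_sub_mertensRange_le {X H z : ℝ} (hX : 1 ≤ X) (hH : 0 ≤ H) (hHX : H ≤ X) :
    |H * (∑ d ∈ (Finset.Icc 1 ⌊√(2 * X + H)⌋₊).filter (fun d : ℕ => z < (d:ℝ) ^ 2),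
      (ArithmeticFunction.moebius d : ℝ) / (d:ℝ) ^ 2) - H * mertensRange z (2 * X)| ≤ H / √X := by
  have hX0 : 0 < X := by linarith
  set N := ⌊√(2 * X + H)⌋₊ with hN
  set N₂ := ⌊√(2 * X)⌋₊ with hN₂
  have hNN : N₂ ≤ N := Nat.floor_mono (Real.sqrt_le_sqrt (by linarith))
  have hsub : (Finset.Icc 1 N₂).filter (fun d : ℕ => z < (d:ℝ) ^ 2) ⊆
      (Finset.Icc 1 N).filter (fun d : ℕ => z < (d:ℝ) ^ 2) :=
    Finset.filter_subset_filter _ (Finset.Icc_subset_Icc_right hNN)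
  rw [← mul_sub, mertensRange, ← Finset.sum_sdiff hsub, add_sub_cancel_right, abs_mul,
    abs_of_nonneg hH, div_eq_mul_inv]
  gcongr
  have hterm : ∀ d ∈ (Finset.Icc 1 N).filter (fun d : ℕ => z < (d:ℝ) ^ 2) \
      (Finset.Icc 1 N₂).filter (fun d : ℕ => z < (d:ℝ) ^ 2),
      |(ArithmeticFunction.moebius d : ℝ) / (d:ℝ) ^ 2| ≤ 1 / (2 * X) := fun d hd => by
    simp only [Finset.mem_sdiff, Finset.mem_filter, Finset.mem_Icc, not_and_or] at hd
    have h2 : N₂ < d := by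
      rcases hd.2 with (h | h) | h
      · exact absurd hd.1.1.1 h
      · omega
      · exact absurd hd.1.2 h
    rw [hN₂, Nat.floor_lt (Real.sqrt_nonneg _)] at h2
    have hd0 : (0:ℝ) < d := (Real.sqrt_nonneg _).trans_lt h2
    rw [Real.sqrt_lt' hd0] at h2
    rw [abs_div, abs_of_nonneg (sq_nonneg (d:ℝ))]
    exact div_le_div₀ zero_le_one (abs_moebius_le_one d) (by positivity) h2.le
  refine (Finset.abs_sum_le_sum_abs _ _).trans ((Finset.sum_le_sum hterm).trans ?_)
  rw [Finset.sum_const, nsmul_eq_mul]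
  have hcard : ((((Finset.Icc 1 N).filter (fun d : ℕ => z < (d:ℝ) ^ 2) \
      (Finset.Icc 1 N₂).filter (fun d : ℕ => z < (d:ℝ) ^ 2)).card : ℕ) : ℝ) ≤ 2 * √X := by
    have h1 : ((Finset.Icc 1 N).filter (fun d : ℕ => z < (d:ℝ) ^ 2) \
      (Finset.Icc 1 N₂).filter (fun d : ℕ => z < (d:ℝ) ^ 2)).card ≤ N :=
      (Finset.card_le_card (Finset.sdiff_subset.trans (Finset.filter_subset _ _))).trans (by simp)
    calc _ ≤ (N:ℝ) := by exact_mod_cast h1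
      _ ≤ √(2 * X + H) := Nat.floor_le (Real.sqrt_nonneg _)
      _ ≤ √(2 ^ 2 * X) := Real.sqrt_le_sqrt (by linarith)
      _ = 2 * √X := by rw [Real.sqrt_mul (by norm_num), Real.sqrt_sq (by norm_num)]
  calc _ ≤ 2 * √X * (1 / (2 * X)) := by gcongr
    _ = (√X)⁻¹ := by
        have := Real.mul_self_sqrt hX0.le
        have h2 := Real.sqrt_pos.2 hX0
        field_simp
        linarith

lemma abs_pairShortGT_sub_sq_le {X H z : ℝ} (hX : 1 ≤ X) (hH : 0 ≤ H) (hHX : H ≤ X) (hz : 1 ≤ z)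
    {J : ℕ} (hJ : ⌊√(2 * X + H)⌋₊ ≤ 2 ^ J) {x : ℝ} (hx : x ∈ Set.Ioc X (2 * X)) :
    |pairShortGT x H z - H * mertensRange z (2 * X)| ^ 2 ≤
      2 * J * ∑ j ∈ Finset.range J,
        (fractSum (2 ^ j * ⌊√z⌋₊) (truncMoebius z ⌊√(2 * X + H)⌋₊) (x + H) -
          fractSum (2 ^ j * ⌊√z⌋₊) (truncMoebius z ⌊√(2 * X + H)⌋₊) x) ^ 2 + 2 * (H ^ 2 / X) := by
  have hX0 : 0 < X := by linarith
  have hx0 : 0 < x := hX0.trans hx.1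
  set N := ⌊√(2 * X + H)⌋₊ with hN
  set a := truncMoebius z N with ha
  set E : ℕ → ℝ := fun j => fractSum (2 ^ j * ⌊√z⌋₊) a (x + H) - fractSum (2 ^ j * ⌊√z⌋₊) a x with hE
  have hsum : ∑ j ∈ Finset.range J, E j =
      ∑ d ∈ (Finset.Icc 1 N).filter (fun d : ℕ => z < (d:ℝ) ^ 2), (ArithmeticFunction.moebius d : ℝ) *
        (Int.fract ((x + H) / (d:ℝ) ^ 2) - Int.fract (x / (d:ℝ) ^ 2)) := by
    rw [← sum_truncMoebius_eq hz hJ, ← sum_dyadic_blocks]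
    refine Finset.sum_congr rfl fun j _ => ?_
    simp only [hE, fractSum]
    rw [← Finset.sum_sub_distrib]
    exact Finset.sum_congr rfl fun d _ => by ring
  have hpair := pairShortGT_eq (z := z) hx0.le hH (N := N)
    (Nat.floor_mono (Real.sqrt_le_sqrt (by linarith [hx.2])))
  have herr := abs_sum_sub_mertensRange_le (z := z) hX hH hHX
  rw [← hN] at herr
  set M := H * (∑ d ∈ (Finset.Icc 1 N).filter (fun d : ℕ => z < (d:ℝ) ^ 2),
      (ArithmeticFunction.moebius d : ℝ) / (d:ℝ) ^ 2) with hM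
  have hdecomp : pairShortGT x H z - H * mertensRange z (2 * X) =
      (M - H * mertensRange z (2 * X)) - ∑ j ∈ Finset.range J, E j := by
    rw [hpair, hsum, hM, Finset.mul_sum, sub_right_comm, ← Finset.sum_sub_distrib]
    congr 1
    exact Finset.sum_congr rfl fun d _ => by ring
  have hcs : (∑ j ∈ Finset.range J, E j) ^ 2 ≤ J * ∑ j ∈ Finset.range J, E j ^ 2 := by
    simpa using sq_sum_le_card_mul_sum_sq (s := Finset.range J) (f := E)
  have herr2 : (M - H * mertensRange z (2 * X)) ^ 2 ≤ H ^ 2 / X := by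
    rw [← sq_abs]
    calc _ ≤ (H / √X) ^ 2 := pow_le_pow_left₀ (abs_nonneg _) herr 2
      _ = H ^ 2 / X := by rw [div_pow, Real.sq_sqrt hX0.le]
  rw [sq_abs, hdecomp]
  nlinarith [sq_nonneg ((M - H * mertensRange z (2 * X)) + ∑ j ∈ Finset.range J, E j)]

lemma setIntegral_sq_le_of_setLIntegral_le {f : ℝ → ℝ} (hf : Measurable f) {S : Set ℝ} {B : ℝ}
    (hB : 0 ≤ B) (h : ∫⁻ x in S, ‖f x‖ₑ ^ 2 ≤ ENNReal.ofReal B) :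
    IntegrableOn (fun x => f x ^ 2) S ∧ ∫ x in S, f x ^ 2 ≤ B := by
  have he : ∀ x, ENNReal.ofReal (f x ^ 2) = ‖f x‖ₑ ^ 2 := fun r => by
    rw [← ofReal_norm, ← ENNReal.ofReal_pow (norm_nonneg _), Real.norm_eq_abs, sq_abs]
  have hm : Measurable fun x => f x ^ 2 := hf.pow_const 2
  constructor
  · refine ⟨hm.aestronglyMeasurable, ?_⟩
    rw [hasFiniteIntegral_iff_ofReal (ae_of_all _ fun x => sq_nonneg _)]
    simp only [he]
    exact h.trans_lt ENNReal.ofReal_lt_top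
  · rw [integral_eq_lintegral_of_nonneg_ae (ae_of_all _ fun x => sq_nonneg _) hm.aestronglyMeasurable]
    simp only [he]
    exact ENNReal.toReal_le_of_le_ofReal hB h

lemma exists_variance_le {η : ℝ} (hη : 0 < η) (hη1 : η ≤ 1 / 3) :
    ∃ K : ℝ, 1 ≤ K ∧ ∀ X H z : ℝ, 1 ≤ X → 1 ≤ H → H ≤ X → 1 ≤ z →
      (1 / X) * (∫ x in X..(2 * X), |pairShortGT x H z - H * mertensRange z (2 * X)| ^ 2) ≤
        K * X ^ (3 * η) * (H * z ^ (-(3 / 8) : ℝ) + H ^ (5 / 3 : ℝ) * X ^ (-(2 / 3) : ℝ))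
          + 2 * (H ^ 2 / X) := by
  obtain ⟨K, hK, hKb⟩ := exists_setLIntegral_fractSum_sq_le hη hη1
  set L : ℝ := 1 + 2 / η with hL
  have hL1 : 1 ≤ L := by rw [hL]; linarith [div_pos two_pos hη]
  have hL2 : 1 ≤ L ^ 2 := one_le_pow₀ hL1
  refine ⟨48 * (L ^ 2 * K), by nlinarith, fun X H z hX hH hHX hz => ?_⟩
  have hX0 : 0 < X := by linarith
  set N := ⌊√(2 * X + H)⌋₊ with hN
  set J := Nat.log 2 N + 1 with hJ
  have hJN : N ≤ 2 ^ J := (Nat.lt_pow_succ_log_self one_lt_two N).le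
  set D := ⌊√z⌋₊ with hD
  have hsz : 1 ≤ √z := Real.one_le_sqrt.2 hz
  have hD1 : 1 ≤ D := by rw [hD, Nat.one_le_floor_iff]; exact hsz
  have hDz : √z / 2 ≤ D := by
    have h1 := Nat.lt_floor_add_one (√z)
    have h2 : (1:ℝ) ≤ D := by exact_mod_cast hD1
    rw [← hD] at h1
    linarith
  have hJ2 : (J:ℝ) ^ 2 ≤ 12 * L ^ 2 * X ^ η := by
    have hN1 : 1 ≤ N := by
      rw [hN, Nat.one_le_floor_iff]; exact Real.one_le_sqrt.2 (by linarith)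
    have h1 : (2:ℝ) ^ Nat.log 2 N ≤ 3 * X := by
      have h2 : ((2 ^ Nat.log 2 N : ℕ) : ℝ) ≤ N := by exact_mod_cast Nat.pow_log_le_self 2 (by omega)
      calc (2:ℝ) ^ Nat.log 2 N ≤ N := by exact_mod_cast h2
        _ ≤ √(2 * X + H) := Nat.floor_le (Real.sqrt_nonneg _)
        _ ≤ 2 * X + H := Real.sqrt_le_iff.2 ⟨by linarith, by nlinarith⟩
        _ ≤ 3 * X := by linarith
    have h3 : (Nat.log 2 N : ℝ) * Real.log 2 ≤ Real.log (3 * X) := by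
      rw [← Real.log_pow]; exact Real.log_le_log (by positivity) h1
    have h4 : (J:ℝ) ≤ 2 * (1 + Real.log (3 * X)) := by
      have h5 : (J:ℝ) = Nat.log 2 N + 1 := by rw [hJ]; push_cast; ring
      have h6 : (0:ℝ) ≤ Nat.log 2 N := Nat.cast_nonneg _
      nlinarith [Real.log_two_gt_d9]
    calc (J:ℝ) ^ 2 ≤ (2 * (1 + Real.log (3 * X))) ^ 2 := by gcongr
      _ = 4 * (1 + Real.log (3 * X)) ^ 2 := by ring
      _ ≤ 4 * (L ^ 2 * (3 * X) ^ η) := by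
          gcongr; exact one_add_log_sq_le hη (by linarith)
      _ = 4 * L ^ 2 * X ^ η * 3 ^ η := by rw [Real.mul_rpow (by norm_num) hX0.le]; ring
      _ ≤ 4 * L ^ 2 * X ^ η * 3 := by
          gcongr
          calc (3:ℝ) ^ η ≤ 3 ^ (1:ℝ) := Real.rpow_le_rpow_of_exponent_le (by norm_num) (by linarith)
            _ = 3 := Real.rpow_one 3
      _ = _ := by ring
  set a := truncMoebius z N with ha
  set B : ℝ := H * z ^ (-(3 / 8) : ℝ) + H ^ (5 / 3 : ℝ) * X ^ (-(2 / 3) : ℝ) with hB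
  have hB0 : 0 ≤ B := by positivity
  set V : ℝ := K * X * X ^ (2 * η) * (2 * B) with hV
  have hV0 : 0 ≤ V := by positivity
  have hDpow : ∀ j : ℕ, ((2 ^ j * D : ℕ) : ℝ) ^ (-(3 / 4) : ℝ) ≤ 2 * z ^ (-(3 / 8) : ℝ) := fun j => by
    have h1 : √z / 2 ≤ ((2 ^ j * D : ℕ) : ℝ) := by
      refine hDz.trans ?_
      exact_mod_cast Nat.le_mul_of_pos_left D (by positivity)
    calc ((2 ^ j * D : ℕ) : ℝ) ^ (-(3 / 4) : ℝ) ≤ (√z / 2) ^ (-(3 / 4) : ℝ) :=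
          Real.rpow_le_rpow_of_nonpos (by linarith) h1 (by norm_num)
      _ = 2 ^ (3 / 4 : ℝ) * z ^ (-(3 / 8) : ℝ) := by
          rw [Real.div_rpow (Real.sqrt_nonneg z) (by norm_num), Real.sqrt_eq_rpow,
            ← Real.rpow_mul (by linarith), Real.rpow_neg zero_le_two, div_inv_eq_mul, mul_comm]
          norm_num
      _ ≤ 2 ^ (1:ℝ) * z ^ (-(3 / 8) : ℝ) := by
          gcongr
          · norm_num
          · norm_num
      _ = _ := by rw [Real.rpow_one]
  set f : ℕ → ℝ → ℝ := fun j x => fractSum (2 ^ j * D) a (x + H) - fractSum (2 ^ j * D) a x with hf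
  have hblock : ∀ j : ℕ, IntegrableOn (fun x => f j x ^ 2) (Set.Ioc X (2 * X)) ∧
      ∫ x in Set.Ioc X (2 * X), f j x ^ 2 ≤ V := fun j => by
    refine setIntegral_sq_le_of_setLIntegral_le
      (((measurable_fractSum _ _).comp (measurable_id.add_const H)).sub (measurable_fractSum _ _)) hV0 ?_
    refine (hKb X H hH hHX (2 ^ j * D) (one_le_mul (Nat.one_le_two_pow) hD1) a
      (abs_truncMoebius_le_one z N)).trans (ENNReal.ofReal_le_ofReal ?_)
    rw [hV]
    gcongr
    rw [hB, mul_add]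
    have h2 : 0 ≤ H ^ (5 / 3 : ℝ) * X ^ (-(2 / 3) : ℝ) := by positivity
    have h3 := mul_le_mul_of_nonneg_left (hDpow j) (show 0 ≤ H by linarith)
    linarith
  have hgi : IntegrableOn (fun x => 2 * (J:ℝ) * ∑ j ∈ Finset.range J, f j x ^ 2) (Set.Ioc X (2 * X)) :=
    (integrable_finsetSum _ fun j _ => (hblock j).1).const_mul _
  have hci : IntegrableOn (fun _ : ℝ => 2 * (H ^ 2 / X)) (Set.Ioc X (2 * X)) :=
    continuous_const.integrableOn_Ioc
  have hint : ∫ x in X..(2 * X), |pairShortGT x H z - H * mertensRange z (2 * X)| ^ 2 ≤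
      2 * J * (J * V) + 2 * (H ^ 2 / X) * X := by
    rw [intervalIntegral.integral_of_le (by linarith)]
    calc _ ≤ ∫ x in Set.Ioc X (2 * X),
          (2 * (J:ℝ) * ∑ j ∈ Finset.range J, f j x ^ 2 + 2 * (H ^ 2 / X)) := by
          refine integral_mono_of_nonneg (ae_of_all _ fun x => by positivity) (hgi.add hci) ?_
          refine (ae_restrict_iff' measurableSet_Ioc).2 (ae_of_all _ fun x hx => ?_)
          exact abs_pairShortGT_sub_sq_le hX (by linarith) hHX hz hJN hx
      _ = 2 * J * ∑ j ∈ Finset.range J, (∫ x in Set.Ioc X (2 * X), f j x ^ 2)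
          + 2 * (H ^ 2 / X) * X := by
          rw [integral_add hgi hci, integral_const_mul, integral_finsetSum _ fun j _ => (hblock j).1,
            setIntegral_const, smul_eq_mul, Measure.real, Real.volume_Ioc,
            ENNReal.toReal_ofReal (by linarith)]
          ring
      _ ≤ _ := by
          gcongr
          refine (Finset.sum_le_sum fun j _ => (hblock j).2).trans_eq ?_
          rw [Finset.sum_const, Finset.card_range, nsmul_eq_mul]
  calc _ ≤ (1 / X) * (2 * J * (J * V) + 2 * (H ^ 2 / X) * X) := by gcongr
    _ = 4 * (J:ℝ) ^ 2 * K * X ^ (2 * η) * B + 2 * (H ^ 2 / X) := by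
        rw [hV]; field_simp
        ring
    _ ≤ 4 * (12 * L ^ 2 * X ^ η) * K * X ^ (2 * η) * B + 2 * (H ^ 2 / X) := by gcongr
    _ = 48 * (L ^ 2 * K) * (X ^ η * X ^ (2 * η)) * B + 2 * (H ^ 2 / X) := by ring
    _ = _ := by rw [← Real.rpow_add hX0]; ring_nf

end LargeDivisors

theorem large_divisors_variance :
    ∀ ε : ℝ, ε ∈ Set.Ioo (0 : ℝ) (1 / 100) →
      ∃ K : ℝ, 0 < K ∧
        ∀ X H z : ℝ, 1 ≤ X → X ^ ε ≤ H → H ≤ X ^ ((4 : ℝ) / 7 - ε) →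
          H ^ ((4 : ℝ) / 3 + ε) ≤ z →
            (1 / X) * (∫ x in X..(2 * X),
                |pairShortGT x H z - H * mertensRange z (2 * X)| ^ 2)
              ≤ K * H ^ ((1 : ℝ) / 2 - ε / 8) := by
  intro ε hε
  have hε0 : 0 < ε := hε.1
  have hε1 : ε < 1 / 100 := hε.2
  set η : ℝ := ε ^ 2 / 12 with hη
  have hη0 : 0 < η := by positivity
  obtain ⟨K, hK, hKb⟩ := LargeDivisors.exists_variance_le hη0 (by rw [hη]; nlinarith)
  refine ⟨2 * K + 2, by linarith, fun X H z hX hXH hHX hz => ?_⟩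
  have hX0 : 0 < X := by linarith
  have hH : 1 ≤ H := (Real.one_le_rpow hX hε0.le).trans hXH
  have hH0 : 0 < H := by linarith
  have hHX' : H ≤ X := hHX.trans (by
    calc X ^ ((4:ℝ) / 7 - ε) ≤ X ^ (1:ℝ) := Real.rpow_le_rpow_of_exponent_le hX (by linarith)
      _ = X := Real.rpow_one X)
  have hz1 : 1 ≤ z := (Real.one_le_rpow hH (by linarith)).trans hz
  have hXlow : H ^ (7 / 4 + 3 * ε) ≤ X := by
    calc H ^ (7 / 4 + 3 * ε) ≤ (X ^ ((4:ℝ) / 7 - ε)) ^ (7 / 4 + 3 * ε) :=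
          Real.rpow_le_rpow hH0.le hHX (by linarith)
      _ = X ^ (((4:ℝ) / 7 - ε) * (7 / 4 + 3 * ε)) := by rw [← Real.rpow_mul hX0.le]
      _ ≤ X ^ (1:ℝ) := Real.rpow_le_rpow_of_exponent_le hX (by nlinarith)
      _ = X := Real.rpow_one X
  have hXη : X ^ (3 * η) ≤ H ^ (ε / 4) := by
    calc X ^ (3 * η) = (X ^ ε) ^ (ε / 4) := by
          rw [← Real.rpow_mul hX0.le, hη]; congr 1; ring
      _ ≤ H ^ (ε / 4) := Real.rpow_le_rpow (by positivity) hXH (by linarith)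
  have h1 : H * z ^ (-(3 / 8) : ℝ) ≤ H ^ (1 / 2 - 3 * ε / 8) := by
    calc H * z ^ (-(3 / 8) : ℝ) ≤ H ^ (1:ℝ) * (H ^ ((4:ℝ) / 3 + ε)) ^ (-(3 / 8) : ℝ) := by
          rw [Real.rpow_one]
          exact mul_le_mul_of_nonneg_left
            (Real.rpow_le_rpow_of_nonpos (by positivity) hz (by norm_num)) (by positivity)
      _ = _ := by rw [← Real.rpow_mul hH0.le, ← Real.rpow_add hH0]; congr 1; ring
  have h2 : H ^ (5 / 3 : ℝ) * X ^ (-(2 / 3) : ℝ) ≤ H ^ (1 / 2 - 3 * ε / 8) := by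
    calc H ^ (5 / 3 : ℝ) * X ^ (-(2 / 3) : ℝ)
        ≤ H ^ (5 / 3 : ℝ) * (H ^ (7 / 4 + 3 * ε)) ^ (-(2 / 3) : ℝ) := by
          exact mul_le_mul_of_nonneg_left
            (Real.rpow_le_rpow_of_nonpos (by positivity) hXlow (by norm_num)) (by positivity)
      _ = H ^ (5 / 3 + (7 / 4 + 3 * ε) * (-(2 / 3))) := by
          rw [← Real.rpow_mul hH0.le, ← Real.rpow_add hH0]
      _ ≤ _ := Real.rpow_le_rpow_of_exponent_le hH (by linarith)
  have h3 : H ^ 2 / X ≤ H ^ ((1:ℝ) / 2 - ε / 8) := by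
    rw [div_le_iff₀ hX0]
    calc H ^ 2 = H ^ (2:ℝ) := by rw [← Real.rpow_natCast]; norm_num
      _ ≤ H ^ (((1:ℝ) / 2 - ε / 8) + (7 / 4 + 3 * ε)) :=
          Real.rpow_le_rpow_of_exponent_le hH (by linarith)
      _ = H ^ ((1:ℝ) / 2 - ε / 8) * H ^ (7 / 4 + 3 * ε) := Real.rpow_add hH0 _ _
      _ ≤ _ := by gcongr
  refine (hKb X H z hX hH hHX' hz1).trans ?_
  calc _ ≤ K * H ^ (ε / 4) * (H ^ (1 / 2 - 3 * ε / 8) + H ^ (1 / 2 - 3 * ε / 8))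
        + 2 * H ^ ((1:ℝ) / 2 - ε / 8) := by gcongr
    _ = 2 * K * (H ^ (ε / 4) * H ^ (1 / 2 - 3 * ε / 8)) + 2 * H ^ ((1:ℝ) / 2 - ε / 8) := by ring
    _ = (2 * K + 2) * H ^ ((1 : ℝ) / 2 - ε / 8) := by
        rw [← Real.rpow_add hH0, show ε / 4 + (1 / 2 - 3 * ε / 8) = 1 / 2 - ε / 8 by ring]; ring
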